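/- (Pólya's conjecture for Dirichlet eigenvalues on annuli) For all real numbers 0 < r < R, let Ω = {x ∈ ℝ² : r < |x| < R} be the circular annulus. Then for every integer k ≥ 1, the k-th Dirichlet eigenvalue of the Laplacian on Ω satisfies λ_k(Ω) ≥ 4πk/|Ω| = 4k/(R² − r²), where |Ω| is the area of Ω. -/

import Mathlib

open MeasureTheory Real

/-- The k-th Dirichlet eigenvalue of the Laplacian on `Ω ⊆ ℝⁿ`, defined variationally as
the infimum, over all `k`-dimensional subspaces `E` of the space of smooth compactly
supported functions with support in `Ω`, of the supremum of the Rayleigh quotient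
`(∫_Ω ‖∇u‖²) / (∫_Ω u²)` over nonzero `u ∈ E`. -/
noncomputable def dirichletEig {n : ℕ} (Ω : Set (EuclideanSpace ℝ (Fin n))) (k : ℕ) : ℝ :=
  sInf { r : ℝ | ∃ E : Submodule ℝ (EuclideanSpace ℝ (Fin n) → ℝ),
    Module.finrank ℝ E = k ∧
    (∀ u ∈ E, ContDiff ℝ (⊤ : ℕ∞) u ∧ HasCompactSupport u ∧ tsupport u ⊆ Ω) ∧
    r = sSup { q : ℝ | ∃ u ∈ E, u ≠ (0 : EuclideanSpace ℝ (Fin n) → ℝ) ∧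
        q = (∫ x in Ω, ‖gradient u x‖ ^ 2) / (∫ x in Ω, (u x) ^ 2) } }

/-- The quadratic form of the `m`-th angular mode on the radial interval `[α, β]`. -/
noncomputable def modeForm (m α β : ℝ) (v : ℝ → ℝ) : ℝ :=
  ∫ x in α..β, (x * deriv v x ^ 2 + (m ^ 2 / x - x) * v x ^ 2)

lemma continuousOn_modeForm_integrand (m : ℝ) {v : ℝ → ℝ} (hv : ContDiff ℝ 1 v) :
    ContinuousOn (fun x => x * deriv v x ^ 2 + (m ^ 2 / x - x) * v x ^ 2) (Set.Ioi 0) := by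
  have h1 : Continuous (deriv v) := hv.continuous_deriv le_rfl
  have h2 : Continuous v := hv.continuous
  have h3 : ContinuousOn (fun x : ℝ => m ^ 2 / x) (Set.Ioi 0) :=
    continuousOn_const.div continuousOn_id (fun x hx => (Set.mem_Ioi.1 hx).ne')
  fun_prop

lemma modeForm_add {m α β γ : ℝ} (hα : 0 < α) (h1 : α ≤ β) (h2 : β ≤ γ) {v : ℝ → ℝ}
    (hv : ContDiff ℝ 1 v) :
    modeForm m α γ v = modeForm m α β v + modeForm m β γ v := by
  have hc := continuousOn_modeForm_integrand m hv
  refine (intervalIntegral.integral_add_adjacent_intervals ?_ ?_).symm <;>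
  · refine ContinuousOn.intervalIntegrable (hc.mono ?_)
    rw [Set.uIcc_of_le (by assumption)]
    intro x hx
    have := hx.1
    simp only [Set.mem_Ioi]; linarith

/-- A subsolution `f` of the Riccati equation bounds the mode form from below
by boundary terms. -/
lemma le_modeForm_of_riccati {m α β : ℝ} (hα : 0 < α) (hαβ : α ≤ β) {f f' : ℝ → ℝ}
    (hf : ∀ x ∈ Set.Icc α β, HasDerivAt f (f' x) x)
    (hR : ∀ x ∈ Set.Icc α β, x * f' x + f x ^ 2 + x ^ 2 - m ^ 2 ≤ 0)
    {v : ℝ → ℝ} (hv : ContDiff ℝ 1 v) :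
    f β * v β ^ 2 - f α * v α ^ 2 ≤ modeForm m α β v := by
  set g : ℝ → ℝ := fun x => x * deriv v x ^ 2 + (m ^ 2 / x - x) * v x ^ 2 with hg
  have hc : ContinuousOn g (Set.Ioi 0) := continuousOn_modeForm_integrand m hv
  have hintg : ∀ x ∈ Set.Icc α β, HasDerivAt (fun y => ∫ t in α..y, g t) (g x) x := by
    intro x hx
    have hx0 : 0 < x := hα.trans_le hx.1
    refine intervalIntegral.integral_hasDerivAt_right ?_ ?_ ?_
    · refine ContinuousOn.intervalIntegrable (hc.mono ?_)
      rw [Set.uIcc_of_le hx.1]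
      intro y hy
      exact hα.trans_le hy.1
    · exact hc.stronglyMeasurableAtFilter isOpen_Ioi x hx0
    · exact hc.continuousAt (Ioi_mem_nhds hx0)
  have hvd : ∀ x, HasDerivAt v (deriv v x) x := fun x =>
    (hv.differentiable one_ne_zero x).hasDerivAt
  have hH : ∀ x ∈ Set.Icc α β, HasDerivAt (fun y => (∫ t in α..y, g t) - f y * v y ^ 2)
      (g x - (f' x * v x ^ 2 + f x * (2 * v x * deriv v x))) x := by
    intro x hx
    have := (hintg x hx).sub ((hf x hx).mul ((hvd x).pow 2))
    refine this.congr_deriv ?_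
    simp
  have hmono : MonotoneOn (fun y => (∫ t in α..y, g t) - f y * v y ^ 2) (Set.Icc α β) := by
    refine monotoneOn_of_deriv_nonneg (convex_Icc α β)
      (fun x hx => (hH x hx).continuousAt.continuousWithinAt)
      (fun x hx => (hH x (interior_subset hx)).differentiableAt.differentiableWithinAt) ?_
    intro x hx
    have hx := interior_subset hx
    rw [(hH x hx).deriv]
    have hx0 : 0 < x := hα.trans_le hx.1
    have key : g x - (f' x * v x ^ 2 + f x * (2 * v x * deriv v x)) =
        (x * deriv v x - f x * v x) ^ 2 / x
          - (x * f' x + f x ^ 2 + x ^ 2 - m ^ 2) * v x ^ 2 / x := by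
      simp only [hg]; field_simp; ring
    rw [key]
    have h1 := hR x hx
    have h2 : 0 ≤ (x * deriv v x - f x * v x) ^ 2 / x := by positivity
    have h3 : (x * f' x + f x ^ 2 + x ^ 2 - m ^ 2) * v x ^ 2 / x ≤ 0 :=
      div_nonpos_of_nonpos_of_nonneg (mul_nonpos_of_nonpos_of_nonneg h1 (sq_nonneg _)) hx0.le
    linarith
  have := hmono (Set.left_mem_Icc.2 hαβ) (Set.right_mem_Icc.2 hαβ) hαβ
  simp only [intervalIntegral.integral_same] at this
  unfold modeForm
  linarith

/-- The mode form is nonnegative on functions vanishing at the endpoints and at `n`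
prescribed points. -/
def NonnegModulo (m a b : ℝ) (n : ℕ) : Prop :=
  ∃ S : Finset ℝ, S.card ≤ n ∧ ∀ v : ℝ → ℝ, ContDiff ℝ 1 v → v a = 0 → v b = 0 →
    (∀ x ∈ S, v x = 0) → 0 ≤ modeForm m a b v

lemma NonnegModulo.of_riccati {m α β : ℝ} (hα : 0 < α) (hαβ : α ≤ β) {f f' : ℝ → ℝ}
    (hf : ∀ x ∈ Set.Icc α β, HasDerivAt f (f' x) x)
    (hR : ∀ x ∈ Set.Icc α β, x * f' x + f x ^ 2 + x ^ 2 - m ^ 2 ≤ 0) :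
    NonnegModulo m α β 0 := by
  refine ⟨∅, by simp, fun v hv h1 h2 _ => ?_⟩
  have := le_modeForm_of_riccati hα hαβ hf hR hv
  simpa [h1, h2] using this

lemma NonnegModulo.of_riccati_glue {m α β γ : ℝ} (hα : 0 < α) (hαβ : α ≤ β) (hβγ : β ≤ γ)
    {f f' g g' : ℝ → ℝ}
    (hf : ∀ x ∈ Set.Icc α β, HasDerivAt f (f' x) x)
    (hfR : ∀ x ∈ Set.Icc α β, x * f' x + f x ^ 2 + x ^ 2 - m ^ 2 ≤ 0)
    (hg : ∀ x ∈ Set.Icc β γ, HasDerivAt g (g' x) x)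
    (hgR : ∀ x ∈ Set.Icc β γ, x * g' x + g x ^ 2 + x ^ 2 - m ^ 2 ≤ 0)
    (hfg : g β ≤ f β) :
    NonnegModulo m α γ 0 := by
  refine ⟨∅, by simp, fun v hv h1 h2 _ => ?_⟩
  have h3 := le_modeForm_of_riccati hα hαβ hf hfR hv
  have h4 := le_modeForm_of_riccati (hα.trans_le hαβ) hβγ hg hgR hv
  rw [modeForm_add hα hαβ hβγ hv]
  simp only [h1, h2] at h3 h4
  have : g β * v β ^ 2 ≤ f β * v β ^ 2 := mul_le_mul_of_nonneg_right hfg (sq_nonneg _)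
  linarith

lemma NonnegModulo.mono {m a b : ℝ} {n n' : ℕ} (h : NonnegModulo m a b n) (hn : n ≤ n') :
    NonnegModulo m a b n' := by
  obtain ⟨S, hS, h⟩ := h
  exact ⟨S, hS.trans hn, h⟩

lemma NonnegModulo.trans {m a c b : ℝ} {n n' : ℕ} (ha : 0 < a) (hac : a ≤ c) (hcb : c ≤ b)
    (h : NonnegModulo m a c n) (h' : NonnegModulo m c b n') :
    NonnegModulo m a b (n + n' + 1) := by
  classical
  obtain ⟨S, hS, h⟩ := h
  obtain ⟨S', hS', h'⟩ := h'
  refine ⟨insert c (S ∪ S'), ?_, fun v hv h1 h2 h3 => ?_⟩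
  · have := Finset.card_insert_le c (S ∪ S')
    have := Finset.card_union_le S S'
    omega
  · rw [modeForm_add ha hac hcb hv]
    have hc : v c = 0 := h3 c (by simp)
    exact add_nonneg (h v hv h1 hc fun x hx => h3 x (by simp [hx]))
      (h' v hv hc h2 fun x hx => h3 x (by simp [hx]))

/-- The Debye phase function: `∫ √(x² - m²) / x` from `m` to `x`. -/
noncomputable def debye (m x : ℝ) : ℝ := √(x ^ 2 - m ^ 2) - m * arccos (m / x)

lemma debye_of_le {m x : ℝ} (hx : 0 < x) (h : x ≤ m) : debye m x = 0 := by
  have h1 : x ^ 2 - m ^ 2 ≤ 0 := by nlinarith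
  have h2 : 1 ≤ m / x := by rwa [one_le_div hx]
  simp [debye, sqrt_eq_zero_of_nonpos h1, arccos_of_one_le h2]

lemma debye_zero {x : ℝ} (hx : 0 ≤ x) : debye 0 x = x := by
  simp [debye, sqrt_sq hx]

lemma continuousOn_debye (m : ℝ) : ContinuousOn (debye m) (Set.Ioi 0) := by
  unfold debye
  have h3 : ContinuousOn (fun x : ℝ => m / x) (Set.Ioi 0) :=
    continuousOn_const.div continuousOn_id (fun x hx => (Set.mem_Ioi.1 hx).ne')
  have h4 : ContinuousOn (fun x : ℝ => arccos (m / x)) (Set.Ioi 0) :=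
    continuous_arccos.comp_continuousOn h3
  have h5 : Continuous (fun x : ℝ => √(x ^ 2 - m ^ 2)) := by fun_prop
  exact h5.continuousOn.sub (continuousOn_const.mul h4)

lemma hasDerivAt_sqrt_sq_sub {m x : ℝ} (hm : 0 ≤ m) (hx : m < x) :
    HasDerivAt (fun y => √(y ^ 2 - m ^ 2)) (x / √(x ^ 2 - m ^ 2)) x := by
  have hQ : 0 < x ^ 2 - m ^ 2 := by nlinarith
  have := (((hasDerivAt_id x).pow 2).sub_const (m ^ 2)).sqrt hQ.ne'
  refine this.congr_deriv ?_
  have : 0 < √(x ^ 2 - m ^ 2) := sqrt_pos.2 hQ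
  simp; field_simp

lemma hasDerivAt_debye {m x : ℝ} (hm : 0 ≤ m) (hx : m < x) :
    HasDerivAt (debye m) (√(x ^ 2 - m ^ 2) / x) x := by
  have hx0 : 0 < x := hm.trans_lt hx
  have hQ : 0 < x ^ 2 - m ^ 2 := by nlinarith
  have h1 := hasDerivAt_sqrt_sq_sub hm hx
  have h2 : HasDerivAt (fun y => m / y) (-m / x ^ 2) x := by
    have := (hasDerivAt_const x m).div (hasDerivAt_id x) hx0.ne'
    refine this.congr_deriv ?_
    simp
  have hlt : m / x < 1 := by rwa [div_lt_one hx0]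
  have hge : 0 ≤ m / x := by positivity
  have h3 := (hasDerivAt_arccos (by linarith : m / x ≠ -1) hlt.ne).comp x h2
  have := h1.sub (h3.const_mul m)
  refine this.congr_deriv ?_
  have e : √(1 - (m / x) ^ 2) = √(x ^ 2 - m ^ 2) / x := by
    rw [show 1 - (m / x) ^ 2 = (x ^ 2 - m ^ 2) / x ^ 2 by field_simp,
      sqrt_div hQ.le, sqrt_sq hx0.le]
  rw [e]
  have hs : 0 < √(x ^ 2 - m ^ 2) := sqrt_pos.2 hQ
  field_simp
  rw [sq_sqrt hQ.le]

lemma strictMonoOn_debye {m : ℝ} (hm : 0 ≤ m) : StrictMonoOn (debye m) (Set.Ici m ∩ Set.Ioi 0) := by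
  have hconv : Convex ℝ (Set.Ici m ∩ Set.Ioi 0) := (convex_Ici m).inter (convex_Ioi 0)
  refine strictMonoOn_of_deriv_pos hconv
    ((continuousOn_debye m).mono Set.inter_subset_right) ?_
  intro x hx
  rw [interior_inter, interior_Ici, interior_Ioi] at hx
  rw [(hasDerivAt_debye hm hx.1).deriv]
  have hx1 : m < x := hx.1
  have hx2 : 0 < x := hx.2
  have hQ : 0 < x ^ 2 - m ^ 2 := by nlinarith
  have hs : 0 < √(x ^ 2 - m ^ 2) := sqrt_pos.2 hQ
  positivity

lemma monotoneOn_debye {m : ℝ} (hm : 0 ≤ m) : MonotoneOn (debye m) (Set.Ioi 0) := by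
  intro x hx y hy hxy
  rcases le_total x m with h | h
  · rcases le_total y m with h' | h'
    · rw [debye_of_le hx h, debye_of_le hy h']
    · rw [debye_of_le hx h]
      have hm0 : 0 < m := lt_of_lt_of_le hx h
      have := (strictMonoOn_debye hm).monotoneOn ⟨Set.mem_Ici.2 le_rfl, hm0⟩ ⟨h', hy⟩ h'
      rwa [debye_of_le hm0 le_rfl] at this
  · exact (strictMonoOn_debye hm).monotoneOn ⟨h, hx⟩ ⟨h.trans hxy, hy⟩ hxy

lemma debye_nonneg {m x : ℝ} (hm : 0 ≤ m) (hx : 0 < x) : 0 ≤ debye m x := by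
  rcases le_total x m with h | h
  · rw [debye_of_le hx h]
  · rcases hm.eq_or_lt with rfl | hm0
    · rw [debye_zero hx.le]; exact hx.le
    · have := monotoneOn_debye hm hm0 hx h
      rwa [debye_of_le hm0 le_rfl] at this

lemma debye_pos {m x : ℝ} (hm : 0 ≤ m) (hx : m < x) : 0 < debye m x := by
  have hx0 : 0 < x := hm.trans_lt hx
  have h := strictMonoOn_debye hm (a := (m + x) / 2) (b := x) ⟨by simp; linarith, by simp; linarith⟩
    ⟨hx.le, hx0⟩ (by linarith)
  exact (debye_nonneg hm (by linarith)).trans_lt h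

lemma debye_le_algebraic {m x : ℝ} (hm : 0 ≤ m) (hx : m < x) :
    debye m x ≤ √(x ^ 2 - m ^ 2) ^ 3 / (x * √(x ^ 2 + 4 * m ^ 2)) := by
  have hx0 : 0 < x := hm.trans_lt hx
  rcases hm.eq_or_lt with rfl | hm0
  · rw [debye_zero hx0.le]
    simp only [ne_eq, OfNat.ofNat_ne_zero, not_false_eq_true, zero_pow, sub_zero, mul_zero,
      add_zero, sqrt_sq hx0.le]
    rw [le_div_iff₀ (by positivity)]; nlinarith
  set R : ℝ → ℝ := fun y => √(y ^ 2 - m ^ 2) ^ 3 / (y * √(y ^ 2 + 4 * m ^ 2)) - debye m y with hR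
  have hB : ∀ y : ℝ, 0 < y → HasDerivAt (fun y => √(y ^ 2 + 4 * m ^ 2))
      (y / √(y ^ 2 + 4 * m ^ 2)) y := by
    intro y hy
    have hQ : 0 < y ^ 2 + 4 * m ^ 2 := by positivity
    have := (((hasDerivAt_id y).pow 2).add_const (4 * m ^ 2)).sqrt hQ.ne'
    refine this.congr_deriv ?_
    have : 0 < √(y ^ 2 + 4 * m ^ 2) := sqrt_pos.2 hQ
    simp; field_simp
  have hmono : MonotoneOn R (Set.Ici m) := by
    have hd : ∀ y, m < y → HasDerivAt R
        (((3 * √(y ^ 2 - m ^ 2) ^ 2 * (y / √(y ^ 2 - m ^ 2))) * (y * √(y ^ 2 + 4 * m ^ 2))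
        - √(y ^ 2 - m ^ 2) ^ 3 * (1 * √(y ^ 2 + 4 * m ^ 2) + y * (y / √(y ^ 2 + 4 * m ^ 2))))
          / (y * √(y ^ 2 + 4 * m ^ 2)) ^ 2 - √(y ^ 2 - m ^ 2) / y) y := by
      intro y hy
      have hy0 : 0 < y := hm.trans_lt hy
      have hne : y * √(y ^ 2 + 4 * m ^ 2) ≠ 0 := by positivity
      have h1 := (hasDerivAt_sqrt_sq_sub hm hy).pow 3
      have h2 := (hasDerivAt_id y).mul (hB y hy0)
      exact ((h1.div h2 hne).sub (hasDerivAt_debye hm hy)).congr_deriv (by simp)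
    refine monotoneOn_of_deriv_nonneg (convex_Ici m) ?_ ?_ ?_
    · intro y hy
      have hy0 : 0 < y := hm0.trans_le hy
      refine ContinuousAt.continuousWithinAt ?_
      have hne : y * √(y ^ 2 + 4 * m ^ 2) ≠ 0 := by positivity
      refine ContinuousAt.sub (ContinuousAt.div (by fun_prop) (by fun_prop) hne) ?_
      exact (continuousOn_debye m).continuousAt (Ioi_mem_nhds hy0)
    · intro y hy
      rw [interior_Ici] at hy
      exact (hd y hy).differentiableAt.differentiableWithinAt
    · intro y hy
      rw [interior_Ici] at hy
      rw [(hd y hy).deriv]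
      have hy0 : 0 < y := hm0.trans hy
      have hQ : 0 < y ^ 2 - m ^ 2 := by have : m < y := hy; nlinarith
      have hP : 0 < y ^ 2 + 4 * m ^ 2 := by positivity
      obtain ⟨A, hA⟩ : ∃ A, A = √(y ^ 2 - m ^ 2) := ⟨_, rfl⟩
      obtain ⟨B, hB⟩ : ∃ B, B = √(y ^ 2 + 4 * m ^ 2) := ⟨_, rfl⟩
      have hA0 : 0 < A := hA ▸ sqrt_pos.2 hQ
      have hB0 : 0 < B := hB ▸ sqrt_pos.2 hP
      have hA2 : A ^ 2 = y ^ 2 - m ^ 2 := by rw [hA, sq_sqrt hQ.le]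
      have hB2 : B ^ 2 = y ^ 2 + 4 * m ^ 2 := by rw [hB, sq_sqrt hP.le]
      rw [← hA, ← hB]
      have key : (3 * A ^ 2 * (y / A) * (y * B) - A ^ 3 * (1 * B + y * (y / B))) / (y * B) ^ 2
          - A / y = A / (y ^ 2 * B ^ 3) * ((3 * y ^ 2 * B ^ 2 - A ^ 2 * B ^ 2 - A ^ 2 * y ^ 2)
            - y * B ^ 3) := by
        field_simp
        ring
      rw [key]
      refine mul_nonneg (by positivity) ?_
      have h1 : 3 * y ^ 2 * B ^ 2 - A ^ 2 * B ^ 2 - A ^ 2 * y ^ 2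
          = y ^ 4 + 10 * y ^ 2 * m ^ 2 + 4 * m ^ 4 := by rw [hA2, hB2]; ring
      rw [h1, sub_nonneg]
      refine le_of_sq_le_sq ?_ (by positivity)
      have h2 : (y * B ^ 3) ^ 2 = y ^ 2 * (y ^ 2 + 4 * m ^ 2) ^ 3 := by rw [← hB2]; ring
      rw [h2]
      have : (y ^ 4 + 10 * y ^ 2 * m ^ 2 + 4 * m ^ 4) ^ 2 - y ^ 2 * (y ^ 2 + 4 * m ^ 2) ^ 3
        = 8 * y ^ 6 * m ^ 2 + 60 * y ^ 4 * m ^ 4 + 16 * y ^ 2 * m ^ 6 + 16 * m ^ 8 := by ring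
      have : 0 ≤ 8 * y ^ 6 * m ^ 2 + 60 * y ^ 4 * m ^ 4 + 16 * y ^ 2 * m ^ 6 + 16 * m ^ 8 := by
        positivity
      linarith
  have h0 : R m = 0 := by simp [hR, debye_of_le hm0 le_rfl]
  have := hmono (Set.mem_Ici.2 le_rfl) (Set.mem_Ici.2 hx.le) hx.le
  rw [h0] at this
  simp only [hR] at this
  linarith

lemma debye_sq_mul_le {m x : ℝ} (hm : 0 ≤ m) (hx : m < x) :
    (4 * m ^ 2 * x ^ 2 + x ^ 4) * debye m x ^ 2 ≤ (x ^ 2 - m ^ 2) ^ 3 := by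
  have hx0 : 0 < x := hm.trans_lt hx
  have hQ : 0 < x ^ 2 - m ^ 2 := by nlinarith
  have h1 := debye_le_algebraic hm hx
  have hP : 0 < x ^ 2 + 4 * m ^ 2 := by positivity
  rw [le_div_iff₀ (by positivity)] at h1
  have h2 := pow_le_pow_left₀ (by have := debye_nonneg hm hx0; positivity) h1 2
  have e1 : (debye m x * (x * √(x ^ 2 + 4 * m ^ 2))) ^ 2
      = (4 * m ^ 2 * x ^ 2 + x ^ 4) * debye m x ^ 2 := by
    rw [mul_pow, mul_pow, sq_sqrt hP.le]; ring
  have e2 : (√(x ^ 2 - m ^ 2) ^ 3) ^ 2 = (x ^ 2 - m ^ 2) ^ 3 := by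
    rw [← pow_mul, mul_comm, pow_mul, sq_sqrt hQ.le]
  rwa [e1, e2] at h2

/-- Liouville transformation: Riccati subsolutions for `D²y + (1 + 1/(4τ²)) y = 0` in the
Debye phase `τ` give Riccati subsolutions for the mode form. -/
lemma NonnegModulo.of_debye_riccati {m α β : ℝ} (hm : 0 ≤ m) (hα : m < α) (hαβ : α ≤ β)
    {F F' : ℝ → ℝ}
    (hF : ∀ τ ∈ Set.Icc (debye m α) (debye m β), HasDerivAt F (F' τ) τ)
    (hR : ∀ τ ∈ Set.Icc (debye m α) (debye m β),
      F' τ + F τ ^ 2 + 1 + 1 / (4 * τ ^ 2) ≤ 0) :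
    NonnegModulo m α β 0 := by
  have hα0 : 0 < α := hm.trans_lt hα
  refine NonnegModulo.of_riccati hα0 hαβ
    (f := fun x => √(x ^ 2 - m ^ 2) * F (debye m x) - x ^ 2 / (2 * (x ^ 2 - m ^ 2)))
    (f' := fun x => (x / √(x ^ 2 - m ^ 2)) * F (debye m x)
      + √(x ^ 2 - m ^ 2) * (F' (debye m x) * (√(x ^ 2 - m ^ 2) / x))
      + m ^ 2 * x / (x ^ 2 - m ^ 2) ^ 2) ?_ ?_
  · intro x hx
    have hxm : m < x := hα.trans_le hx.1
    have hx0 : 0 < x := hm.trans_lt hxm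
    have hQ : 0 < x ^ 2 - m ^ 2 := by nlinarith
    have hmem : debye m x ∈ Set.Icc (debye m α) (debye m β) :=
      ⟨monotoneOn_debye hm hα0 hx0 hx.1, monotoneOn_debye hm hx0 (hx0.trans_le hx.2) hx.2⟩
    have h1 := (hasDerivAt_sqrt_sq_sub hm hxm).mul
      ((hF _ hmem).comp x (hasDerivAt_debye hm hxm))
    have h2 := ((hasDerivAt_id x).pow 2).div
      ((((hasDerivAt_id x).pow 2).sub_const (m ^ 2)).const_mul 2) (by simp; exact hQ.ne')
    refine (h1.sub h2).congr_deriv ?_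
    simp only [Function.comp, id, Pi.pow_apply]
    field_simp
    ring
  · intro x hx
    have hxm : m < x := hα.trans_le hx.1
    have hx0 : 0 < x := hm.trans_lt hxm
    have hQ : 0 < x ^ 2 - m ^ 2 := by nlinarith
    have hmem : debye m x ∈ Set.Icc (debye m α) (debye m β) :=
      ⟨monotoneOn_debye hm hα0 hx0 hx.1, monotoneOn_debye hm hx0 (hx0.trans_le hx.2) hx.2⟩
    have h1 := hR _ hmem
    have h2 := debye_sq_mul_le hm hxm
    have hτ := debye_pos hm hxm
    obtain ⟨τ, hτe⟩ : ∃ τ, τ = debye m x := ⟨_, rfl⟩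
    obtain ⟨q, hq⟩ : ∃ q, q = √(x ^ 2 - m ^ 2) := ⟨_, rfl⟩
    have hq0 : 0 < q := hq ▸ sqrt_pos.2 hQ
    have hq2 : x ^ 2 - m ^ 2 = q ^ 2 := by rw [hq, sq_sqrt hQ.le]
    simp only [← hτe, ← hq] at h1 h2 hτ ⊢
    rw [hq2] at h2 ⊢
    have key : x * (x / q * F τ + q * (F' τ * (q / x)) + m ^ 2 * x / (q ^ 2) ^ 2)
        + (q * F τ - x ^ 2 / (2 * q ^ 2)) ^ 2 + x ^ 2 - m ^ 2
        = q ^ 2 * (F' τ + F τ ^ 2 + 1) + (4 * m ^ 2 * x ^ 2 + x ^ 4) / (4 * q ^ 4)  := by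
      rw [add_sub_assoc, hq2]
      field_simp
      ring
    rw [key]
    have h3 : (4 * m ^ 2 * x ^ 2 + x ^ 4) / (4 * q ^ 4) ≤ q ^ 2 * (1 / (4 * τ ^ 2)) := by
      rw [div_le_iff₀ (by positivity)]
      have : q ^ 2 * (1 / (4 * τ ^ 2)) * (4 * q ^ 4) = (q ^ 2) ^ 3 / τ ^ 2 := by
        field_simp
      rw [this, le_div_iff₀ (by positivity)]
      exact h2
    have h4 := mul_le_mul_of_nonneg_left h1 (sq_nonneg q)
    nlinarith

/-- `ψ` is a phase function, with frequency `ω` and logarithmic amplitude derivative `h`,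
for `D²y + (1 + 1/(4τ²)) y = 0`. -/
structure IsDebyePhase (ψ ω h h' : ℝ → ℝ) : Prop where
  phase : ∀ τ, 0 < τ → HasDerivAt ψ (ω τ) τ
  freq : ∀ τ, 0 < τ → HasDerivAt ω (-(2 * h τ * ω τ)) τ
  amp : ∀ τ, 0 < τ → HasDerivAt h (h' τ) τ
  pos : ∀ τ, 0 < τ → 0 < ω τ
  riccati : ∀ τ, 0 < τ → h' τ + h τ ^ 2 + 1 + 1 / (4 * τ ^ 2) ≤ ω τ ^ 2

namespace IsDebyePhase

variable {ψ ω h h' : ℝ → ℝ}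

lemma monotoneOn (H : IsDebyePhase ψ ω h h') : MonotoneOn ψ (Set.Ioi 0) := by
  refine monotoneOn_of_deriv_nonneg (convex_Ioi 0)
    (fun τ hτ => (H.phase τ hτ).continuousAt.continuousWithinAt)
    (fun τ hτ => (H.phase τ (interior_subset hτ)).differentiableAt.differentiableWithinAt) ?_
  intro τ hτ
  have hτ := interior_subset hτ
  rw [(H.phase τ hτ).deriv]
  exact (H.pos τ hτ).le

lemma nonneg_of_lt_pi (H : IsDebyePhase ψ ω h h') {m : ℝ} (hm : 0 ≤ m) {α β : ℝ} (hα : m < α)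
    (hαβ : α ≤ β) (hn : ψ (debye m β) - ψ (debye m α) < π) : NonnegModulo m α β 0 := by
  have hτα := debye_pos hm hα
  set φ := (ψ (debye m α) + ψ (debye m β)) / 2 with hφ
  have hmem : ∀ τ ∈ Set.Icc (debye m α) (debye m β), 0 < τ ∧ 0 < cos (ψ τ - φ) := by
    intro τ hτ
    have h0 : 0 < τ := hτα.trans_le hτ.1
    refine ⟨h0, cos_pos_of_mem_Ioo ⟨?_, ?_⟩⟩
    · have := H.monotoneOn hτα h0 hτ.1
      linarith
    · have := H.monotoneOn h0 (h0.trans_le hτ.2) hτ.2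
      linarith
  refine NonnegModulo.of_debye_riccati hm hα hαβ (F := fun τ => h τ - ω τ * tan (ψ τ - φ))
    (F' := fun τ => h' τ - (-(2 * h τ * ω τ) * tan (ψ τ - φ)
      + ω τ * (1 / cos (ψ τ - φ) ^ 2 * ω τ))) ?_ ?_
  · intro τ hτ
    obtain ⟨h0, hc⟩ := hmem τ hτ
    have h1 : HasDerivAt (fun τ => tan (ψ τ - φ)) (1 / cos (ψ τ - φ) ^ 2 * ω τ) τ :=
      HasDerivAt.comp (h₂ := tan) τ (hasDerivAt_tan hc.ne') ((H.phase τ h0).sub_const φ)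
    exact (H.amp τ h0).sub ((H.freq τ h0).mul h1)
  · intro τ hτ
    obtain ⟨h0, hc⟩ := hmem τ hτ
    have h1 := H.riccati τ h0
    have h2 : 1 / cos (ψ τ - φ) ^ 2 = 1 + tan (ψ τ - φ) ^ 2 := by
      rw [div_eq_iff (by positivity), one_add_tan_sq_mul_cos_sq_eq_one hc.ne']
    rw [h2]
    nlinarith

/-- The phase increment bounds the number of zero conditions needed. -/
lemma nonnegModulo (H : IsDebyePhase ψ ω h h') {m : ℝ} (hm : 0 ≤ m) (n : ℕ) {α β : ℝ}
    (hα : m < α) (hαβ : α ≤ β) (hn : ψ (debye m β) - ψ (debye m α) < (n + 1) * π) :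
    NonnegModulo m α β n := by
  induction n generalizing α with
  | zero => exact H.nonneg_of_lt_pi hm hα hαβ (by simpa using hn)
  | succ n ih =>
    set Δ := ψ (debye m β) - ψ (debye m α) with hΔ
    have hα0 : 0 < α := hm.trans_lt hα
    have hτα := debye_pos hm hα
    have hτβ : debye m α ≤ debye m β := monotoneOn_debye hm hα0 (hα0.trans_le hαβ) hαβ
    have hΔ0 : 0 ≤ Δ := sub_nonneg.2 (H.monotoneOn hτα (hτα.trans_le hτβ) hτβ)
    have hcont : ContinuousOn (fun x => ψ (debye m x)) (Set.Icc α β) := by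
      refine ContinuousOn.comp (t := Set.Ioi 0)
        (fun τ hτ => (H.phase τ hτ).continuousAt.continuousWithinAt)
        ((continuousOn_debye m).mono fun x hx => hα0.trans_le hx.1)
        (fun x hx => debye_pos hm (hα.trans_le hx.1))
    have hn2 : (0 : ℝ) < n + 2 := by positivity
    have hmem : ψ (debye m α) + Δ / (n + 2) ∈
        Set.Icc (ψ (debye m α)) (ψ (debye m β)) := by
      constructor
      · have : 0 ≤ Δ / (n + 2) := by positivity
        linarith
      · have : Δ / (n + 2) ≤ Δ := div_le_self hΔ0 (by linarith [n.cast_nonneg (α := ℝ)])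
        linarith
    obtain ⟨c, hc, hceq⟩ := intermediate_value_Icc hαβ hcont hmem
    simp only at hceq
    push_cast at hn
    have hn' : Δ / (n + 2) < π := by
      rw [div_lt_iff₀ hn2]; linarith
    have h1 : NonnegModulo m α c 0 := H.nonneg_of_lt_pi hm hα hc.1 (by linarith)
    have h2 : NonnegModulo m c β n := by
      refine ih (hα.trans_le hc.1) hc.2 ?_
      have : ψ (debye m β) - ψ (debye m c) = (n + 1) * (Δ / (n + 2)) := by
        rw [hceq]; field_simp; linarith
      rw [this]
      exact mul_lt_mul_of_pos_left hn' (by positivity)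
    simpa using h1.trans hα0 hc.1 hc.2 h2

end IsDebyePhase

lemma isDebyePhase_rational : IsDebyePhase (fun τ => τ - 1 / (8 * τ))
    (fun τ => 1 + 1 / (8 * τ ^ 2)) (fun τ => 1 / (τ * (8 * τ ^ 2 + 1)))
    (fun τ => -(24 * τ ^ 2 + 1) / (τ * (8 * τ ^ 2 + 1)) ^ 2) where
  phase τ hτ := by
    have := (hasDerivAt_id τ).sub ((hasDerivAt_const τ (1 : ℝ)).div
      ((hasDerivAt_id τ).const_mul 8) (by simp; exact hτ.ne'))
    refine this.congr_deriv ?_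
    simp; field_simp; ring
  freq τ hτ := by
    have := ((hasDerivAt_const τ (1 : ℝ)).div
      (((hasDerivAt_id τ).pow 2).const_mul 8) (by simp; exact hτ.ne')).const_add 1
    refine this.congr_deriv ?_
    have : 8 * τ ^ 2 + 1 ≠ 0 := by positivity
    simp; field_simp
  amp τ hτ := by
    have h1 : τ * (8 * τ ^ 2 + 1) ≠ 0 := by positivity
    have := (hasDerivAt_const τ (1 : ℝ)).div ((hasDerivAt_id τ).mul
      ((((hasDerivAt_id τ).pow 2).const_mul 8).add_const 1)) h1
    refine this.congr_deriv ?_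
    simp; field_simp; ring
  pos τ hτ := by positivity
  riccati τ hτ := by
    have h1 : 0 < 8 * τ ^ 2 + 1 := by positivity
    have e : (1 + 1 / (8 * τ ^ 2)) ^ 2 - (-(24 * τ ^ 2 + 1) / (τ * (8 * τ ^ 2 + 1)) ^ 2
      + (1 / (τ * (8 * τ ^ 2 + 1))) ^ 2 + 1 + 1 / (4 * τ ^ 2))
      = 24 / (8 * τ ^ 2 + 1) ^ 2 + 1 / (64 * τ ^ 4) := by
      field_simp; ring
    have : 0 ≤ 24 / (8 * τ ^ 2 + 1) ^ 2 + 1 / (64 * τ ^ 4) := by positivity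
    linarith

lemma isDebyePhase_arsinh : IsDebyePhase (fun τ => (√(4 * τ ^ 2 + 1) - arsinh (1 / (2 * τ))) / 2)
    (fun τ => √(4 * τ ^ 2 + 1) / (2 * τ)) (fun τ => 1 / (2 * τ * (4 * τ ^ 2 + 1)))
    (fun τ => -(24 * τ ^ 2 + 2) / (2 * τ * (4 * τ ^ 2 + 1)) ^ 2) where
  phase τ hτ := by
    have hP : 0 < 4 * τ ^ 2 + 1 := by positivity
    have h1 := ((((hasDerivAt_id τ).pow 2).const_mul 4).add_const 1).sqrt hP.ne'
    have h2 := (hasDerivAt_const τ (1 : ℝ)).div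
      ((hasDerivAt_id τ).const_mul 2) (by simp; exact hτ.ne')
    have := (h1.sub ((hasDerivAt_arsinh (1 / (2 * τ))).comp τ h2)).div_const 2
    refine this.congr_deriv ?_
    have e : √(1 + (1 / (2 * τ)) ^ 2) = √(4 * τ ^ 2 + 1) / (2 * τ) := by
      rw [show 1 + (1 / (2 * τ)) ^ 2 = (4 * τ ^ 2 + 1) / (2 * τ) ^ 2 by field_simp; ring,
        sqrt_div hP.le, sqrt_sq (by positivity)]
    have hs : 0 < √(4 * τ ^ 2 + 1) := sqrt_pos.2 hP
    have hs2 := sq_sqrt hP.le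
    simp only [id, Pi.pow_apply, e]
    field_simp
    rw [hs2]
    norm_num
    ring
  freq τ hτ := by
    have hP : 0 < 4 * τ ^ 2 + 1 := by positivity
    have h1 := ((((hasDerivAt_id τ).pow 2).const_mul 4).add_const 1).sqrt hP.ne'
    have := h1.div ((hasDerivAt_id τ).const_mul 2) (by simp; exact hτ.ne')
    refine this.congr_deriv ?_
    have hs : 0 < √(4 * τ ^ 2 + 1) := sqrt_pos.2 hP
    have hs2 := sq_sqrt hP.le
    simp only [id, Pi.pow_apply]
    field_simp
    rw [hs2]
    ring
  amp τ hτ := by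
    have h1 : 2 * τ * (4 * τ ^ 2 + 1) ≠ 0 := by positivity
    have := (hasDerivAt_const τ (1 : ℝ)).div (((hasDerivAt_id τ).const_mul 2).mul
      ((((hasDerivAt_id τ).pow 2).const_mul 4).add_const 1)) h1
    refine this.congr_deriv ?_
    simp; field_simp; ring
  pos τ hτ := by positivity
  riccati τ hτ := by
    have h1 : 0 < 4 * τ ^ 2 + 1 := by positivity
    rw [div_pow (√(4 * τ ^ 2 + 1)), sq_sqrt h1.le]
    have e : (4 * τ ^ 2 + 1) / (2 * τ) ^ 2 - (-(24 * τ ^ 2 + 2) / (2 * τ * (4 * τ ^ 2 + 1)) ^ 2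
      + (1 / (2 * τ * (4 * τ ^ 2 + 1))) ^ 2 + 1 + 1 / (4 * τ ^ 2))
      = (24 * τ ^ 2 + 1) / (2 * τ * (4 * τ ^ 2 + 1)) ^ 2 := by
      field_simp; ring
    have : 0 ≤ (24 * τ ^ 2 + 1) / (2 * τ * (4 * τ ^ 2 + 1)) ^ 2 := by positivity
    linarith

lemma arsinh_phase_le {τ : ℝ} (hτ : 0 < τ) :
    (√(4 * τ ^ 2 + 1) - arsinh (1 / (2 * τ))) / 2 ≤ τ := by
  have hP : 0 < 4 * τ ^ 2 + 1 := by positivity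
  obtain ⟨s, hs⟩ : ∃ s, s = √(4 * τ ^ 2 + 1) := ⟨_, rfl⟩
  have hs0 : 0 < s := hs ▸ sqrt_pos.2 hP
  have hs2 : s ^ 2 = 4 * τ ^ 2 + 1 := by rw [hs, sq_sqrt hP.le]
  have e : √(1 + (1 / (2 * τ)) ^ 2) = s / (2 * τ) := by
    rw [show 1 + (1 / (2 * τ)) ^ 2 = (4 * τ ^ 2 + 1) / (2 * τ) ^ 2 by field_simp; ring,
      sqrt_div hP.le, sqrt_sq (by positivity), hs]
  have h1 : s - 2 * τ ≤ arsinh (1 / (2 * τ)) := by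
    rw [arsinh, e, le_log_iff_exp_le (by positivity)]
    have hd : s - 2 * τ = 1 / (s + 2 * τ) := by
      rw [eq_div_iff (by positivity)]; linarith [sq_nonneg s, hs2, (by ring : (s - 2 * τ) * (s + 2 * τ) = s ^ 2 - 4 * τ ^ 2)]
    have hd0 : 0 < s - 2 * τ := by rw [hd]; positivity
    have hd1 : s - 2 * τ < 1 := by
      rw [hd, div_lt_one (by positivity)]; nlinarith
    have h3 : exp (s - 2 * τ) ≤ 1 / (1 - (s - 2 * τ)) := by
      have h4 := add_one_le_exp (-(s - 2 * τ))
      rw [exp_neg] at h4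
      rw [le_div_iff₀ (by linarith)]
      have h5 := exp_pos (s - 2 * τ)
      calc exp (s - 2 * τ) * (1 - (s - 2 * τ)) ≤ exp (s - 2 * τ) * (exp (s - 2 * τ))⁻¹ :=
            mul_le_mul_of_nonneg_left (by linarith) h5.le
        _ = 1 := mul_inv_cancel₀ h5.ne'
    refine h3.trans ?_
    rw [← add_div, div_le_div_iff₀ (by linarith) (by positivity)]
    nlinarith
  rw [← hs]
  linarith

lemma le_arsinh_phase {τ : ℝ} (hτ : 74 / 1000 ≤ τ) :
    τ - 7 / 25 * π ≤ (√(4 * τ ^ 2 + 1) - arsinh (1 / (2 * τ))) / 2 := by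
  have hτ0 : 0 < τ := by linarith
  set ψ : ℝ → ℝ := fun τ => (√(4 * τ ^ 2 + 1) - arsinh (1 / (2 * τ))) / 2 with hψ
  have hmono : MonotoneOn (fun τ => ψ τ - τ) (Set.Ioi 0) := by
    have hd : ∀ x, 0 < x → HasDerivAt (fun τ => ψ τ - τ) (√(4 * x ^ 2 + 1) / (2 * x) - 1) x :=
      fun x hx => (isDebyePhase_arsinh.phase x hx).sub (hasDerivAt_id x)
    refine monotoneOn_of_deriv_nonneg (convex_Ioi 0)
      (fun x hx => (hd x hx).continuousAt.continuousWithinAt)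
      (fun x hx => (hd x (interior_subset hx)).differentiableAt.differentiableWithinAt) ?_
    intro x hx
    have hx : 0 < x := interior_subset hx
    rw [(hd x hx).deriv, sub_nonneg, le_div_iff₀ (by positivity)]
    exact le_sqrt_of_sq_le (by nlinarith)
  have h1 := hmono (a := 74 / 1000) (b := τ) (by norm_num) hτ0 hτ
  have h2 : -(7 / 25 * π) ≤ ψ (74 / 1000) - 74 / 1000 := by
    simp only [hψ]
    have h3 : (1.0108 : ℝ) ≤ √(4 * (74 / 1000) ^ 2 + 1) := le_sqrt_of_sq_le (by norm_num)
    have h4 : arsinh (1 / (2 * (74 / 1000))) ≤ 2.62 := by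
      have h5 : √(1 + (1 / (2 * (74 / 1000)) : ℝ) ^ 2) ≤ 6.84 := by
        rw [sqrt_le_iff]; norm_num
      have h6 : (1 / (2 * (74 / 1000)) : ℝ) + √(1 + (1 / (2 * (74 / 1000)) : ℝ) ^ 2) ≤ 13.6 := by
        have : (1 / (2 * (74 / 1000)) : ℝ) ≤ 6.76 := by norm_num
        linarith
      rw [arsinh, log_le_iff_le_exp (by positivity)]
      refine h6.trans ?_
      have h7 : exp 2.62 ^ 50 = exp 1 ^ 131 := by
        rw [← exp_nat_mul, ← exp_nat_mul]; norm_num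
      refine le_of_pow_le_pow_left₀ (n := 50) (by norm_num) (exp_pos _).le ?_
      rw [h7]
      calc (13.6 : ℝ) ^ 50 ≤ 2.7182818283 ^ 131 := by norm_num
        _ ≤ exp 1 ^ 131 := pow_le_pow_left₀ (by norm_num) exp_one_gt_d9.le _
    have := pi_gt_d4
    linarith
  have h6 : τ - 7 / 25 * π ≤ ψ τ := by linarith
  exact h6

/-- Mode bound when the interval starts beyond the turning point, away from it. -/
lemma nonnegModulo_of_debye_ge {m a b : ℝ} (hm : 0 ≤ m) (ha : m < a) (hab : a ≤ b)
    (hτ : 74 / 1000 ≤ debye m a) {n : ℕ}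
    (hn : (debye m b - debye m a) / π + 7 / 25 < n + 1) : NonnegModulo m a b n := by
  refine isDebyePhase_arsinh.nonnegModulo hm n ha hab ?_
  have h1 := arsinh_phase_le (debye_pos hm (ha.trans_le hab))
  have h2 := le_arsinh_phase hτ
  have hp := pi_pos
  have h3 : debye m b - debye m a < (n + 1 - 7 / 25) * π := by
    rw [← div_lt_iff₀ hp]; linarith
  linarith

lemma lobe_pos {τ : ℝ} (h0 : 0 < τ) (h1 : τ ≤ 2389 / 1000) :
    0 < 1 - τ ^ 2 / 4 + τ ^ 4 / 64 - τ ^ 6 / 2304 := by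
  obtain ⟨s, hs⟩ : ∃ s, s = τ ^ 2 := ⟨_, rfl⟩
  have h2 : s ≤ (2389 / 1000) ^ 2 := by rw [hs]; exact pow_le_pow_left₀ h0.le h1 2
  have h3 : 0 < s := by rw [hs]; positivity
  have e : 1 - τ ^ 2 / 4 + τ ^ 4 / 64 - τ ^ 6 / 2304 = 1 - s / 4 + s ^ 2 / 64 - s ^ 3 / 2304 := by
    rw [hs]; ring
  rw [e]
  obtain ⟨d, hd⟩ : ∃ d, d = (2389 / 1000) ^ 2 - s := ⟨_, rfl⟩
  have hd0 : 0 ≤ d := by linarith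
  have hs' : s = (2389 / 1000) ^ 2 - d := by linarith
  have h4 : 0 ≤ d * (1 / 4 - (2 * s + d) / 64 + (s ^ 2 + s * (s + d) + (s + d) ^ 2) / 2304) := by
    refine mul_nonneg hd0 ?_
    nlinarith [sq_nonneg (2 * s + d - 24), sq_nonneg d]
  have h5 : (0:ℝ) < 1 - (s + d) / 4 + (s + d) ^ 2 / 64 - (s + d) ^ 3 / 2304 := by
    have : s + d = (2389 / 1000) ^ 2 := by linarith
    rw [this]; norm_num
  nlinarith

lemma nonnegModulo_lobe {m a b : ℝ} (hm : 0 ≤ m) (ha : m < a) (hab : a ≤ b)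
    (hτ : debye m b ≤ 2389 / 1000) : NonnegModulo m a b 0 := by
  have hτa := debye_pos hm ha
  refine NonnegModulo.of_debye_riccati hm ha hab
    (F := fun τ => 1 / (2 * τ) + (-τ / 2 + τ ^ 3 / 16 - τ ^ 5 / 384) /
      (1 - τ ^ 2 / 4 + τ ^ 4 / 64 - τ ^ 6 / 2304))
    (F' := fun τ => -1 / (2 * τ ^ 2) + ((-1 / 2 + 3 * τ ^ 2 / 16 - 5 * τ ^ 4 / 384) *
      (1 - τ ^ 2 / 4 + τ ^ 4 / 64 - τ ^ 6 / 2304) - (-τ / 2 + τ ^ 3 / 16 - τ ^ 5 / 384) ^ 2) /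
      (1 - τ ^ 2 / 4 + τ ^ 4 / 64 - τ ^ 6 / 2304) ^ 2) ?_ ?_
  · intro τ hτ'
    have h0 : 0 < τ := hτa.trans_le hτ'.1
    have hp := lobe_pos h0 (hτ'.2.trans hτ)
    have hid := hasDerivAt_id τ
    have h1 := (hasDerivAt_const τ (1 : ℝ)).div (hid.const_mul 2) (by simp; exact h0.ne')
    have h2 := ((hid.neg.div_const 2).add ((hid.pow 3).div_const 16)).sub
      ((hid.pow 5).div_const 384)
    have h3 := (((hasDerivAt_const τ (1 : ℝ)).sub ((hid.pow 2).div_const 4)).add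
      ((hid.pow 4).div_const 64)).sub ((hid.pow 6).div_const 2304)
    refine (h1.add (h2.div h3 (by simpa using hp.ne'))).congr_deriv ?_
    simp
    congr 1
    · field_simp
    · congr 1; ring
  · intro τ hτ'
    have h0 : 0 < τ := hτa.trans_le hτ'.1
    have hp := lobe_pos h0 (hτ'.2.trans hτ)
    obtain ⟨p, hpe⟩ : ∃ p, p = 1 - τ ^ 2 / 4 + τ ^ 4 / 64 - τ ^ 6 / 2304 := ⟨_, rfl⟩
    simp only [← hpe] at hp ⊢
    have key : -1 / (2 * τ ^ 2) + ((-1 / 2 + 3 * τ ^ 2 / 16 - 5 * τ ^ 4 / 384) * p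
        - (-τ / 2 + τ ^ 3 / 16 - τ ^ 5 / 384) ^ 2) / p ^ 2
        + (1 / (2 * τ) + (-τ / 2 + τ ^ 3 / 16 - τ ^ 5 / 384) / p) ^ 2 + 1 + 1 / (4 * τ ^ 2)
        = ((-1 / 2 + 3 * τ ^ 2 / 16 - 5 * τ ^ 4 / 384)
          + (-1 / 2 + τ ^ 2 / 16 - τ ^ 4 / 384) + p) / p := by
      field_simp; ring
    rw [key]
    refine div_nonpos_of_nonpos_of_nonneg ?_ hp.le
    have : (-1 / 2 + 3 * τ ^ 2 / 16 - 5 * τ ^ 4 / 384)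
          + (-1 / 2 + τ ^ 2 / 16 - τ ^ 4 / 384) + p = - τ ^ 6 / 2304 := by
      rw [hpe]; ring
    rw [this]
    have : 0 < τ ^ 6 := by positivity
    linarith

lemma exists_debye_eq {m a b τ : ℝ} (ha : 0 < a) (hab : a ≤ b)
    (h1 : debye m a ≤ τ) (h2 : τ ≤ debye m b) : ∃ x ∈ Set.Icc a b, debye m x = τ :=
  intermediate_value_Icc hab ((continuousOn_debye m).mono fun _ hx => ha.trans_le hx.1) ⟨h1, h2⟩

/-- Continuation beyond a point where the Debye phase is large enough. -/
lemma nonnegModulo_rational {m x b σ : ℝ} (hm : 0 ≤ m) (hx : m < x) (hxb : x ≤ b) {n : ℕ}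
    (hσ : σ ≤ debye m x - 1 / (8 * debye m x)) (hn : debye m b - σ < (n + 1) * π) :
    NonnegModulo m x b n := by
  refine isDebyePhase_rational.nonnegModulo hm n hx hxb ?_
  have h1 := debye_pos hm (hx.trans_le hxb)
  have : 0 < 1 / (8 * debye m b) := by positivity
  linarith

lemma nonnegModulo_of_debye_lt {m a b : ℝ} (hm : 0 ≤ m) (ha : m < a) (hab : a ≤ b)
    (hτ : debye m a < 74 / 1000) {n : ℕ}
    (hn : (debye m b - debye m a) / π + 7 / 25 < n + 1) : NonnegModulo m a b n := by
  have ha0 : 0 < a := hm.trans_lt ha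
  rcases le_or_gt (debye m b) (2389 / 1000) with h | h
  · exact (nonnegModulo_lobe hm ha hab h).mono (Nat.zero_le _)
  obtain ⟨x, hx, hxe⟩ := exists_debye_eq ha0 hab (τ := 2389 / 1000) (by linarith) h.le
  have hp := pi_pos
  have h3 : debye m b - debye m a < (n + 1 - 7 / 25) * π := by
    rw [← div_lt_iff₀ hp]; linarith
  have hp1 := pi_gt_d4
  have hp2 := pi_lt_d4
  rcases n with _ | n
  · norm_num at h3
    linarith
  · have h4 := nonnegModulo_lobe hm ha hx.1 hxe.le
    have h5 : NonnegModulo m x b n := by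
      refine nonnegModulo_rational hm (ha.trans_le hx.1) hx.2 (σ := 18 / 25 * π + 74 / 1000) ?_ ?_
      · rw [hxe]; norm_num; linarith
      · push_cast at h3; linarith
    simpa using h4.trans ha0 hx.1 hx.2 h5

lemma airy_quintic_nonneg {t : ℝ} (h : t ≤ 134 / 100) :
    0 ≤ (1 + 84 / 100 * t - 2 * t * (1 - 21 / 100 * t) - (1 - 21 / 100 * t) ^ 6) * t := by
  have e : (1 + 84 / 100 * t - 2 * t * (1 - 21 / 100 * t) - (1 - 21 / 100 * t) ^ 6) * t =
      t ^ 2 * (1 / 10 - 483 / 2000 * t + 18522 / 100000 * t ^ 2 - 2917215 / 100000000 * t ^ 3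
        + 6 * (21 / 100) ^ 5 * t ^ 4 - (21 / 100) ^ 6 * t ^ 5) := by ring
  rw [e]
  refine mul_nonneg (sq_nonneg _) ?_
  rcases le_total t 0 with h0 | h0
  · have h1 : 0 ≤ -t := by linarith
    have h2 : 0 ≤ (-t) ^ 3 := by positivity
    have h3 : 0 ≤ (-t) ^ 5 := by positivity
    have h4 : 0 ≤ t ^ 4 := by positivity
    have h5 : 0 ≤ t ^ 2 := by positivity
    have e3 : (-t) ^ 3 = - t ^ 3 := by ring
    have e5 : (-t) ^ 5 = - t ^ 5 := by ring
    rw [e3] at h2; rw [e5] at h3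
    linarith
  · have h1 : 0 ≤ t ^ 4 * (6 * (21 / 100) ^ 5 - (21 / 100) ^ 6 * t) :=
      mul_nonneg (by positivity) (by nlinarith)
    have h2 : 0 ≤ 1 / 10 - 483 / 2000 * t + 18522 / 100000 * t ^ 2
        - 2917215 / 100000000 * t ^ 3 := by
      nlinarith [mul_nonneg h0 (sq_nonneg (t - 8 / 10)), sq_nonneg (t - 8 / 10),
        mul_nonneg (sub_nonneg.2 h) (sq_nonneg (t - 8 / 10))]
    linarith

/-- Upper bound for the potential after the change of variable `t ↦ t / (1 - 21/100 t)`. -/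
lemma exp_sub_one_mul_le {t : ℝ} (h : t ≤ 134 / 100) :
    (exp (2 * t) - 1) * (1 - 21 / 100 * t) ^ 5 ≤ 2 * t := by
  have hu : ∀ s : ℝ, s ≤ 134 / 100 → 0 < 1 - 21 / 100 * s := fun s hs => by linarith
  set N : ℝ → ℝ := fun s => exp (-(2 * s)) * (1 + 2 * s / (1 - 21 / 100 * s) ^ 5) with hN
  have hd : ∀ s : ℝ, s ≤ 134 / 100 → HasDerivAt N (exp (-(2 * s)) * 2 / (1 - 21 / 100 * s) ^ 6 *
      (1 + 84 / 100 * s - 2 * s * (1 - 21 / 100 * s) - (1 - 21 / 100 * s) ^ 6)) s := by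
    intro s hs
    have h0 := hu s hs
    have h1 := ((hasDerivAt_id s).const_mul 2).neg.exp
    have h2 := (((hasDerivAt_id s).const_mul (21 / 100)).const_sub 1).pow 5
    have h3 := (((hasDerivAt_id s).const_mul 2).div h2 (by simp; exact h0.ne')).const_add 1
    refine (h1.mul h3).congr_deriv ?_
    simp only [id, Pi.pow_apply, Pi.div_apply, Pi.neg_apply]
    obtain ⟨u, hue⟩ : ∃ u, u = 1 - 21 / 100 * s := ⟨_, rfl⟩
    have hs' : s = (1 - u) * (100 / 21) := by linarith
    rw [← hue] at h0 ⊢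
    field_simp
    rw [hs']
    ring
  have hge : 1 ≤ N t := by
    have hN0 : N 0 = 1 := by simp [hN]
    rw [← hN0]
    rcases le_total t 0 with h0 | h0
    · have hanti : AntitoneOn N (Set.Iic 0) := by
        refine antitoneOn_of_deriv_nonpos (convex_Iic 0)
          (fun x hx => (hd x (by have := Set.mem_Iic.1 hx; linarith)).continuousAt.continuousWithinAt)
          (fun x hx => (hd x (by have := Set.mem_Iic.1 (interior_subset hx); linarith)).differentiableAt.differentiableWithinAt) ?_
        intro x hx
        rw [interior_Iic, Set.mem_Iio] at hx
        rw [(hd x (by linarith)).deriv]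
        have h1 := airy_quintic_nonneg (t := x) (by linarith)
        have h2 := hu x (by linarith)
        refine mul_nonpos_of_nonneg_of_nonpos (by positivity) ?_
        by_contra hc
        push Not at hc
        nlinarith
      exact hanti (Set.mem_Iic.2 h0) (Set.mem_Iic.2 le_rfl) h0
    · have hmono : MonotoneOn N (Set.Icc 0 (134 / 100)) := by
        refine monotoneOn_of_deriv_nonneg (convex_Icc _ _)
          (fun x hx => (hd x hx.2).continuousAt.continuousWithinAt)
          (fun x hx => (hd x (interior_subset hx).2).differentiableAt.differentiableWithinAt) ?_
        intro x hx
        rw [interior_Icc] at hx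
        rw [(hd x hx.2.le).deriv]
        have h1 := airy_quintic_nonneg (t := x) hx.2.le
        have h2 := hu x hx.2.le
        have h3 := hx.1
        refine mul_nonneg (by positivity) ?_
        by_contra hc
        push Not at hc
        nlinarith
      exact hmono ⟨le_rfl, by norm_num⟩ ⟨h0, h⟩ h0
  have h0 := hu t h
  have h1 : exp (2 * t) * N t = 1 + 2 * t / (1 - 21 / 100 * t) ^ 5 := by
    simp only [hN]
    rw [← mul_assoc, ← exp_add]; simp
  have h2 : exp (2 * t) - 1 ≤ 2 * t / (1 - 21 / 100 * t) ^ 5 := by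
    nlinarith [exp_pos (2 * t)]
  rwa [le_div_iff₀ (by positivity)] at h2

noncomputable def airyW (z : ℝ) : ℝ := (1 - z ^ 3 / 6 + z ^ 6 / 180 - z ^ 9 / 12960)
  + 71 / 100 * (z - z ^ 4 / 12 + z ^ 7 / 504 - z ^ 10 / 45360)

noncomputable def airyW' (z : ℝ) : ℝ := (- z ^ 2 / 2 + z ^ 5 / 30 - z ^ 8 / 1440)
  + 71 / 100 * (1 - z ^ 3 / 3 + z ^ 6 / 72 - z ^ 9 / 4536)

noncomputable def airyW'' (z : ℝ) : ℝ := (- z + z ^ 4 / 6 - z ^ 7 / 180)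
  + 71 / 100 * (- z ^ 2 + z ^ 5 / 12 - z ^ 8 / 504)

lemma hasDerivAt_airyW (z : ℝ) : HasDerivAt airyW (airyW' z) z := by
  have h := hasDerivAt_id z
  have h1 := ((((h.pow 3).div_const 6).const_sub 1).add ((h.pow 6).div_const 180)).sub
    ((h.pow 9).div_const 12960)
  have h2 := ((h.sub ((h.pow 4).div_const 12)).add ((h.pow 7).div_const 504)).sub
    ((h.pow 10).div_const 45360)
  refine (h1.add (h2.const_mul (71 / 100))).congr_deriv ?_
  simp [airyW']; ring

lemma hasDerivAt_airyW' (z : ℝ) : HasDerivAt airyW' (airyW'' z) z := by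
  have h := hasDerivAt_id z
  have h1 := (((h.pow 2).neg.div_const 2).add ((h.pow 5).div_const 30)).sub
    ((h.pow 8).div_const 1440)
  have h2 := ((((h.pow 3).div_const 3).const_sub 1).add ((h.pow 6).div_const 72)).sub
    ((h.pow 9).div_const 4536)
  refine (h1.add (h2.const_mul (71 / 100))).congr_deriv ?_
  simp [airyW'']; ring

lemma airyW_pos {z : ℝ} (h1 : -(144 / 100) ≤ z) (h2 : z ≤ 232 / 100) : 0 < airyW z := by
  rcases le_total z 0 with h0 | h0
  · obtain ⟨r, hr⟩ : ∃ r, r = -z := ⟨_, rfl⟩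
    have hz : z = -r := by linarith
    have hr0 : 0 ≤ r := by linarith
    have hr1 : r ≤ 144 / 100 := by linarith
    have e : airyW z = (1 + r ^ 3 / 6 - 71 / 100 * r - 71 / 1200 * r ^ 4)
        + r ^ 6 * (1 / 180 - 71 / 50400 * r) + r ^ 9 * (1 / 12960 - 71 / 4536000 * r) := by
      rw [airyW, hz]; ring
    have i1 : 0 ≤ r ^ 6 * (1 / 180 - 71 / 50400 * r) := mul_nonneg (by positivity) (by linarith)
    have i2 : 0 ≤ r ^ 9 * (1 / 12960 - 71 / 4536000 * r) :=
      mul_nonneg (by positivity) (by linarith)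
    have i3 : 0 ≤ r ^ 3 * (144 / 100 - r) := mul_nonneg (by positivity) (by linarith)
    have i4 : 0 ≤ r * (144 / 100 - r) * (r + 1) := by
      have : 0 ≤ 144 / 100 - r := by linarith
      positivity
    rw [e]
    nlinarith [mul_nonneg hr0 (sq_nonneg (r - 1)), sq_nonneg (r - 1)]
  · have hc : ConcaveOn ℝ (Set.Icc 0 (232 / 100)) airyW := by
      refine concaveOn_of_hasDerivWithinAt2_nonpos (convex_Icc _ _) (f' := airyW') (f'' := airyW'')
        (fun x _ => (hasDerivAt_airyW x).continuousAt.continuousWithinAt)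
        (fun x _ => (hasDerivAt_airyW x).hasDerivWithinAt)
        (fun x _ => (hasDerivAt_airyW' x).hasDerivWithinAt) ?_
      intro x hx
      have hx := interior_subset hx
      have hx0 : 0 ≤ x := hx.1
      have hx1 : x ≤ 232 / 100 := hx.2
      obtain ⟨s, hs⟩ : ∃ s, s = x ^ 3 := ⟨_, rfl⟩
      have hs1 : s ≤ (232 / 100) ^ 3 := by rw [hs]; exact pow_le_pow_left₀ hx0 hx1 3
      have hs0 : 0 ≤ s := by rw [hs]; positivity
      have e : airyW'' x = -(x * ((1 - s / 6 + s ^ 2 / 180)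
          + 71 / 100 * x * (1 - s / 12 + s ^ 2 / 504))) := by
        rw [airyW'', hs]; ring
      have j1 : 26 / 100 ≤ 1 - s / 12 + s ^ 2 / 504 := by nlinarith
      rw [e, neg_nonpos]
      refine mul_nonneg hx0 ?_
      rcases le_total x 2 with h | h
      · have : s ≤ 2 ^ 3 := by rw [hs]; exact pow_le_pow_left₀ hx0 h 3
        have : 0 ≤ 1 - s / 6 + s ^ 2 / 180 := by nlinarith
        have : 0 ≤ 71 / 100 * x * (1 - s / 12 + s ^ 2 / 504) :=
          mul_nonneg (by positivity) (by linarith)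
        linarith
      · have : -(1 / 4) ≤ 1 - s / 6 + s ^ 2 / 180 := by nlinarith [sq_nonneg (s - 15)]
        have : 2 * (26 / 100) ≤ x * (1 - s / 12 + s ^ 2 / 504) :=
          mul_le_mul h j1 (by norm_num) hx0
        linarith
    have hm := hc.min_le_of_mem_Icc (x := 0) (y := 232 / 100) (z := z)
      ⟨le_rfl, by norm_num⟩ ⟨by norm_num, le_rfl⟩ ⟨h0, h2⟩
    refine lt_of_lt_of_le ?_ hm
    rw [lt_min_iff]
    constructor <;> norm_num [airyW]

lemma airyW''_add_le {z : ℝ} (h1 : -(144 / 100) ≤ z) : airyW'' z + z * airyW z ≤ 0 := by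
  have e : airyW'' z + z * airyW z = -(z ^ 10 * (1 / 12960 + 71 / 4536000 * z)) := by
    rw [airyW'', airyW]; ring
  rw [e, neg_nonpos]
  refine mul_nonneg ?_ (by linarith)
  have : z ^ 10 = (z ^ 5) ^ 2 := by ring
  rw [this]; positivity

/-- The slow variable in the Langer transformation. -/
noncomputable def langerZ (m μ x : ℝ) : ℝ := μ * (log (x / m) / (1 - 21 / 100 * log (x / m)))

lemma hasDerivAt_langerZ {m μ x : ℝ} (hm : 0 < m) (hx : 0 < x)
    (hu : 0 < 1 - 21 / 100 * log (x / m)) :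
    HasDerivAt (langerZ m μ) (μ * (1 / (x * (1 - 21 / 100 * log (x / m)) ^ 2))) x := by
  have hl : HasDerivAt (fun x => log (x / m)) (1 / x) x := by
    refine (((hasDerivAt_id x).div_const m).log (div_pos hx hm).ne').congr_deriv ?_
    simp; field_simp
  have hu' := (hl.const_mul (21 / 100)).const_sub 1
  refine ((hl.div hu' hu.ne').const_mul μ).congr_deriv ?_
  field_simp; ring

lemma riccati_langer {m μ : ℝ} (hm : 0 < m) (hμ : 0 < μ) (hμm : μ ^ 3 = 2 * m ^ 2)
    {F F' : ℝ → ℝ} {x : ℝ} (hx : 0 < x) (hx1 : log (x / m) ≤ 134 / 100)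
    (hF : HasDerivAt F (F' (langerZ m μ x)) (langerZ m μ x))
    (hR : F' (langerZ m μ x) + F (langerZ m μ x) ^ 2 + langerZ m μ x ≤ 0) :
    ∃ d, HasDerivAt (fun x => -(21 / 100) / (1 - 21 / 100 * log (x / m))
      + μ / (1 - 21 / 100 * log (x / m)) ^ 2 * F (langerZ m μ x)) d x ∧
      x * d + (-(21 / 100) / (1 - 21 / 100 * log (x / m))
      + μ / (1 - 21 / 100 * log (x / m)) ^ 2 * F (langerZ m μ x)) ^ 2 + x ^ 2 - m ^ 2 ≤ 0 := by
  have hu : 0 < 1 - 21 / 100 * log (x / m) := by linarith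
  have hl : HasDerivAt (fun x => log (x / m)) (1 / x) x := by
    refine (((hasDerivAt_id x).div_const m).log (div_pos hx hm).ne').congr_deriv ?_
    simp; field_simp
  have hu' := (hl.const_mul (21 / 100)).const_sub 1
  have hz := hasDerivAt_langerZ (μ := μ) hm hx hu
  have h1 := (hasDerivAt_const x (-(21 / 100 : ℝ))).div hu' hu.ne'
  have h2 := (hasDerivAt_const x μ).div (hu'.pow 2) (by simp; exact hu.ne')
  have h3 := hF.comp x hz
  refine ⟨_, h1.add (h2.mul h3), ?_⟩
  have hE := exp_sub_one_mul_le hx1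
  have hex : exp (2 * log (x / m)) = x ^ 2 / m ^ 2 := by
    rw [mul_comm, exp_mul, exp_log (div_pos hx hm)]
    norm_cast
    rw [div_pow]
  rw [hex] at hE
  simp only [Pi.pow_apply, Pi.div_apply]
  set z := langerZ m μ x with hzdef
  have hze : z * (1 - 21 / 100 * log (x / m)) = μ * log (x / m) := by
    rw [hzdef, langerZ, ← mul_div_assoc, div_mul_cancel₀ _ hu.ne']
  set t := log (x / m)
  obtain ⟨u, hue⟩ : ∃ u, u = 1 - 21 / 100 * t := ⟨_, rfl⟩
  rw [← hue] at hu hE hze ⊢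
  have key : x * ((0 * u - -(21 / 100) * -(21 / 100 * (1 / x))) / u ^ 2 +
      ((0 * u ^ 2 - μ * (↑2 * u ^ (2 - 1) * -(21 / 100 * (1 / x)))) / (u ^ 2) ^ 2 * F z +
        μ / u ^ 2 * (F' z * (μ * (1 / (x * u ^ 2)))))) +
      (-(21 / 100) / u + μ / u ^ 2 * F z) ^ 2 = μ ^ 2 / u ^ 4 * (F' z + F z ^ 2) := by
    field_simp; ring
  have h5 : x ^ 2 - m ^ 2 ≤ μ ^ 2 / u ^ 4 * z := by
    have h6 : (x ^ 2 - m ^ 2) * u ^ 5 ≤ 2 * m ^ 2 * t := by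
      have e1 : (x ^ 2 - m ^ 2) * u ^ 5 = m ^ 2 * ((x ^ 2 / m ^ 2 - 1) * u ^ 5) := by field_simp
      rw [e1]
      have := mul_le_mul_of_nonneg_left hE (sq_nonneg m)
      linarith
    have e2 : μ ^ 2 / u ^ 4 * z = (2 * m ^ 2 * t) / u ^ 5 := by
      have : 2 * m ^ 2 * t = μ ^ 2 * (z * u) := by rw [hze, ← hμm]; ring
      rw [this]; field_simp
    rw [e2, le_div_iff₀ (by positivity)]
    exact h6
  have h7 : μ ^ 2 / u ^ 4 * (F' z + F z ^ 2 + z) ≤ 0 :=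
    mul_nonpos_of_nonneg_of_nonpos (by positivity) hR
  push_cast at key ⊢
  linarith

lemma langer_bernstein_pos {t : ℝ} (h0 : 0 ≤ t) (h1 : t ≤ 133 / 100) :
    967 / 1000 ≤ (1 + t + 2 / 3 * t ^ 2 + 1 / 3 * t ^ 3 + 2 / 15 * t ^ 4 + 2 / 45 * t ^ 5
      + 4 / 315 * t ^ 6 + 1 / 315 * t ^ 7) * (1 - 21 / 100 * t) ^ 5 := by
  have e : (1 + t + 2 / 3 * t ^ 2 + 1 / 3 * t ^ 3 + 2 / 15 * t ^ 4 + 2 / 45 * t ^ 5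
      + 4 / 315 * t ^ 6 + 1 / 315 * t ^ 7) * (1 - 21 / 100 * t) ^ 5 - 967 / 1000 =
      33000000000000000000000 / 30635127461052805121505361 * (t ^ 0 * (133 / 100 - t) ^ 12) +
      329500000000000000000000 / 30635127461052805121505361 * (t ^ 1 * (133 / 100 - t) ^ 11) +
      4645519700000000000000000 / 91905382383158415364516083 * (t ^ 2 * (133 / 100 - t) ^ 10) +
      4579567304430000000000000 / 30635127461052805121505361 * (t ^ 3 * (133 / 100 - t) ^ 9) +
      28645308186856901500000000 / 91905382383158415364516083 * (t ^ 4 * (133 / 100 - t) ^ 8) +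
      132666979876323076237630000 / 275716147149475246093548249 * (t ^ 5 * (133 / 100 - t) ^ 7) +
      7313011318340299757909900 / 13129340340451202194930869 * (t ^ 6 * (133 / 100 - t) ^ 6) +
      131795324700443656928451038 / 275716147149475246093548249 * (t ^ 7 * (133 / 100 - t) ^ 5) +
      903320455561841173270699753 / 3063512746105280512150536100 * (t ^ 8 * (133 / 100 - t) ^ 4) +
      852789479451909185071450395041 / 6892903678736881152338706225000 * (t ^ 9 * (133 / 100 - t) ^ 3) +
      22007005272552491258284872050951 / 689290367873688115233870622500000 * (t ^ 10 * (133 / 100 - t) ^ 2) +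
      34907324508157261882839031210711 / 8616129598421101440423382781250000 * (t ^ 11 * (133 / 100 - t) ^ 1) +
      1390097332850312738475304047779677 / 13785807357473762304677412450000000000 * (t ^ 12 * (133 / 100 - t) ^ 0) := by ring
  rw [← sub_nonneg, e]
  have : 0 ≤ 133 / 100 - t := by linarith
  positivity

lemma le_exp_sub_one_mul {t : ℝ} (h0 : 0 ≤ t) (h1 : t ≤ 133 / 100) :
    967 / 1000 * (2 * t) ≤ (exp (2 * t) - 1) * (1 - 21 / 100 * t) ^ 5 := by
  have h2 := sum_le_exp_of_nonneg (x := 2 * t) (by positivity) 9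
  simp only [Finset.sum_range_succ, Finset.sum_range_zero, Nat.factorial] at h2
  have h3 : 2 * t * (1 + t + 2 / 3 * t ^ 2 + 1 / 3 * t ^ 3 + 2 / 15 * t ^ 4 + 2 / 45 * t ^ 5
      + 4 / 315 * t ^ 6 + 1 / 315 * t ^ 7) ≤ exp (2 * t) - 1 := by
    refine le_trans (le_of_eq ?_) (sub_le_sub_right h2 1)
    push_cast; ring
  have hu : 0 ≤ (1 - 21 / 100 * t) ^ 5 := pow_nonneg (by linarith) 5
  have h4 := mul_le_mul_of_nonneg_right h3 hu
  have h5 := mul_le_mul_of_nonneg_left (langer_bernstein_pos h0 h1) (by positivity : 0 ≤ 2 * t)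
  linarith

lemma langerZ_le_langerZ {m μ x y : ℝ} (hm : 0 < m) (hμ : 0 < μ) (hx : 0 < x) (hxy : x ≤ y)
    (hy : log (y / m) ≤ 134 / 100) : langerZ m μ x ≤ langerZ m μ y := by
  have h1 : log (x / m) ≤ log (y / m) := log_le_log (div_pos hx hm) (by gcongr)
  refine mul_le_mul_of_nonneg_left ?_ hμ.le
  rw [div_le_div_iff₀ (by linarith) (by linarith)]
  linarith

lemma langerZ_mul_exp {m μ y : ℝ} (hm : 0 < m) (hy : 0 < 1 + 21 / 100 * y) :
    langerZ m μ (m * exp (y / (1 + 21 / 100 * y))) = μ * y := by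
  rw [langerZ, mul_div_cancel_left₀ _ hm.ne', log_exp]
  have : 1 - 21 / 100 * (y / (1 + 21 / 100 * y)) = 1 / (1 + 21 / 100 * y) := by
    rw [eq_div_iff hy.ne', sub_mul, mul_assoc, div_mul_cancel₀ _ hy.ne']; ring
  rw [this, div_div_div_cancel_right₀ hy.ne', div_one]

/-- Lower bound of the Debye phase by the phase of the Langer variable. -/
lemma langerZ_phase_le_debye {m μ x : ℝ} (hm : 0 < m) (hμ : 0 < μ) (hμm : μ ^ 3 = 2 * m ^ 2)
    (hx : m ≤ x) (hx1 : log (x / m) ≤ 133 / 100) :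
    98336 / 100000 * (2 / 3) * (langerZ m μ x * √(langerZ m μ x)) ≤ debye m x := by
  have hlog : ∀ y ∈ Set.Icc m x, 0 ≤ log (y / m) ∧ log (y / m) ≤ 133 / 100 := by
    intro y hy
    refine ⟨log_nonneg (by rw [one_le_div hm]; exact hy.1), le_trans ?_ hx1⟩
    have : 0 < y / m := div_pos (hm.trans_le hy.1) hm
    exact log_le_log this (by have := hy.2; gcongr)
  have hzc : ContinuousOn (langerZ m μ) (Set.Icc m x) := fun y hy =>
    (hasDerivAt_langerZ hm (hm.trans_le hy.1) (by linarith [(hlog y hy).2])).continuousAt.continuousWithinAt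
  set G : ℝ → ℝ := fun y => debye m y - 98336 / 100000 * (2 / 3) * (langerZ m μ y * √(langerZ m μ y))
    with hG
  have hmono : MonotoneOn G (Set.Icc m x) := by
    have hd : ∀ y ∈ interior (Set.Icc m x), ∃ d, HasDerivAt G d y ∧ 0 ≤ d := by
      intro y hy
      rw [interior_Icc] at hy
      have hy0 : 0 < y := hm.trans hy.1
      obtain ⟨hl0, hl1⟩ := hlog y ⟨hy.1.le, hy.2.le⟩
      have hl0' : 0 < log (y / m) := log_pos (by rw [one_lt_div hm]; exact hy.1)
      have hu : 0 < 1 - 21 / 100 * log (y / m) := by linarith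
      have hz := hasDerivAt_langerZ (μ := μ) hm hy0 hu
      have hzpos : 0 < langerZ m μ y := by rw [langerZ]; positivity
      refine ⟨_, (hasDerivAt_debye hm.le hy.1).sub
        ((hz.mul (hz.sqrt hzpos.ne')).const_mul (98336 / 100000 * (2 / 3))), ?_⟩
      have hze : langerZ m μ y * (1 - 21 / 100 * log (y / m)) = μ * log (y / m) := by
        rw [langerZ, ← mul_div_assoc, div_mul_cancel₀ _ hu.ne']
      have hE := le_exp_sub_one_mul hl0 hl1
      have hex : exp (2 * log (y / m)) = y ^ 2 / m ^ 2 := by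
        rw [mul_comm, exp_mul, exp_log (div_pos hy0 hm)]
        norm_cast
        rw [div_pow]
      rw [hex] at hE
      set z := langerZ m μ y
      set t := log (y / m)
      obtain ⟨u, hue⟩ : ∃ u, u = 1 - 21 / 100 * t := ⟨_, rfl⟩
      rw [← hue] at hu hE hze ⊢
      obtain ⟨w, hw⟩ : ∃ w, w = √z := ⟨_, rfl⟩
      have hw0 : 0 < w := by rw [hw]; exact sqrt_pos.2 hzpos
      have hw2 : w ^ 2 = z := by rw [hw, sq_sqrt hzpos.le]
      rw [← hw]
      have e : 98336 / 100000 * (2 / 3) * (μ * (1 / (y * u ^ 2)) * w +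
          z * (μ * (1 / (y * u ^ 2)) / (2 * w))) = 98336 / 100000 * μ * w / u ^ 2 / y := by
        rw [← hw2]; field_simp; ring
      rw [e, sub_nonneg]
      refine div_le_div_of_nonneg_right (le_sqrt_of_sq_le ?_) hy0.le
      have e2 : (98336 / 100000 * μ * w / u ^ 2) ^ 2
          = (98336 / 100000) ^ 2 * (2 * m ^ 2 * t) / u ^ 5 := by
        have : 2 * m ^ 2 * t = μ ^ 2 * (w ^ 2 * u) := by rw [hw2, hze, ← hμm]; ring
        rw [this]; field_simp
      rw [e2, div_le_iff₀ (by positivity)]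
      have e1 : (y ^ 2 - m ^ 2) * u ^ 5 = m ^ 2 * ((y ^ 2 / m ^ 2 - 1) * u ^ 5) := by field_simp
      rw [e1]
      have h3 := mul_le_mul_of_nonneg_left hE (sq_nonneg m)
      have h4 : 0 ≤ m ^ 2 * t := by positivity
      nlinarith
    choose! g' hg using hd
    refine monotoneOn_of_deriv_nonneg (convex_Icc _ _) ?_
      (fun y hy => (hg y hy).1.differentiableAt.differentiableWithinAt) ?_
    · refine ((continuousOn_debye m).mono fun y hy => hm.trans_le hy.1).sub ?_
      exact continuousOn_const.mul (hzc.mul hzc.sqrt)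
    · intro y hy
      rw [(hg y hy).1.deriv]; exact (hg y hy).2
  have h := hmono ⟨le_rfl, hx⟩ ⟨hx, le_rfl⟩ hx
  have h0 : langerZ m μ m = 0 := by simp [langerZ, hm.ne']
  simp only [hG, h0, debye_of_le hm le_rfl] at h
  simp only [zero_mul, mul_zero, sub_zero] at h
  linarith

/-- Mode bound when the interval starts inside the turning point. -/
lemma exists_nonnegModulo_of_le {m a b : ℝ} (hm : 1 ≤ m) (ha : 0 < a) (hab : a < b)
    {n : ℕ} (hn : debye m b / π + 7 / 25 < n + 1) :
    ∃ a', 0 < a' ∧ a' ≤ a ∧ NonnegModulo m a' b n := by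
  have hm0 : 0 < m := by linarith
  rcases le_or_gt b m with hbm | hmb
  · refine ⟨a, ha, le_rfl, NonnegModulo.mono ?_ (Nat.zero_le n)⟩
    refine NonnegModulo.of_riccati ha hab.le (f := fun _ => 0) (f' := fun _ => 0)
      (fun x _ => hasDerivAt_const x 0) fun x hx => ?_
    have h1 := hx.2
    have h2 : 0 < x := ha.trans_le hx.1
    nlinarith
  obtain ⟨μ, hμ, hμm⟩ : ∃ μ : ℝ, 0 < μ ∧ μ ^ 3 = 2 * m ^ 2 := by
    refine ⟨(2 * m ^ 2) ^ ((1 : ℝ) / 3), by positivity, ?_⟩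
    rw [← rpow_natCast, ← rpow_mul (by positivity)]
    norm_num
  have hμ1 : 12599 / 10000 ≤ μ := by
    by_contra hc
    push Not at hc
    have : μ ^ 3 < (12599 / 10000) ^ 3 := pow_lt_pow_left₀ hc hμ.le (by norm_num)
    nlinarith
  have hy0 : -(144 / 100) / μ ≤ 0 := div_nonpos_of_nonpos_of_nonneg (by norm_num) hμ.le
  have hy0' : -(115 / 100) ≤ -(144 / 100) / μ := by rw [le_div_iff₀ hμ]; linarith
  have hy1 : 232 / 100 / μ ≤ 18415 / 10000 := by rw [div_le_iff₀ hμ]; linarith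
  have hy1' : 0 < 232 / 100 / μ := by positivity
  have hz0 := langerZ_mul_exp (μ := μ) hm0 (y := -(144 / 100) / μ) (by linarith)
  have hz1 := langerZ_mul_exp (μ := μ) hm0 (y := 232 / 100 / μ) (by linarith)
  rw [mul_div_cancel₀ _ hμ.ne'] at hz0 hz1
  obtain ⟨t0, ht0⟩ : ∃ t, t = -(144 / 100) / μ / (1 + 21 / 100 * (-(144 / 100) / μ)) := ⟨_, rfl⟩
  obtain ⟨t1, ht1⟩ : ∃ t, t = 232 / 100 / μ / (1 + 21 / 100 * (232 / 100 / μ)) := ⟨_, rfl⟩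
  have ht0' : t0 ≤ 0 := by rw [ht0]; exact div_nonpos_of_nonpos_of_nonneg hy0 (by linarith)
  have ht1' : 0 < t1 := by rw [ht1]; positivity
  have ht1'' : t1 ≤ 133 / 100 := by rw [ht1, div_le_iff₀ (by positivity)]; linarith
  rw [← ht0] at hz0
  rw [← ht1] at hz1
  have hlx : ∀ t, log (m * exp t / m) = t := fun t => by
    rw [mul_div_cancel_left₀ _ hm0.ne', log_exp]
  have hx0 : 0 < m * exp t0 := by positivity
  have hx0m : m * exp t0 ≤ m := mul_le_of_le_one_right hm0.le (exp_le_one_iff.2 ht0')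
  have hmx1 : m < m * exp t1 := lt_mul_of_one_lt_right hm0 (one_lt_exp_iff.2 ht1')
  have hl0 := hlx t0
  have hl1 := hlx t1
  obtain ⟨x0, hx0e⟩ : ∃ x, x = m * exp t0 := ⟨_, rfl⟩
  obtain ⟨x1, hx1e⟩ : ∃ x, x = m * exp t1 := ⟨_, rfl⟩
  rw [← hx0e] at hz0 hx0 hx0m hl0
  rw [← hx1e] at hz1 hmx1 hl1
  have hlog : ∀ x, 0 < x → x ≤ x1 → log (x / m) ≤ 133 / 100 := by
    intro x hx hxx
    refine le_trans (log_le_log (div_pos hx hm0) (by gcongr)) (hl1.le.trans ht1'')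
  have hpieceA : ∀ x, 0 < x → x ≤ x0 → _ := fun x hx hxx =>
    riccati_langer hm0 hμ hμm (F := fun _ => 12 / 10) (F' := fun _ => 0) hx
      ((hlog x hx (by linarith)).trans (by norm_num)) (hasDerivAt_const _ _)
      (by
        have := langerZ_le_langerZ hm0 hμ hx hxx (by linarith)
        rw [hz0] at this; linarith)
  have hWpos : ∀ x, x0 ≤ x → x ≤ x1 → -(144 / 100) ≤ langerZ m μ x ∧ langerZ m μ x ≤ 232 / 100 := by
    intro x h1 h2
    have h3 := langerZ_le_langerZ hm0 hμ hx0 h1 ((hlog x (by linarith) h2).trans (by norm_num))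
    have h4 := langerZ_le_langerZ (y := x1) hm0 hμ (hx0.trans_le h1) h2 (by linarith)
    rw [hz0] at h3; rw [hz1] at h4
    exact ⟨h3, h4⟩
  have hpieceB : ∀ x, x0 ≤ x → x ≤ x1 → _ := fun x h1 h2 =>
    riccati_langer hm0 hμ hμm (F := fun z => airyW' z / airyW z)
      (F' := fun z => (airyW'' z * airyW z - airyW' z * airyW' z) / airyW z ^ 2)
      (hx0.trans_le h1) ((hlog x (by linarith) h2).trans (by norm_num))
      ((hasDerivAt_airyW' _).div (hasDerivAt_airyW _)
        (airyW_pos (hWpos x h1 h2).1 (hWpos x h1 h2).2).ne')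
      (by
        obtain ⟨h3, h4⟩ := hWpos x h1 h2
        have h5 := airyW_pos h3 h4
        have h6 := airyW''_add_le h3
        set z := langerZ m μ x
        have : (airyW'' z * airyW z - airyW' z * airyW' z) / airyW z ^ 2
            + (airyW' z / airyW z) ^ 2 + z = (airyW'' z + z * airyW z) / airyW z := by
          field_simp; ring
        rw [this]
        exact div_nonpos_of_nonpos_of_nonneg h6 h5.le)
  choose! dA hA using hpieceA
  choose! dB hB using hpieceB
  have hglue : airyW' (langerZ m μ x0) / airyW (langerZ m μ x0) ≤ 12 / 10 := by
    rw [hz0, div_le_iff₀ (airyW_pos le_rfl (by norm_num))]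
    norm_num [airyW, airyW']
  have hl0u : 0 < 1 - 21 / 100 * log (x0 / m) := by linarith
  have hbase : ∀ β, x0 ≤ β → β ≤ x1 → NonnegModulo m (min a x0) β 0 := by
    intro β h1 h2
    have h3 : 0 < min a x0 := lt_min ha hx0
    refine NonnegModulo.of_riccati_glue h3 (min_le_right a x0) h1
      (fun x hx => (hA x (h3.trans_le hx.1) hx.2).1) (fun x hx => (hA x (h3.trans_le hx.1) hx.2).2)
      (fun x hx => (hB x hx.1 (hx.2.trans h2)).1) (fun x hx => (hB x hx.1 (hx.2.trans h2)).2) ?_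
    gcongr
  refine ⟨min a x0, lt_min ha hx0, min_le_left a x0, ?_⟩
  rcases le_or_gt b x1 with hb1 | hb1
  · exact (hbase b (by linarith) hb1).mono (Nat.zero_le n)
  have hD : 2316 / 1000 ≤ debye m x1 := by
    refine le_trans ?_ (langerZ_phase_le_debye hm0 hμ hμm hmx1.le (by linarith))
    rw [hz1]
    have : (152315 / 100000 : ℝ) ≤ √(232 / 100) := le_sqrt_of_sq_le (by norm_num)
    linarith
  have hp := pi_pos
  have hp1 := pi_gt_d4
  have hp2 := pi_lt_d4
  have h3 : debye m b < (n + 1 - 7 / 25) * π := by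
    rw [← div_lt_iff₀ hp]; linarith
  have hDb : debye m x1 ≤ debye m b :=
    monotoneOn_debye hm0.le (Set.mem_Ioi.2 (by linarith)) (Set.mem_Ioi.2 (by linarith)) hb1.le
  rcases n with _ | n
  · norm_num at h3
    linarith
  · have h5 : NonnegModulo m x1 b n := by
      refine nonnegModulo_rational hm0.le hmx1 hb1.le (σ := 18 / 25 * π) ?_ ?_
      · have : 1 / (8 * debye m x1) ≤ 1 / (8 * (2316 / 1000)) := by gcongr
        have e : (1 : ℝ) / (8 * (2316 / 1000)) ≤ 54 / 1000 := by norm_num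
        linarith
      · push_cast at h3; linarith
    simpa using (hbase x1 (by linarith) le_rfl).trans (lt_min ha hx0)
      ((min_le_right a x0).trans (by linarith)) hb1.le h5

/-- The mode bound: the `m`-th angular mode on `[a, b]` has at most `n` eigenvalues below `1`
if the Debye phase difference is small enough. -/
theorem exists_nonnegModulo (m : ℕ) {a b : ℝ} (ha : 0 < a) (hab : a < b) {n : ℕ}
    (hn : (debye m b - debye m a) / π + 7 / 25 < n + 1) :
    ∃ a', 0 < a' ∧ a' ≤ a ∧ NonnegModulo m a' b n := by
  rcases lt_or_ge (m : ℝ) a with h | h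
  · refine ⟨a, ha, le_rfl, ?_⟩
    rcases lt_or_ge (debye m a) (74 / 1000) with h1 | h1
    · exact nonnegModulo_of_debye_lt (Nat.cast_nonneg m) h hab.le h1 hn
    · exact nonnegModulo_of_debye_ge (Nat.cast_nonneg m) h hab.le h1 hn
  · have hm : (1 : ℝ) ≤ m := by
      have : (0 : ℝ) < m := ha.trans_le h
      exact_mod_cast this
    refine exists_nonnegModulo_of_le hm ha hab ?_
    rwa [debye_of_le ha h, sub_zero] at hn

lemma ConvexOn.mul_le_integral {f : ℝ → ℝ} {x h : ℝ} (hh : 0 ≤ h)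
    (hf : ConvexOn ℝ (Set.Icc (x - h) (x + h)) f)
    (hi : IntervalIntegrable f volume (x - h) (x + h)) :
    2 * h * f x ≤ ∫ s in (x - h)..(x + h), f s := by
  have hsub1 : IntervalIntegrable f volume (x - h) x := hi.mono_set (by
    rw [Set.uIcc_of_le (by linarith), Set.uIcc_of_le (by linarith)]
    exact Set.Icc_subset_Icc_right (by linarith))
  have hsub2 : IntervalIntegrable f volume x (x + h) := hi.mono_set (by
    rw [Set.uIcc_of_le (by linarith), Set.uIcc_of_le (by linarith)]
    exact Set.Icc_subset_Icc_left (by linarith))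
  have h1 : ∫ t in (0:ℝ)..h, f (x + t) = ∫ s in x..(x + h), f s := by
    rw [intervalIntegral.integral_comp_add_left]; simp
  have h2 : ∫ t in (0:ℝ)..h, f (x - t) = ∫ s in (x - h)..x, f s := by
    rw [intervalIntegral.integral_comp_sub_left]; simp
  have i1 : IntervalIntegrable (fun t => f (x + t)) volume 0 h := by
    have := hsub2.comp_add_left x; simpa using this
  have i2 : IntervalIntegrable (fun t => f (x - t)) volume 0 h := by
    have := hsub1.symm.comp_sub_left x; simpa using this
  rw [← intervalIntegral.integral_add_adjacent_intervals hsub1 hsub2, ← h1, ← h2,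
    ← intervalIntegral.integral_add i2 i1]
  have h3 : ∫ _t in (0:ℝ)..h, 2 * f x = 2 * h * f x := by simp; ring
  rw [← h3]
  refine intervalIntegral.integral_mono_on hh (by simp) (i2.add i1) fun t ht => ?_
  have hm1 : x - t ∈ Set.Icc (x - h) (x + h) := ⟨by linarith [ht.2], by linarith [ht.1]⟩
  have hm2 : x + t ∈ Set.Icc (x - h) (x + h) := ⟨by linarith [ht.1], by linarith [ht.2]⟩
  have h4 := hf.2 hm1 hm2 (by norm_num : (0 : ℝ) ≤ 1 / 2) (by norm_num : (0 : ℝ) ≤ 1 / 2)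
    (by norm_num)
  simp only [smul_eq_mul] at h4
  rw [show 1 / 2 * (x - t) + 1 / 2 * (x + t) = x by ring] at h4
  linarith

lemma ConcaveOn.trapezoid_le_integral {f : ℝ → ℝ} {α β : ℝ} (hαβ : α ≤ β)
    (hf : ConcaveOn ℝ (Set.Icc α β) f) (hi : IntervalIntegrable f volume α β) :
    (β - α) * ((f α + f β) / 2) ≤ ∫ s in α..β, f s := by
  rcases hαβ.eq_or_lt with rfl | hlt
  · simp
  have hβα : 0 < β - α := by linarith
  have h0 : ∫ s in α..β, (f α + (f β - f α) / (β - α) * (s - α)) =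
      (β - α) * ((f α + f β) / 2) := by
    rw [intervalIntegral.integral_add (by simp) (by
      apply Continuous.intervalIntegrable; fun_prop), intervalIntegral.integral_const_mul,
      intervalIntegral.integral_comp_sub_right (fun s => s)]
    simp
    field_simp; ring
  rw [← h0]
  refine intervalIntegral.integral_mono_on hαβ
    (by apply Continuous.intervalIntegrable; fun_prop) hi fun s hs => ?_
  have ha : 0 ≤ (β - s) / (β - α) := div_nonneg (by linarith [hs.2]) hβα.le
  have hb : 0 ≤ (s - α) / (β - α) := div_nonneg (by linarith [hs.1]) hβα.le
  have h4 := hf.2 (Set.left_mem_Icc.2 hαβ) (Set.right_mem_Icc.2 hαβ) ha hb (by field_simp; ring)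
  simp only [smul_eq_mul] at h4
  have e1 : (β - s) / (β - α) * α + (s - α) / (β - α) * β = s := by field_simp; ring
  rw [e1] at h4
  refine le_trans (le_of_eq ?_) h4
  field_simp; ring

/-- A profile on `[0, L]` which is convex up to `p`, concave afterwards, and has slope
at most `-2`. -/
structure IsProfile (m : ℝ → ℝ) (p L : ℝ) : Prop where
  anti : AntitoneOn (fun s => m s + 2 * s) (Set.Icc 0 L)
  convex : ConvexOn ℝ (Set.Icc 0 p) m
  concave : ConcaveOn ℝ (Set.Icc p L) m
  nonneg : 0 ≤ p
  le : p ≤ L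

namespace IsProfile
variable {m : ℝ → ℝ} {p L : ℝ}

lemma antitoneOn (H : IsProfile m p L) : AntitoneOn m (Set.Icc 0 L) := fun x hx y hy hxy => by
  have := H.anti hx hy hxy
  simp only at this
  linarith

lemma intervalIntegrable (H : IsProfile m p L) {α β : ℝ} (h0 : 0 ≤ α) (hα : α ≤ L) (h1 : 0 ≤ β)
    (hβ : β ≤ L) : IntervalIntegrable m volume α β := by
  refine (H.antitoneOn.mono ?_).intervalIntegrable
  intro x hx
  rw [Set.mem_uIcc] at hx
  rcases hx with hx | hx <;> exact ⟨by linarith [hx.1], by linarith [hx.2]⟩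

lemma half_cell (H : IsProfile m p L) {σ : ℝ} (h0 : 1 / 2 ≤ σ) (hσ : σ ≤ L) :
    m σ / 2 + 1 / 4 ≤ ∫ s in (σ - 1 / 2)..σ, m s := by
  have h1 : ∫ s in (σ - 1 / 2)..σ, (m σ + 2 * (σ - s)) = m σ / 2 + 1 / 4 := by
    rw [intervalIntegral.integral_add (by simp) (by
      apply Continuous.intervalIntegrable; fun_prop), intervalIntegral.integral_const_mul,
      intervalIntegral.integral_comp_sub_left (fun s => s)]
    simp
    ring
  rw [← h1]
  refine intervalIntegral.integral_mono_on (by linarith)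
    (by apply Continuous.intervalIntegrable; fun_prop)
    (H.intervalIntegrable (by linarith) (by linarith) (by linarith) hσ) fun s hs => ?_
  have := H.anti (a := s) (b := σ) ⟨by linarith [hs.1], by linarith [hs.2]⟩
    ⟨by linarith, hσ⟩ hs.2
  simp only at this
  linarith

lemma add (H : IsProfile m p L) {α β γ : ℝ} (h0 : 0 ≤ α) (h1 : α ≤ β) (h2 : β ≤ γ) (h3 : γ ≤ L) :
    ∫ s in α..γ, m s = (∫ s in α..β, m s) + ∫ s in β..γ, m s :=
  (intervalIntegral.integral_add_adjacent_intervals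
    (H.intervalIntegrable h0 (by linarith) (by linarith) (by linarith))
    (H.intervalIntegrable (by linarith) (by linarith) (by linarith) h3)).symm

/-- The two rows around the inflection. -/
lemma inflection_cell (H : IsProfile m p L) {σ : ℝ} (h0 : 1 / 2 ≤ σ) (h1 : σ < p)
    (h2 : p < σ + 1 / 2) (h3 : σ + 1 ≤ L) :
    m σ + m (σ + 1) / 2 + 1 / 4 ≤ ∫ s in (σ - 1 / 2)..(σ + 1), m s := by
  obtain ⟨h, hh⟩ : ∃ h, h = p - σ := ⟨_, rfl⟩
  have hp : p = σ + h := by linarith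
  have c1 : ConvexOn ℝ (Set.Icc (σ - h) (σ + h)) m :=
    H.convex.subset (Set.Icc_subset_Icc (by linarith) (by linarith)) (convex_Icc _ _)
  have c2 : ConcaveOn ℝ (Set.Icc p (σ + 1)) m :=
    H.concave.subset (Set.Icc_subset_Icc_right (by linarith)) (convex_Icc _ _)
  have i1 := c1.mul_le_integral (by linarith)
    (H.intervalIntegrable (by linarith) (by linarith) (by linarith) (by linarith))
  have i2 := c2.trapezoid_le_integral (by linarith)
    (H.intervalIntegrable (by linarith) (by linarith) (by linarith) (by linarith))
  have i3 : (1 / 2 - h) * (m (σ - h)) + (1 / 2 - h) ^ 2 ≤ ∫ s in (σ - 1 / 2)..(σ - h), m s := by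
    have e : ∫ s in (σ - 1 / 2)..(σ - h), (m (σ - h) + 2 * ((σ - h) - s)) =
        (1 / 2 - h) * (m (σ - h)) + (1 / 2 - h) ^ 2 := by
      rw [intervalIntegral.integral_add (by simp) (by
        apply Continuous.intervalIntegrable; fun_prop), intervalIntegral.integral_const_mul,
        intervalIntegral.integral_comp_sub_left (fun s => s)]
      simp
      ring
    rw [← e]
    refine intervalIntegral.integral_mono_on (by linarith)
      (by apply Continuous.intervalIntegrable; fun_prop)
      (H.intervalIntegrable (by linarith) (by linarith) (by linarith) (by linarith)) fun s hs => ?_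
    have := H.anti (a := s) (b := σ - h) ⟨by linarith [hs.1], by linarith [hs.2]⟩
      ⟨by linarith, by linarith⟩ hs.2
    simp only at this
    linarith
  have hm1 : σ - h ∈ Set.Icc (σ - h) (σ + h) := ⟨by linarith, by linarith⟩
  have hm2 : σ + h ∈ Set.Icc (σ - h) (σ + h) := ⟨by linarith, by linarith⟩
  have h4 := c1.2 hm1 hm2 (by norm_num : (0 : ℝ) ≤ 1 / 2) (by norm_num : (0 : ℝ) ≤ 1 / 2)
    (by norm_num)
  simp only [smul_eq_mul] at h4
  rw [show 1 / 2 * (σ - h) + 1 / 2 * (σ + h) = σ by ring] at h4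
  rw [H.add (β := σ - h) (by linarith) (by linarith) (by linarith) h3,
    H.add (α := σ - h) (β := σ + h) (by linarith) (by linarith) (by linarith) h3]
  rw [hp] at i2
  have h5 : (1 / 2 - h) * (2 * m σ - m (σ + h)) ≤ (1 / 2 - h) * m (σ - h) :=
    mul_le_mul_of_nonneg_left (by linarith) (by linarith)
  have h6 := H.anti (a := σ + h) (b := σ + 1) ⟨by linarith, by linarith⟩ ⟨by linarith, h3⟩
    (by linarith)
  simp only at h6
  have hh0 : 0 < h := by linarith
  nlinarith

lemma sum_trapezoid (H : IsProfile m p L) {σ : ℝ} (h0 : 1 / 2 ≤ σ) (h1 : p ≤ σ) (n : ℕ)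
    (h2 : σ + n ≤ L) :
    ∑ j ∈ Finset.range (n + 1), m (σ + j) ≤
      (∫ s in σ..(σ + n), m s) + m σ / 2 + m (σ + n) / 2 := by
  induction n with
  | zero => simp
  | succ n ih =>
    push_cast at h2 ⊢
    rw [Finset.sum_range_succ]
    have h3 := ih (by linarith)
    have hn : (0 : ℝ) ≤ n := n.cast_nonneg
    have c2 : ConcaveOn ℝ (Set.Icc (σ + n) (σ + (n + 1))) m :=
      H.concave.subset (Set.Icc_subset_Icc (by linarith) (by linarith)) (convex_Icc _ _)
    have i2 := c2.trapezoid_le_integral (by linarith)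
      (H.intervalIntegrable (by linarith) (by linarith) (by linarith) (by linarith))
    rw [H.add (β := σ + n) (by linarith) (by linarith) (by linarith) h2]
    push_cast
    rw [show σ + (n + 1) - (σ + n) = 1 by ring] at i2
    linarith

/-- Sums over equidistant rows are bounded by the area. -/
lemma sum_le (H : IsProfile m p L) (n : ℕ) {σ : ℝ} (h0 : 1 / 2 ≤ σ) (h2 : σ + n ≤ L) :
    ∑ j ∈ Finset.range (n + 1), m (σ + j) ≤
      (∫ s in (σ - 1 / 2)..(σ + n), m s) + m (σ + n) / 2 - 1 / 4 := by
  have hn : (0 : ℝ) ≤ n := n.cast_nonneg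
  rcases le_or_gt p σ with hp | hp
  · have h3 := H.sum_trapezoid h0 hp n h2
    have h4 := H.half_cell h0 (by linarith)
    rw [H.add (β := σ) (by linarith) (by linarith) (by linarith) h2]
    linarith
  induction n generalizing σ with
  | zero =>
    have h4 := H.half_cell h0 (by simpa using h2)
    simp
    linarith
  | succ n ih =>
    have hn : (0 : ℝ) ≤ n := n.cast_nonneg
    rw [Finset.sum_range_succ']
    have e : ∀ j : ℕ, σ + ((j + 1 : ℕ) : ℝ) = σ + 1 + j := fun j => by push_cast; ring
    simp only [e] at h2 ⊢
    simp only [Nat.cast_zero, add_zero]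
    rcases le_or_gt (σ + 1 / 2) p with h | h
    · have c1 : ConvexOn ℝ (Set.Icc (σ - 1 / 2) (σ + 1 / 2)) m :=
        H.convex.subset (Set.Icc_subset_Icc (by linarith) (by linarith)) (convex_Icc _ _)
      have i1 := c1.mul_le_integral (by linarith)
        (H.intervalIntegrable (by linarith) (by linarith) (by linarith) (by linarith))
      rw [H.add (β := σ + 1 / 2) (by linarith) (by linarith) (by linarith) h2]
      have h5 : ∑ j ∈ Finset.range (n + 1), m (σ + 1 + j) ≤
          (∫ s in (σ + 1 / 2)..(σ + 1 + n), m s) + m (σ + 1 + n) / 2 - 1 / 4 := by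
        have e2 : σ + 1 / 2 = σ + 1 - 1 / 2 := by ring
        rw [e2]
        rcases le_or_gt p (σ + 1) with hp' | hp'
        · have h3 := H.sum_trapezoid (by linarith) hp' n h2
          have h4 := H.half_cell (σ := σ + 1) (by linarith) (by linarith)
          rw [H.add (β := σ + 1) (by linarith) (by linarith) (by linarith) h2]
          linarith
        · exact ih (by linarith) h2 hn hp'
      linarith
    · have h3 := H.sum_trapezoid (σ := σ + 1) (by linarith) (by linarith) n h2
      have h4 := H.inflection_cell h0 hp h (by linarith)
      rw [H.add (β := σ + 1) (by linarith) (by linarith) (by linarith) h2]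
      linarith

end IsProfile

/-- A unimodal density `w` on `[0, b]` with mode `a`, bounded by `1/2`. -/
structure IsUnimodalDensity (w : ℝ → ℝ) (a b : ℝ) : Prop where
  cont : Continuous w
  pos : ∀ y, 0 < y → y < b → 0 < w y
  le_half : ∀ y, 0 ≤ y → w y ≤ 1 / 2
  mono : MonotoneOn w (Set.Icc 0 a)
  anti : AntitoneOn w (Set.Icc a b)
  mode_nonneg : 0 ≤ a
  mode_lt : a < b

namespace IsUnimodalDensity
variable {w : ℝ → ℝ} {a b : ℝ}

lemma strictMonoOn_primitive (H : IsUnimodalDensity w a b) :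
    StrictMonoOn (fun y => ∫ t in (0:ℝ)..y, w t) (Set.Icc 0 b) := by
  refine strictMonoOn_of_deriv_pos (convex_Icc 0 b) (fun y _ =>
    (H.cont.integral_hasStrictDerivAt 0 y).hasDerivAt.continuousAt.continuousWithinAt)
    fun y hy => ?_
  rw [interior_Icc] at hy
  rw [(H.cont.integral_hasStrictDerivAt 0 y).hasDerivAt.deriv]
  exact H.pos y hy.1 hy.2

lemma concaveOn_primitive (H : IsUnimodalDensity w a b) :
    ConcaveOn ℝ (Set.Icc a b) (fun y => ∫ t in (0:ℝ)..y, w t) := by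
  refine AntitoneOn.concaveOn_of_deriv (convex_Icc a b) (fun y _ =>
    (H.cont.integral_hasStrictDerivAt 0 y).hasDerivAt.continuousAt.continuousWithinAt)
    (fun y _ => (H.cont.integral_hasStrictDerivAt 0 y).hasDerivAt.differentiableAt
      |>.differentiableWithinAt) ?_
  have : deriv (fun y => ∫ t in (0:ℝ)..y, w t) = w :=
    funext fun y => (H.cont.integral_hasStrictDerivAt 0 y).hasDerivAt.deriv
  rw [this]
  exact H.anti.mono interior_subset

lemma convexOn_primitive (H : IsUnimodalDensity w a b) :
    ConvexOn ℝ (Set.Icc 0 a) (fun y => ∫ t in (0:ℝ)..y, w t) := by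
  refine MonotoneOn.convexOn_of_deriv (convex_Icc 0 a) (fun y _ =>
    (H.cont.integral_hasStrictDerivAt 0 y).hasDerivAt.continuousAt.continuousWithinAt)
    (fun y _ => (H.cont.integral_hasStrictDerivAt 0 y).hasDerivAt.differentiableAt
      |>.differentiableWithinAt) ?_
  have : deriv (fun y => ∫ t in (0:ℝ)..y, w t) = w :=
    funext fun y => (H.cont.integral_hasStrictDerivAt 0 y).hasDerivAt.deriv
  rw [this]
  exact H.mono.mono interior_subset

lemma primitive_sub_le (H : IsUnimodalDensity w a b) {x y : ℝ} (h0 : 0 ≤ x) (hxy : x ≤ y) :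
    (∫ t in (0:ℝ)..y, w t) - ∫ t in (0:ℝ)..x, w t ≤ (y - x) / 2 := by
  rw [intervalIntegral.integral_interval_sub_left (H.cont.intervalIntegrable _ _)
    (H.cont.intervalIntegrable _ _)]
  calc _ ≤ ∫ _t in x..y, (1 / 2 : ℝ) :=
        intervalIntegral.integral_mono_on hxy (H.cont.intervalIntegrable _ _) (by simp)
          fun t ht => H.le_half t (h0.trans ht.1)
    _ = _ := by simp; ring

/-- The inverse function of the complementary distribution function of `w`. -/
lemma exists_inverse (H : IsUnimodalDensity w a b) : ∃ m : ℝ → ℝ,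
    ∀ s ∈ Set.Icc 0 (∫ t in (0:ℝ)..b, w t), m s ∈ Set.Icc 0 b ∧
      ∫ t in (0:ℝ)..(m s), w t = (∫ t in (0:ℝ)..b, w t) - s := by
  have hb : 0 ≤ b := H.mode_nonneg.trans H.mode_lt.le
  have h : ∀ s : ℝ, ∃ y, s ∈ Set.Icc 0 (∫ t in (0:ℝ)..b, w t) → y ∈ Set.Icc 0 b ∧
      ∫ t in (0:ℝ)..y, w t = (∫ t in (0:ℝ)..b, w t) - s := by
    intro s
    by_cases hs : s ∈ Set.Icc 0 (∫ t in (0:ℝ)..b, w t)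
    · have := intermediate_value_Icc hb (f := fun y => ∫ t in (0:ℝ)..y, w t) (fun y _ =>
        (H.cont.integral_hasStrictDerivAt 0 y).hasDerivAt.continuousAt.continuousWithinAt)
      obtain ⟨y, hy, h1⟩ := @this ((∫ t in (0:ℝ)..b, w t) - s)
        ⟨by simp; exact hs.2, by simp; exact hs.1⟩
      exact ⟨y, fun _ => ⟨hy, h1⟩⟩
    · exact ⟨0, fun h => absurd h hs⟩
  choose m hm using h
  exact ⟨m, hm⟩

section Inverse
variable {m : ℝ → ℝ} {L : ℝ}

lemma isProfile (H : IsUnimodalDensity w a b) (hL : L = ∫ t in (0:ℝ)..b, w t)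
    (hm : ∀ s ∈ Set.Icc 0 L, m s ∈ Set.Icc 0 b ∧ ∫ t in (0:ℝ)..(m s), w t = L - s) :
    IsProfile m (L - ∫ t in (0:ℝ)..a, w t) L := by
  have hb : 0 ≤ b := H.mode_nonneg.trans H.mode_lt.le
  have hmono := H.strictMonoOn_primitive
  have ha : a ∈ Set.Icc 0 b := ⟨H.mode_nonneg, H.mode_lt.le⟩
  have h0u : 0 ≤ ∫ t in (0:ℝ)..a, w t := by
    have := hmono.monotoneOn (Set.left_mem_Icc.2 hb) ha ha.1
    simpa using this
  have hLa : ∫ t in (0:ℝ)..a, w t ≤ L := by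
    rw [hL]; exact hmono.monotoneOn ha (Set.right_mem_Icc.2 hb) ha.2
  have hanti : AntitoneOn m (Set.Icc 0 L) := by
    intro s hs t ht hst
    refine (hmono.le_iff_le (hm t ht).1 (hm s hs).1).1 ?_
    rw [(hm t ht).2, (hm s hs).2]; linarith
  refine ⟨?_, ?_, ?_, by linarith, by linarith⟩
  · intro s hs t ht hst
    have h1 := hanti hs ht hst
    have h2 := H.primitive_sub_le (hm t ht).1.1 h1
    rw [(hm t ht).2, (hm s hs).2] at h2
    simp only
    linarith
  · refine ⟨convex_Icc _ _, fun s hs t ht α β hα hβ hαβ => ?_⟩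
    have sub : Set.Icc 0 (L - ∫ t in (0:ℝ)..a, w t) ⊆ Set.Icc 0 L :=
      Set.Icc_subset_Icc_right (by linarith)
    have key : ∀ s ∈ Set.Icc 0 (L - ∫ t in (0:ℝ)..a, w t), m s ∈ Set.Icc a b := by
      intro s hs
      refine ⟨(hmono.le_iff_le ha (hm s (sub hs)).1).1 ?_, (hm s (sub hs)).1.2⟩
      rw [(hm s (sub hs)).2]; linarith [hs.2]
    have hst := (convex_Icc _ _) hs ht hα hβ hαβ
    have h1 := H.concaveOn_primitive.2 (key s hs) (key t ht) hα hβ hαβ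
    have h2 := (convex_Icc _ _) (key s hs) (key t ht) hα hβ hαβ
    refine (hmono.le_iff_le (hm _ (sub hst)).1 ⟨H.mode_nonneg.trans h2.1, h2.2⟩).1 ?_
    simp only at h1 ⊢
    rw [(hm s (sub hs)).2, (hm t (sub ht)).2] at h1
    rw [(hm _ (sub hst)).2]
    refine le_trans (le_of_eq ?_) h1
    simp only [smul_eq_mul]
    linear_combination (-L) * hαβ
  · refine ⟨convex_Icc _ _, fun s hs t ht α β hα hβ hαβ => ?_⟩
    have sub : Set.Icc (L - ∫ t in (0:ℝ)..a, w t) L ⊆ Set.Icc 0 L :=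
      Set.Icc_subset_Icc_left (by linarith)
    have key : ∀ s ∈ Set.Icc (L - ∫ t in (0:ℝ)..a, w t) L, m s ∈ Set.Icc 0 a := by
      intro s hs
      refine ⟨(hm s (sub hs)).1.1, (hmono.le_iff_le (hm s (sub hs)).1 ha).1 ?_⟩
      rw [(hm s (sub hs)).2]; linarith [hs.1]
    have hst := (convex_Icc _ _) hs ht hα hβ hαβ
    have h1 := H.convexOn_primitive.2 (key s hs) (key t ht) hα hβ hαβ
    have h2 := (convex_Icc _ _) (key s hs) (key t ht) hα hβ hαβ
    refine (hmono.le_iff_le ⟨h2.1, h2.2.trans ha.2⟩ (hm _ (sub hst)).1).1 ?_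
    simp only at h1 ⊢
    rw [(hm s (sub hs)).2, (hm t (sub ht)).2] at h1
    rw [(hm _ (sub hst)).2]
    refine h1.trans (le_of_eq ?_)
    simp only [smul_eq_mul]
    linear_combination L * hαβ

lemma integral_inverse (H : IsUnimodalDensity w a b) (hL : L = ∫ t in (0:ℝ)..b, w t)
    (hm : ∀ s ∈ Set.Icc 0 L, m s ∈ Set.Icc 0 b ∧ ∫ t in (0:ℝ)..(m s), w t = L - s)
    {s : ℝ} (hs : s ∈ Set.Icc 0 L) : ∫ t in s..L, m t = ∫ y in (0:ℝ)..(m s), y * w y := by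
  have hb : 0 ≤ b := H.mode_nonneg.trans H.mode_lt.le
  have hmono := H.strictMonoOn_primitive
  obtain ⟨f, hf⟩ : ∃ f : ℝ → ℝ, f = fun y => L - ∫ t in (0:ℝ)..y, w t := ⟨_, rfl⟩
  have hfc : Continuous f := by
    rw [hf]
    exact continuous_const.sub (continuous_iff_continuousAt.2 fun y =>
      (H.cont.integral_hasStrictDerivAt 0 y).hasDerivAt.continuousAt)
  have hms := (hm s hs).1
  have hinv : ∀ y ∈ Set.Icc 0 b, f y ∈ Set.Icc 0 L ∧ m (f y) = y := by
    intro y hy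
    have h1 : f y ∈ Set.Icc 0 L := by
      have i1 := hmono.monotoneOn (Set.left_mem_Icc.2 hb) hy hy.1
      have i2 := hmono.monotoneOn hy (Set.right_mem_Icc.2 hb) hy.2
      simp only [intervalIntegral.integral_same] at i1 i2
      rw [hf]
      exact ⟨by simp only; rw [hL]; linarith, by simp only; linarith⟩
    refine ⟨h1, hmono.injOn (hm _ h1).1 hy ?_⟩
    rw [(hm _ h1).2, hf]; ring
  have himg : f '' Set.Icc 0 (m s) = Set.Icc s L := by
    ext t
    constructor
    · rintro ⟨y, hy, rfl⟩
      have hy' : y ∈ Set.Icc 0 b := ⟨hy.1, hy.2.trans hms.2⟩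
      refine ⟨?_, (hinv y hy').1.2⟩
      have := hmono.monotoneOn hy' hms hy.2
      rw [(hm s hs).2] at this
      rw [hf]; simp only; linarith
    · intro ht
      have ht' : t ∈ Set.Icc 0 L := ⟨hs.1.trans ht.1, ht.2⟩
      refine ⟨m t, ⟨(hm t ht').1.1, ?_⟩, ?_⟩
      · refine (hmono.le_iff_le (hm t ht').1 hms).1 ?_
        rw [(hm t ht').2, (hm s hs).2]; linarith [ht.1]
      · rw [hf]; simp only; rw [(hm t ht').2]; ring
  have key := integral_image_eq_integral_abs_deriv_smul (s := Set.Icc 0 (m s)) (f := f)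
    (f' := fun y => -w y) measurableSet_Icc (fun y _ => by
      rw [hf]
      exact ((H.cont.integral_hasStrictDerivAt 0 y).hasDerivAt.const_sub L).hasDerivWithinAt)
    (fun y hy z hz h => by
      rw [← (hinv y ⟨hy.1, hy.2.trans hms.2⟩).2, h, (hinv z ⟨hz.1, hz.2.trans hms.2⟩).2]) m
  rw [himg, integral_Icc_eq_integral_Ioc, integral_Icc_eq_integral_Ioc,
    ← intervalIntegral.integral_of_le hs.2, ← intervalIntegral.integral_of_le hms.1] at key
  rw [key]
  refine intervalIntegral.integral_congr_ae ?_
  have hne : ∀ᵐ y : ℝ, y ≠ b := by simp [ae_iff]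
  filter_upwards [hne] with y hyb hy
  rw [Set.uIoc_of_le hms.1] at hy
  have hy' : y ∈ Set.Icc 0 b := ⟨hy.1.le, hy.2.trans hms.2⟩
  rw [(hinv y hy').2, abs_neg, abs_of_pos (H.pos y hy.1 (lt_of_le_of_ne hy'.2 hyb)), smul_eq_mul,
    mul_comm]

end Inverse

end IsUnimodalDensity

lemma two_mul_sum_le_of_le_inverse {n : ℕ → ℕ} {J K : ℕ} {x : ℕ → ℝ} (hJ : ∀ i, n i ≤ J)
    (hx : ∀ j i, j < n i → (i : ℝ) ≤ x j) (hx0 : ∀ j < J, 0 ≤ x j) :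
    ((n 0 + 2 * ∑ i ∈ Finset.Icc 1 K, n i : ℕ) : ℝ) ≤ ∑ j ∈ Finset.range J, (1 + 2 * x j) := by
  have h1 : ∀ i, n i = ∑ j ∈ Finset.range J, if j < n i then 1 else 0 := by
    intro i
    rw [← Finset.sum_filter, Finset.sum_const, smul_eq_mul, mul_one]
    have : (Finset.range J).filter (fun j => j < n i) = Finset.range (n i) := by
      ext j
      have := hJ i
      simp only [Finset.mem_filter, Finset.mem_range]
      omega
    rw [this, Finset.card_range]
  have h2 : n 0 + 2 * ∑ i ∈ Finset.Icc 1 K, n i = ∑ j ∈ Finset.range J,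
      ((if j < n 0 then 1 else 0) + 2 * ∑ i ∈ Finset.Icc 1 K, if j < n i then 1 else 0) := by
    rw [Finset.sum_add_distrib, ← Finset.mul_sum, Finset.sum_comm, ← h1 0]
    congr 2
    exact Finset.sum_congr rfl fun i _ => h1 i
  rw [h2]
  push_cast
  refine Finset.sum_le_sum fun j hj => ?_
  have hxj := hx0 j (Finset.mem_range.1 hj)
  have h3 : (∑ i ∈ Finset.Icc 1 K, if j < n i then (1 : ℝ) else 0) ≤ x j := by
    rw [← Finset.sum_filter, Finset.sum_const, nsmul_eq_mul, mul_one]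
    have : (Finset.Icc 1 K).filter (fun i => j < n i) ⊆ Finset.Icc 1 ⌊x j⌋₊ := by
      intro i hi
      simp only [Finset.mem_filter, Finset.mem_Icc] at hi ⊢
      exact ⟨hi.1.1, Nat.le_floor (hx j i hi.2)⟩
    have h4 := Finset.card_le_card this
    rw [Nat.card_Icc, Nat.add_sub_cancel] at h4
    exact le_trans (by exact_mod_cast h4) (Nat.floor_le hxj)
  have h5 : (if j < n 0 then (1 : ℝ) else 0) ≤ 1 := by split_ifs <;> norm_num
  linarith

namespace IsUnimodalDensity
variable {w : ℝ → ℝ} {a b L : ℝ}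

lemma exists_count_le_sum (H : IsUnimodalDensity w a b) (hL : L = ∫ t in (0:ℝ)..b, w t)
    {n : ℕ → ℕ} {J K : ℕ} (hJ : ∀ i, n i ≤ J) (hJL : (J : ℝ) ≤ L + 7 / 25)
    (hn : ∀ i, n i ≠ 0 → (i : ℝ) ≤ b ∧ (n i : ℝ) ≤ L - (∫ t in (0:ℝ)..i, w t) + 7 / 25) :
    ∃ m : ℝ → ℝ, (∀ s ∈ Set.Icc 0 L, m s ∈ Set.Icc 0 b ∧ ∫ t in (0:ℝ)..(m s), w t = L - s) ∧
      ((n 0 + 2 * ∑ i ∈ Finset.Icc 1 K, n i : ℕ) : ℝ) ≤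
        ∑ j ∈ Finset.range J, (1 + 2 * m (18 / 25 + j)) := by
  obtain ⟨m, hm⟩ := H.exists_inverse
  rw [← hL] at hm
  have hmem : ∀ j < J, (18 / 25 + j : ℝ) ∈ Set.Icc 0 L := by
    intro j hj
    have : (j : ℝ) + 1 ≤ J := by exact_mod_cast hj
    exact ⟨by positivity, by linarith⟩
  refine ⟨m, hm, two_mul_sum_le_of_le_inverse hJ (fun j i hji => ?_)
    fun j hj => (hm _ (hmem j hj)).1.1⟩
  obtain ⟨h1, h2⟩ := hn i (by omega)
  have h3 := hm _ (hmem j (hji.trans_le (hJ i)))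
  have h4 : (j : ℝ) + 1 ≤ n i := by exact_mod_cast hji
  refine (H.strictMonoOn_primitive.le_iff_le ⟨Nat.cast_nonneg i, h1⟩ h3.1).1 ?_
  rw [h3.2]
  linarith

/-- Lattice points under a profile with at least two rows: area plus explicit boundary terms. -/
theorem exists_count_le (H : IsUnimodalDensity w a b) (hL : L = ∫ t in (0:ℝ)..b, w t)
    {n : ℕ → ℕ} {J K : ℕ} (hJ : ∀ i, n i ≤ J) (hJL : (J : ℝ) ≤ L + 7 / 25) (hJ2 : 2 ≤ J)
    (hn : ∀ i, n i ≠ 0 → (i : ℝ) ≤ b ∧ (n i : ℝ) ≤ L - (∫ t in (0:ℝ)..i, w t) + 7 / 25) :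
    ∃ M ∈ Set.Icc 0 b, (∫ t in (0:ℝ)..M, w t) ≤ L - 43 / 25 ∧ ∃ I : ℝ,
      ((n 0 + 2 * ∑ i ∈ Finset.Icc 1 K, n i : ℕ) : ℝ) ≤ 2 * (∫ y in (0:ℝ)..b, y * w y) - 2 * I
        - 2 * (∫ y in (0:ℝ)..M, w y * (y + 1 / 2)) + M + L - 11 / 50 ∧
      ((∃ x ∈ Set.Icc a b, (∫ t in (0:ℝ)..x, w t) = L - 11 / 100 ∧ 11 / 50 * x ≤ I) ∨
        (L - 11 / 50 < (∫ t in (0:ℝ)..a, w t) ∧ a * (11 / 50 - (11 / 50) ^ 2 / (2 * L)) ≤ I)) := by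
  obtain ⟨m, hm, hN⟩ := H.exists_count_le_sum (K := K) hL hJ hJL hn
  have hP := H.isProfile hL hm
  obtain ⟨k, rfl⟩ : ∃ k, J = k + 1 := ⟨J - 1, by omega⟩
  have hk : (1 : ℝ) ≤ k := by exact_mod_cast (by omega : 1 ≤ k)
  push_cast at hJL
  have hL1 : 43 / 25 ≤ L := by linarith
  have hkL : 18 / 25 + (k : ℝ) ≤ L := by linarith
  have hmk := hm (18 / 25 + k) ⟨by positivity, hkL⟩
  have hsum := hP.sum_le k (σ := 18 / 25) (by norm_num) hkL
  have e1 := H.integral_inverse hL hm (s := 0) ⟨le_rfl, by linarith⟩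
  have e2 := H.integral_inverse hL hm (s := 18 / 25 + k) ⟨by positivity, hkL⟩
  have hm0 : m 0 = b := by
    have h0 := hm 0 ⟨le_rfl, by linarith⟩
    refine H.strictMonoOn_primitive.injOn h0.1
      ⟨H.mode_nonneg.trans H.mode_lt.le, le_rfl⟩ ?_
    rw [h0.2, hL]; ring
  rw [hm0] at e1
  have e3 := hP.add (α := 0) (β := 18 / 25 - 1 / 2) (γ := L) le_rfl (by norm_num) (by linarith) le_rfl
  have e4 := hP.add (α := 18 / 25 - 1 / 2) (β := 18 / 25 + k) (γ := L) (by norm_num) (by linarith)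
    hkL le_rfl
  have e5 : ∫ y in (0:ℝ)..(m (18 / 25 + k)), w y * (y + 1 / 2) =
      (∫ y in (0:ℝ)..(m (18 / 25 + k)), y * w y) + (L - (18 / 25 + k)) / 2 := by
    rw [← hmk.2, ← intervalIntegral.integral_div, ← intervalIntegral.integral_add
      (Continuous.intervalIntegrable (by have := H.cont; fun_prop) _ _)
      (Continuous.intervalIntegrable (by have := H.cont; fun_prop) _ _)]
    congr 1; ext y; ring
  refine ⟨m (18 / 25 + k), hmk.1, by rw [hmk.2]; linarith,
    ∫ s in (0:ℝ)..(18 / 25 - 1 / 2), m s, ?_, ?_⟩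
  · refine hN.trans ?_
    rw [Finset.sum_add_distrib, ← Finset.mul_sum]
    simp only [Finset.sum_const, Finset.card_range, nsmul_eq_mul, mul_one]
    push_cast
    rw [e5]
    linarith
  · rw [show (18 / 25 - 1 / 2 : ℝ) = 11 / 50 by norm_num]
    rcases le_or_gt (11 / 50) (L - ∫ t in (0:ℝ)..a, w t) with h | h
    · left
      have hx := hm (11 / 100) ⟨by norm_num, by linarith⟩
      refine ⟨m (11 / 100), ⟨?_, hx.1.2⟩, hx.2, ?_⟩
      · refine (H.strictMonoOn_primitive.le_iff_le ⟨H.mode_nonneg, H.mode_lt.le⟩ hx.1).1 ?_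
        rw [hx.2]; linarith
      · have := ConvexOn.mul_le_integral (f := m) (x := 11 / 100) (h := 11 / 100) (by norm_num)
          (hP.convex.subset (Set.Icc_subset_Icc (by norm_num) (by linarith)) (convex_Icc _ _))
          (hP.intervalIntegrable (by norm_num) (by linarith) (by norm_num) (by linarith))
        norm_num at this ⊢
        exact this
    · right
      refine ⟨by linarith, ?_⟩
      have e6 : ∫ s in (0:ℝ)..(11 / 50), (a * (1 - s / L)) =
          a * (11 / 50 - (11 / 50) ^ 2 / (2 * L)) := by
        rw [intervalIntegral.integral_const_mul, intervalIntegral.integral_sub (by simp)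
          (by apply Continuous.intervalIntegrable; fun_prop), intervalIntegral.integral_div]
        simp
        left
        field_simp
      rw [← e6]
      have hp0 : 0 ≤ L - ∫ t in (0:ℝ)..a, w t := hP.nonneg
      have hpL : L - (∫ t in (0:ℝ)..a, w t) ≤ L := hP.le
      have hmp : m (L - ∫ t in (0:ℝ)..a, w t) = a := by
        have h0 := hm (L - ∫ t in (0:ℝ)..a, w t) ⟨hp0, hpL⟩
        refine H.strictMonoOn_primitive.injOn h0.1 ⟨H.mode_nonneg, H.mode_lt.le⟩ ?_
        rw [h0.2]; ring
      refine intervalIntegral.integral_mono_on (by norm_num)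
        (by apply Continuous.intervalIntegrable; fun_prop)
        (hP.intervalIntegrable (by norm_num) (by linarith) (by norm_num) (by linarith))
        fun s hs => ?_
      have ha := H.mode_nonneg
      have hsL : 0 ≤ s / L := div_nonneg hs.1 (by linarith)
      rcases le_or_gt s (L - ∫ t in (0:ℝ)..a, w t) with h1 | h1
      · have := hP.antitoneOn ⟨hs.1, by linarith⟩ ⟨hp0, hpL⟩ h1
        rw [hmp] at this
        nlinarith
      · obtain ⟨p, hp⟩ : ∃ p, p = L - ∫ t in (0:ℝ)..a, w t := ⟨_, rfl⟩
        rw [← hp] at hmp h1 hp0 hpL h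
        have hcon := hP.concave
        rw [← hp] at hcon
        have hs2 := hs.2
        have hpos : 0 < L - p := by linarith
        have hc := hcon.2 (Set.left_mem_Icc.2 hpL) (Set.right_mem_Icc.2 hpL)
          (div_nonneg (by linarith) hpos.le : 0 ≤ (L - s) / (L - p))
          (div_nonneg (by linarith) hpos.le : 0 ≤ (s - p) / (L - p))
          (by field_simp; ring)
        have e7 : (L - s) / (L - p) * p + (s - p) / (L - p) * L = s := by
          field_simp; ring
        simp only [smul_eq_mul] at hc
        rw [e7, hmp] at hc
        have hmL := (hm L ⟨by linarith, le_rfl⟩).1.1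
        have h2 : 1 - s / L ≤ (L - s) / (L - p) := by
          rw [show 1 - s / L = (L - s) / L by field_simp]
          gcongr <;> linarith
        have h3 : 0 ≤ (s - p) / (L - p) * m L :=
          mul_nonneg (div_nonneg (by linarith) hpos.le) hmL
        nlinarith [mul_le_mul_of_nonneg_left h2 ha]

end IsUnimodalDensity

lemma continuous_arccos_div (b : ℝ) : Continuous fun y : ℝ => arccos (y / b) :=
  continuous_arccos.comp (continuous_id.div_const b)

lemma arccos_div_eq_zero {y b : ℝ} (hb : 0 < b) (h : b ≤ y) : arccos (y / b) = 0 :=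
  arccos_eq_zero.2 (by rwa [le_div_iff₀ hb, one_mul])

lemma hasDerivAt_arccos_div {b t : ℝ} (ht : 0 ≤ t) (htb : t < b) :
    HasDerivAt (fun y => arccos (y / b)) (-(1 / √(b ^ 2 - t ^ 2))) t := by
  have hb : 0 < b := ht.trans_lt htb
  have h1 : t / b < 1 := (div_lt_one hb).2 htb
  have h2 : 0 ≤ t / b := by positivity
  have h := (hasDerivAt_arccos (x := t / b) (by linarith) h1.ne).comp t
    ((hasDerivAt_id t).div_const b)
  refine h.congr_deriv ?_
  have e : 1 - (t / b) ^ 2 = (b ^ 2 - t ^ 2) / b ^ 2 := by field_simp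
  have hpos : 0 < b ^ 2 - t ^ 2 := by nlinarith
  rw [e, Real.sqrt_div' _ (by positivity), Real.sqrt_sq hb.le]
  have := Real.sqrt_pos.2 hpos
  field_simp

/-- The Debye phase as a function of the order is a primitive of `-arccos`. -/
lemma integral_arccos_div {y b : ℝ} (hy : 0 ≤ y) (hb : 0 < b) :
    ∫ t in (0:ℝ)..y, arccos (t / b) = b - debye y b := by
  have key : ∀ y, 0 ≤ y → y ≤ b → ∫ t in (0:ℝ)..y, arccos (t / b) = b - debye y b := by
    intro y hy hyb
    have h := intervalIntegral.integral_eq_sub_of_hasDerivAt_of_le hy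
      (f := fun t => -debye t b) (f' := fun t => arccos (t / b)) ?_ (fun t ht => ?_)
      ((continuous_arccos_div b).intervalIntegrable _ _)
    · rw [h, debye_zero hb.le]; ring
    · unfold debye
      have := continuous_arccos_div b
      fun_prop
    · have ht0 := ht.1
      have htb : t < b := ht.2.trans_le hyb
      have hpos : 0 < b ^ 2 - t ^ 2 := by nlinarith
      have h1 := (((hasDerivAt_id t).pow 2).const_sub (b ^ 2)).sqrt hpos.ne'
      have h2 := (hasDerivAt_id t).mul (hasDerivAt_arccos_div ht0.le htb)
      refine ((h1.sub h2).neg).congr_deriv ?_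
      have := Real.sqrt_pos.2 hpos
      simp
      field_simp
      ring
  rcases le_or_gt y b with h | h
  · exact key y hy h
  · rw [debye_of_le hb h.le, ← intervalIntegral.integral_add_adjacent_intervals
      ((continuous_arccos_div b).intervalIntegrable 0 b)
      ((continuous_arccos_div b).intervalIntegrable b y), key b hb.le le_rfl,
      debye_of_le hb le_rfl]
    have : ∫ t in b..y, arccos (t / b) = ∫ t in b..y, (0:ℝ) :=
      intervalIntegral.integral_congr fun t ht => by
        rw [Set.uIcc_of_le h.le] at ht
        exact arccos_div_eq_zero hb ht.1
    rw [this]; simp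

lemma integral_mul_arccos_div {y b : ℝ} (hb : 0 < b) (hby : b ≤ y) :
    ∫ t in (0:ℝ)..y, t * arccos (t / b) = π * b ^ 2 / 8 := by
  have hintg : ∀ α β, IntervalIntegrable (fun t => t * arccos (t / b)) volume α β := fun α β =>
    (continuous_id.mul (continuous_arccos_div b)).intervalIntegrable _ _
  rw [← intervalIntegral.integral_add_adjacent_intervals (hintg 0 b) (hintg b y)]
  have h0 : ∫ t in b..y, t * arccos (t / b) = ∫ t in b..y, (0:ℝ) :=
    intervalIntegral.integral_congr fun t ht => by
      rw [Set.uIcc_of_le hby] at ht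
      rw [arccos_div_eq_zero hb ht.1, mul_zero]
  rw [h0]
  have h := intervalIntegral.integral_eq_sub_of_hasDerivAt_of_le hb.le
    (f := fun t => t ^ 2 / 2 * arccos (t / b) - t / 4 * √(b ^ 2 - t ^ 2)
      - b ^ 2 / 4 * arccos (t / b)) (f' := fun t => t * arccos (t / b)) ?_ (fun t ht => ?_)
    (hintg 0 b)
  · rw [h]
    simp [hb.ne']
    ring
  · have := continuous_arccos_div b
    fun_prop
  · have ht0 := ht.1
    have hpos : 0 < b ^ 2 - t ^ 2 := by nlinarith [ht.2]
    have h1 := (((hasDerivAt_id t).pow 2).const_sub (b ^ 2)).sqrt hpos.ne'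
    have h2 := hasDerivAt_arccos_div ht0.le ht.2
    refine ((((((hasDerivAt_id t).pow 2).div_const 2).mul h2).sub
      (((hasDerivAt_id t).div_const 4).mul h1)).sub (h2.const_mul (b ^ 2 / 4))).congr_deriv ?_
    have h3 := Real.sqrt_pos.2 hpos
    have h4 := Real.sq_sqrt hpos.le
    simp
    field_simp
    rw [h4]
    ring

lemma isUnimodalDensity_disk {b : ℝ} (hb : 0 < b) :
    IsUnimodalDensity (fun y => arccos (y / b) / π) 0 b where
  cont := (continuous_arccos_div b).div_const π
  pos y _ hyb := div_pos (arccos_pos.2 ((div_lt_one hb).2 hyb)) pi_pos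
  le_half y hy := by
    have := arccos_le_pi_div_two.2 (div_nonneg hy hb.le)
    rw [div_le_iff₀ pi_pos]; linarith
  mono := by simp
  anti := fun x _ y _ hxy => by
    simp only
    gcongr
  mode_nonneg := le_rfl
  mode_lt := hb

/-- The density attached to an annulus. -/
noncomputable def annulusDensity (a b y : ℝ) : ℝ := (arccos (y / b) - arccos (y / a)) / π

lemma monotoneOn_arcsin_sub : MonotoneOn (fun t => arcsin t - t) (Set.Icc 0 1) := by
  refine monotoneOn_of_deriv_nonneg (convex_Icc 0 1) (by fun_prop) (fun t ht => ?_) fun t ht => ?_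
  all_goals rw [interior_Icc] at ht
  · exact ((hasDerivAt_arcsin (by linarith [ht.1]) ht.2.ne).sub
      (hasDerivAt_id t)).differentiableAt.differentiableWithinAt
  · have hd : HasDerivAt (fun t => arcsin t - t) _ t :=
      (hasDerivAt_arcsin (by linarith [ht.1]) ht.2.ne).sub (hasDerivAt_id t)
    rw [hd.deriv]
    have h1 : 0 < 1 - t ^ 2 := by nlinarith [ht.1, ht.2]
    have h2 : √(1 - t ^ 2) ≤ 1 := Real.sqrt_le_one.2 (by nlinarith)
    have := one_le_one_div (Real.sqrt_pos.2 h1) h2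
    linarith

lemma mul_le_pi_mul_annulusDensity {a b y : ℝ} (ha : 0 < a) (hab : a < b) (hy : 0 ≤ y)
    (hya : y ≤ a) : (1 / a - 1 / b) * y ≤ π * annulusDensity a b y := by
  have h := monotoneOn_arcsin_sub (a := y / b) (b := y / a)
    ⟨div_nonneg hy (by linarith), by rw [div_le_one (by linarith)]; linarith⟩
    ⟨by positivity, by rwa [div_le_one ha]⟩ (by gcongr)
  unfold annulusDensity
  rw [mul_div_cancel₀ _ pi_ne_zero, arccos, arccos]
  simp only at h
  have : (1 / a - 1 / b) * y = y / a - y / b := by ring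
  linarith

lemma isUnimodalDensity_annulus {a b : ℝ} (ha : 0 < a) (hab : a < b) :
    IsUnimodalDensity (annulusDensity a b) a b where
  cont := ((continuous_arccos_div b).sub (continuous_arccos_div a)).div_const π
  pos y hy hyb := by
    have hb := ha.trans hab
    refine div_pos (sub_pos.2 ?_) pi_pos
    rcases le_or_gt y a with h | h
    · exact arccos_lt_arccos (by have : 0 ≤ y / b := by positivity
                                 linarith) (by gcongr) (by rwa [div_le_one ha])
    · rw [arccos_div_eq_zero ha h.le]
      exact arccos_pos.2 ((div_lt_one hb).2 hyb)
  le_half y hy := by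
    have h1 := arccos_le_pi_div_two.2 (div_nonneg hy (ha.trans hab).le)
    have h2 := arccos_nonneg (y / a)
    unfold annulusDensity
    rw [div_le_iff₀ pi_pos]; linarith
  mono := by
    have hc : Continuous (annulusDensity a b) :=
      ((continuous_arccos_div b).sub (continuous_arccos_div a)).div_const π
    have hd : ∀ t ∈ interior (Set.Icc 0 a), HasDerivAt (annulusDensity a b)
        ((-(1 / √(b ^ 2 - t ^ 2)) - -(1 / √(a ^ 2 - t ^ 2))) / π) t := fun t ht => by
      rw [interior_Icc] at ht
      exact ((hasDerivAt_arccos_div ht.1.le (ht.2.trans hab)).sub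
        (hasDerivAt_arccos_div ht.1.le ht.2)).div_const π
    refine monotoneOn_of_deriv_nonneg (convex_Icc 0 a) hc.continuousOn
      (fun t ht => (hd t ht).differentiableAt.differentiableWithinAt) fun t ht => ?_
    rw [(hd t ht).deriv]
    rw [interior_Icc] at ht
    have h1 : 0 < a ^ 2 - t ^ 2 := by nlinarith [ht.1, ht.2]
    have h2 : √(a ^ 2 - t ^ 2) ≤ √(b ^ 2 - t ^ 2) := Real.sqrt_le_sqrt (by nlinarith)
    have := one_div_le_one_div_of_le (Real.sqrt_pos.2 h1) h2
    exact div_nonneg (by linarith) pi_pos.le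
  anti := fun x hx y hy hxy => by
    unfold annulusDensity
    rw [arccos_div_eq_zero ha hx.1, arccos_div_eq_zero ha hy.1]
    have hb := ha.trans hab
    gcongr
  mode_nonneg := ha.le
  mode_lt := hab

lemma integral_annulusDensity {a b y : ℝ} (ha : 0 < a) (hab : a < b) (hy : 0 ≤ y) :
    ∫ t in (0:ℝ)..y, annulusDensity a b t = (b - a - (debye y b - debye y a)) / π := by
  unfold annulusDensity
  rw [intervalIntegral.integral_div, intervalIntegral.integral_sub
    ((continuous_arccos_div b).intervalIntegrable _ _)
    ((continuous_arccos_div a).intervalIntegrable _ _), integral_arccos_div hy (ha.trans hab),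
    integral_arccos_div hy ha]
  ring

lemma integral_mul_annulusDensity {a b : ℝ} (ha : 0 < a) (hab : a < b) :
    ∫ t in (0:ℝ)..b, t * annulusDensity a b t = (b ^ 2 - a ^ 2) / 8 := by
  have h : ∀ t, t * annulusDensity a b t = (t * arccos (t / b) - t * arccos (t / a)) / π := by
    intro t; unfold annulusDensity; ring
  simp_rw [h]
  have hintg : ∀ c : ℝ, IntervalIntegrable (fun t => t * arccos (t / c)) volume 0 b := fun c =>
    (continuous_id.mul (continuous_arccos_div c)).intervalIntegrable _ _
  rw [intervalIntegral.integral_div, intervalIntegral.integral_sub (hintg b) (hintg a),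
    integral_mul_arccos_div (ha.trans hab) le_rfl, integral_mul_arccos_div ha hab.le]
  field_simp

lemma integral_disk_density {b y : ℝ} (hb : 0 < b) (hy : 0 ≤ y) :
    ∫ t in (0:ℝ)..y, arccos (t / b) / π = (b - debye y b) / π := by
  rw [intervalIntegral.integral_div, integral_arccos_div hy hb]

lemma integral_mul_disk_density {b : ℝ} (hb : 0 < b) :
    ∫ t in (0:ℝ)..b, t * (arccos (t / b) / π) = b ^ 2 / 8 := by
  have h : ∀ t, t * (arccos (t / b) / π) = t * arccos (t / b) / π := fun t => by ring
  simp_rw [h]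
  rw [intervalIntegral.integral_div, integral_mul_arccos_div hb le_rfl]
  field_simp

lemma debye_le_sub {m b : ℝ} (hm : 0 ≤ m) (hb : 0 < b) (hmb : m ≤ b) : debye m b ≤ b - m := by
  have h1 : 0 ≤ m / b := by positivity
  have h2 : m / b ≤ 1 := by rwa [div_le_one hb]
  have h3 : √(1 - (m / b) ^ 2) ≤ arccos (m / b) := by
    rw [← sin_arccos]
    exact sin_le (arccos_nonneg _)
  have h4 : √(b ^ 2 - m ^ 2) = b * √(1 - (m / b) ^ 2) := by
    rw [show b ^ 2 - m ^ 2 = b ^ 2 * (1 - (m / b) ^ 2) by field_simp, Real.sqrt_mul (by positivity),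
      Real.sqrt_sq hb.le]
  have h5 : √(1 - (m / b) ^ 2) ≤ 1 := Real.sqrt_le_one.2 (by nlinarith)
  unfold debye
  rw [h4]
  nlinarith [mul_le_mul_of_nonneg_left h3 hm, mul_le_mul_of_nonneg_left h5 (sub_nonneg.2 hmb)]

/-- Lower bound for the Debye phase near the turning point. -/
lemma eight_mul_sub_pow_le_debye {m b : ℝ} (hm : 0 ≤ m) (hb : 0 < b) (hmb : m ≤ b) :
    8 * (b - m) ^ 3 ≤ 9 * b * debye m b ^ 2 := by
  have hanti : AntitoneOn (fun y => debye y b - 2 * √2 / 3 * ((b - y) * √((b - y) / b)))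
      (Set.Icc 0 b) := by
    have hd : ∀ t ∈ interior (Set.Icc 0 b), HasDerivAt
        (fun y => debye y b - 2 * √2 / 3 * ((b - y) * √((b - y) / b)))
        (-arccos (t / b) + √2 * √((b - t) / b)) t := fun t ht => by
      rw [interior_Icc] at ht
      have ht0 := ht.1
      have htb := ht.2
      have hpos : 0 < b ^ 2 - t ^ 2 := by nlinarith
      have h1 := (((hasDerivAt_id t).pow 2).const_sub (b ^ 2)).sqrt hpos.ne'
      have h2 := (hasDerivAt_id t).mul (hasDerivAt_arccos_div ht0.le htb)
      have hq : 0 < (b - t) / b := div_pos (by linarith) hb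
      have h3 := (((hasDerivAt_id t).const_sub b).div_const b).sqrt hq.ne'
      have h4 := (((hasDerivAt_id t).const_sub b).mul h3).const_mul (2 * √2 / 3)
      refine ((h1.sub h2).sub h4).congr_deriv ?_
      have := Real.sqrt_pos.2 hpos
      have hs := Real.sqrt_pos.2 hq
      have hs2 : b - t = b * √((b - t) / b) ^ 2 := by
        rw [Real.sq_sqrt hq.le]; field_simp
      simp only [id, Pi.pow_apply]
      generalize √((b - t) / b) = s at *
      rw [hs2]
      field_simp
      ring
    refine antitoneOn_of_deriv_nonpos (convex_Icc 0 b) ?_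
      (fun t ht => (hd t ht).differentiableAt.differentiableWithinAt) fun t ht => ?_
    · unfold debye
      have := continuous_arccos_div b
      fun_prop
    · rw [(hd t ht).deriv]
      rw [interior_Icc] at ht
      have h1 : √2 * √((b - t) / b) ≤ arccos (t / b) := by
        rw [← Real.sqrt_mul (by norm_num)]
        refine Real.sqrt_le_iff.2 ⟨arccos_nonneg _, ?_⟩
        have := Real.one_sub_sq_div_two_le_cos (x := arccos (t / b))
        rw [cos_arccos (by have : 0 ≤ t / b := div_nonneg ht.1.le hb.le
                           linarith) ((div_le_one hb).2 ht.2.le)] at this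
        have e : (b - t) / b = 1 - t / b := by field_simp
        rw [e]; linarith
      linarith
  have h := hanti ⟨hm, hmb⟩ (Set.right_mem_Icc.2 hb.le) hmb
  simp only [debye_of_le hb le_rfl, sub_self, zero_mul, mul_zero] at h
  have hq : 0 ≤ (b - m) / b := div_nonneg (by linarith) hb.le
  have h1 : 0 ≤ 2 * √2 / 3 * ((b - m) * √((b - m) / b)) :=
    mul_nonneg (by positivity) (mul_nonneg (by linarith) (Real.sqrt_nonneg _))
  have h2 := pow_le_pow_left₀ h1 (sub_nonneg.1 h) 2
  have e : (2 * √2 / 3 * ((b - m) * √((b - m) / b))) ^ 2 = 8 / 9 * ((b - m) ^ 3 / b) := by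
    rw [mul_pow, div_pow, mul_pow, mul_pow, Real.sq_sqrt hq, Real.sq_sqrt (by norm_num)]
    field_simp; ring
  rw [e] at h2
  have h3 := mul_le_mul_of_nonneg_left h2 (by positivity : 0 ≤ 9 * b)
  have e2 : 9 * b * (8 / 9 * ((b - m) ^ 3 / b)) = 8 * (b - m) ^ 3 := by field_simp
  linarith

lemma half_one_sub_le_arccos_div_pi {t : ℝ} (h0 : 0 ≤ t) (h1 : t ≤ 1) :
    1 / 2 * (1 - t) ≤ arccos t / π := by
  rw [le_div_iff₀ pi_pos]
  have h2 : arccos t ∈ Set.Icc 0 (π / 2) := ⟨arccos_nonneg _, arccos_le_pi_div_two.2 h0⟩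
  have := one_sub_mul_le_cos h2.1 h2.2
  rw [cos_arccos (by linarith) h1] at this
  have hp := pi_pos
  field_simp at this ⊢
  linarith

lemma sub_le_of_debye_eq {x b : ℝ} (hx : 0 ≤ x) (hb : 0 < b) (hxb : x ≤ b)
    (h : debye x b ≤ 11 / 100 * π) : b - x ≤ 467 / 10000 * b + 654 / 1000 := by
  have h1 := eight_mul_sub_pow_le_debye hx hb hxb
  have h2 := debye_nonneg hx hb
  have h3 : debye x b ≤ 34558 / 100000 := by linarith [pi_lt_d6]
  have h4 : debye x b ^ 2 ≤ (34558 / 100000) ^ 2 := by gcongr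
  have h5 : 8 * (b - x) ^ 3 ≤ 9 * b * (34558 / 100000) ^ 2 := h1.trans (by gcongr)
  have h6 : 0 ≤ (b - x - 981 / 1000) ^ 2 * (b - x + 2 * (981 / 1000)) :=
    mul_nonneg (sq_nonneg _) (by linarith)
  nlinarith

/-- The counts satisfy the lattice bound in the almost-disk regime. -/
lemma count_le_of_le {a b : ℝ} (ha : 0 < a) (ha1 : a ≤ 13 / 10) (hab' : a + 43 / 25 * π ≤ b) (K : ℕ) :
    ((⌊debye (0 : ℕ) b / π + 7 / 25⌋₊ +
      2 * ∑ i ∈ Finset.Icc 1 K, ⌊debye (i : ℕ) b / π + 7 / 25⌋₊ : ℕ) : ℝ) ≤ (b ^ 2 - a ^ 2) / 4 := by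
  have hab : a + 54 / 10 ≤ b := by linarith [pi_gt_d6]
  have hb : 0 < b := by linarith
  have H := isUnimodalDensity_disk hb
  have hp := pi_pos
  have hp1 := pi_gt_d6
  have hp2 := pi_lt_d6
  have hL : b / π = ∫ t in (0:ℝ)..b, arccos (t / b) / π := by
    rw [integral_disk_density hb hb.le, debye_of_le hb le_rfl, sub_zero]
  have hn0 : ∀ i : ℕ, 0 ≤ debye i b / π + 7 / 25 := fun i => by
    have := debye_nonneg (Nat.cast_nonneg i) hb
    positivity
  obtain ⟨n, hn⟩ : ∃ n : ℕ → ℕ, n = fun i : ℕ => ⌊debye i b / π + 7 / 25⌋₊ := ⟨_, rfl⟩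
  have hnle : ∀ i : ℕ, (n i : ℝ) ≤ debye i b / π + 7 / 25 := fun i => by
    rw [hn]; exact Nat.floor_le (hn0 i)
  have h2 : (43 / 25 : ℝ) ≤ b / π := by
    rw [le_div_iff₀ hp]; linarith
  obtain ⟨M, hM, hMu, I, hN, hI⟩ := H.exists_count_le (n := n) (K := K) (J := ⌊b / π + 7 / 25⌋₊) hL
    (fun i => by
      refine Nat.le_floor ((hnle i).trans ?_)
      have h3 : debye i b ≤ b := by
        rcases le_or_gt (i : ℝ) b with h | h
        · have := debye_le_sub (Nat.cast_nonneg i) hb h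
          have : (0 : ℝ) ≤ i := Nat.cast_nonneg i
          linarith
        · rw [debye_of_le hb h.le]; exact hb.le
      gcongr)
    (Nat.floor_le (by positivity)) (Nat.le_floor (by push_cast; linarith)) (fun i hi => by
      constructor
      · by_contra! h
        refine hi ?_
        rw [hn]
        simp only
        rw [debye_of_le hb h.le]; norm_num
      · rw [integral_disk_density hb (Nat.cast_nonneg i), ← sub_div]
        rw [sub_sub_cancel]
        exact hnle i)
  have hN' := hN
  rw [hn] at hN'
  refine hN'.trans ?_
  rw [integral_mul_disk_density hb]
  have hMb : M + 54 / 10 ≤ b := by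
    rw [integral_disk_density hb hM.1, div_le_iff₀ hp, sub_mul, div_mul_cancel₀ _ hp.ne'] at hMu
    have := debye_le_sub hM.1 hb hM.2
    nlinarith
  have hT : M ^ 2 / 4 + M / 4 - M ^ 3 / (6 * b) - M ^ 2 / (8 * b) ≤
      ∫ y in (0:ℝ)..M, arccos (y / b) / π * (y + 1 / 2) := by
    have e : ∫ y in (0:ℝ)..M, ((y / 2 + 1 / 4) - (y ^ 2 * (1 / (2 * b)) + y * (1 / (4 * b)))) =
        M ^ 2 / 4 + M / 4 - M ^ 3 / (6 * b) - M ^ 2 / (8 * b) := by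
      have ii : ∀ {f : ℝ → ℝ}, Continuous f → IntervalIntegrable f volume 0 M :=
        fun hf => hf.intervalIntegrable _ _
      rw [intervalIntegral.integral_sub (ii (by fun_prop)) (ii (by fun_prop)),
        intervalIntegral.integral_add (ii (by fun_prop)) (ii (by fun_prop)),
        intervalIntegral.integral_add (ii (by fun_prop)) (ii (by fun_prop))]
      simp
      field_simp; ring
    rw [← e]
    refine intervalIntegral.integral_mono_on hM.1
      (by apply Continuous.intervalIntegrable; fun_prop)
      (by apply Continuous.intervalIntegrable; have := continuous_arccos_div b; fun_prop)
      fun y hy => ?_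
    have h3 := half_one_sub_le_arccos_div_pi (t := y / b) (div_nonneg hy.1 hb.le)
      ((div_le_one hb).2 (hy.2.trans hM.2))
    have h4 := mul_le_mul_of_nonneg_right h3 (by linarith [hy.1] : 0 ≤ y + 1 / 2)
    refine le_trans (le_of_eq ?_) h4
    field_simp; ring
  have hT2 : -(9 / 100) ≤ M ^ 2 / 4 - M / 4 - M ^ 3 / (6 * b) - M ^ 2 / (8 * b) := by
    have h0 := hM.1
    have h3 : 0 ≤ (M ^ 2 / 4 - M / 4 + 9 / 100) * b - M ^ 3 / 6 - M ^ 2 / 8 := by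
      have h4 : 0 ≤ M ^ 2 / 4 - M / 4 + 9 / 100 := by nlinarith [sq_nonneg (M - 1 / 2)]
      have h5 := mul_le_mul_of_nonneg_left hMb h4
      nlinarith [pow_nonneg h0 3, sq_nonneg (M - 63 / 97.5)]
    have h6 := div_nonneg h3 hb.le
    have e : ((M ^ 2 / 4 - M / 4 + 9 / 100) * b - M ^ 3 / 6 - M ^ 2 / 8) / b =
        M ^ 2 / 4 - M / 4 - M ^ 3 / (6 * b) - M ^ 2 / (8 * b) + 9 / 100 := by
      field_simp
      ring
    linarith
  have hIb : 209726 / 1000000 * b - 1439 / 10000 ≤ I := by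
    rcases hI with ⟨x, hx, hxu, hxI⟩ | ⟨h, -⟩
    · rw [integral_disk_density hb hx.1, div_eq_iff hp.ne', sub_mul, div_mul_cancel₀ _ hp.ne'] at hxu
      have := sub_le_of_debye_eq hx.1 hb hx.2 (by linarith)
      linarith
    · simp at h
      linarith
  have hLb : b / π ≤ 31831 / 100000 * b := by
    rw [div_le_iff₀ hp]; nlinarith
  nlinarith

lemma debye_sub_debye_le {m a b : ℝ} (hm : 0 ≤ m) (ha : 0 < a) (hab : a < b) :
    debye m b - debye m a ≤ b - a := by
  have h := integral_annulusDensity ha hab hm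
  have h0 : 0 ≤ ∫ t in (0:ℝ)..m, annulusDensity a b t :=
    intervalIntegral.integral_nonneg hm fun t ht => by
      refine div_nonneg (sub_nonneg.2 (arccos_le_arccos ?_)) pi_pos.le
      have := ht.1
      gcongr
  rw [h] at h0
  have := (div_nonneg_iff.1 h0).resolve_right (fun h => by linarith [h.2, pi_pos])
  linarith

lemma cubic_correction_bound {P M : ℝ} (hP : 14 / 10 ≤ P) (hM : 0 ≤ M) :
    -(P / 3) + 1 / 10 ≤ M ^ 3 / (6 * P ^ 2) + M ^ 2 / (8 * P ^ 2) - M / 2 := by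
  have hP0 : 0 < P := by linarith
  obtain ⟨t, ht⟩ : ∃ t, t = M / P := ⟨_, rfl⟩
  have hMt : M = t * P := by rw [ht]; field_simp
  have ht0 : 0 ≤ t := by rw [ht]; positivity
  have e : M ^ 3 / (6 * P ^ 2) + M ^ 2 / (8 * P ^ 2) - M / 2 =
      P * ((t - 1) ^ 2 * (t + 2) / 6) - P / 3 + t ^ 2 / 8 := by
    rw [hMt]; field_simp; ring
  rw [e]
  have h1 : 0 ≤ (t - 1) ^ 2 * (t + 2) / 6 := by positivity
  have h2 : 14 / 10 * ((t - 1) ^ 2 * (t + 2) / 6) + t ^ 2 / 8 ≥ 1 / 10 := by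
    nlinarith [mul_nonneg ht0 (sq_nonneg (t - 83 / 100)), sq_nonneg (t - 83 / 100)]
  nlinarith

lemma half_one_sub_le_annulusDensity {a b y : ℝ} (ha : 0 < a) (hay : a ≤ y) (hyb : y ≤ b) :
    1 / 2 * (1 - y / b) ≤ annulusDensity a b y := by
  unfold annulusDensity
  rw [arccos_div_eq_zero ha hay, sub_zero]
  exact half_one_sub_le_arccos_div_pi (div_nonneg (by linarith) (by linarith))
    ((div_le_one (by linarith)).2 hyb)

lemma continuous_annulusDensity (a b : ℝ) : Continuous (annulusDensity a b) :=
  ((continuous_arccos_div b).sub (continuous_arccos_div a)).div_const π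

/-- The boundary term of the annulus density is controlled by `P ^ 2 = π a b / (2 (b - a))`. -/
lemma boundary_term_bound {a b M P : ℝ} (ha : 13 / 10 ≤ a) (hab : a + 54 / 10 ≤ b)
    (hM : 0 ≤ M) (hMb : M + 54 / 10 ≤ b) (hP : 0 ≤ P) (hP2 : P ^ 2 = π * a * b / (2 * (b - a))) :
    -(P / 3) + 1 / 10 ≤ (∫ y in (0:ℝ)..M, annulusDensity a b y * (y + 1 / 2)) - M / 2 := by
  have hp1 := pi_gt_d6
  have hP14 : 14 / 10 ≤ P := by
    refine le_of_sq_le_sq ?_ hP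
    rw [hP2, le_div_iff₀ (by linarith)]
    have h1 : a * (b - a) ≤ a * b := by nlinarith
    have h2 : 31 / 10 * (a * b) ≤ π * a * b := by
      have : 0 < a * b := by nlinarith
      nlinarith
    nlinarith
  have hcont : Continuous fun y => annulusDensity a b y * (y + 1 / 2) := by
    have := continuous_annulusDensity a b
    fun_prop
  have hsmall : ∀ M, 0 ≤ M → M ≤ a →
      -(P / 3) + 1 / 10 ≤ (∫ y in (0:ℝ)..M, annulusDensity a b y * (y + 1 / 2)) - M / 2 := by
    intro M hM hMa
    refine (cubic_correction_bound hP14 hM).trans (sub_le_sub_right ?_ _)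
    have e : ∫ y in (0:ℝ)..M, (y ^ 2 * (1 / (2 * P ^ 2)) + y * (1 / (4 * P ^ 2))) =
        M ^ 3 / (6 * P ^ 2) + M ^ 2 / (8 * P ^ 2) := by
      have ii : ∀ {f : ℝ → ℝ}, Continuous f → IntervalIntegrable f volume 0 M :=
        fun hf => hf.intervalIntegrable _ _
      rw [intervalIntegral.integral_add (ii (by fun_prop)) (ii (by fun_prop))]
      simp
      field_simp; ring
    rw [← e]
    refine intervalIntegral.integral_mono_on hM
      (by apply Continuous.intervalIntegrable; fun_prop) (hcont.intervalIntegrable _ _)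
      fun y hy => ?_
    have h3 := mul_le_pi_mul_annulusDensity (a := a) (b := b) (by linarith) (by linarith) hy.1
      (hy.2.trans hMa)
    have e2 : 1 / a - 1 / b = π / (2 * P ^ 2) := by
      rw [hP2]
      have h4 : a ≠ 0 := by linarith
      have h5 : b ≠ 0 := by linarith
      have h6 : b - a ≠ 0 := by linarith
      field_simp
    rw [e2] at h3
    have h4 : y * (1 / (2 * P ^ 2)) ≤ annulusDensity a b y := by
      refine le_of_mul_le_mul_left ((le_of_eq ?_).trans h3) pi_pos
      ring
    have h5 := mul_le_mul_of_nonneg_right h4 (by linarith [hy.1] : 0 ≤ y + 1 / 2)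
    refine le_trans (le_of_eq ?_) h5
    ring
  rcases le_or_gt M a with h | h
  · exact hsmall M hM h
  · refine (hsmall a (by linarith) le_rfl).trans ?_
    rw [← intervalIntegral.integral_add_adjacent_intervals (hcont.intervalIntegrable 0 a)
      (hcont.intervalIntegrable a M)]
    have h1 : ∫ y in a..M, (1 / 2 : ℝ) ≤ ∫ y in a..M, annulusDensity a b y * (y + 1 / 2) := by
      refine intervalIntegral.integral_mono_on h.le (by simp) (hcont.intervalIntegrable _ _)
        fun y hy => ?_
      have hb : 0 < b := by linarith
      have h2 := half_one_sub_le_annulusDensity (a := a) (b := b) (y := y) (by linarith) hy.1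
        (by linarith [hy.2])
      have h3 := mul_le_mul_of_nonneg_right h2 (by linarith [hy.1] : 0 ≤ y + 1 / 2)
      refine le_trans ?_ h3
      have h4 : b ≤ (b - y) * (y + 1 / 2) := by nlinarith [hy.1, hy.2]
      have e : 1 / 2 * (1 - y / b) * (y + 1 / 2) = 1 / 2 * ((b - y) * (y + 1 / 2) / b) := by
        field_simp
      rw [e]
      have : 1 ≤ (b - y) * (y + 1 / 2) / b := by rwa [le_div_iff₀ hb, one_mul]
      linarith
    simp at h1
    linarith

lemma thick_annulus_bound {a b P : ℝ} (ha : 13 / 10 ≤ a) (hab : a + 54 / 10 ≤ b)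
    (hP2 : P ^ 2 = π * a * b / (2 * (b - a))) :
    P / 3 ≤ 20972 / 100000 * b - 159157 / 1000000 * (b - a) + 66 / 1000 := by
  obtain ⟨h, rfl⟩ : ∃ h, b = a + 54 / 10 + h := ⟨b - (a + 54 / 10), by ring⟩
  have hh : 0 ≤ h := by linarith
  have key : P ^ 2 ≤ (3 * (20972 / 100000 * (a + 54 / 10 + h)
      - 159157 / 1000000 * (a + 54 / 10 + h - a) + 66 / 1000)) ^ 2 := by
    rw [hP2, div_le_iff₀ (by linarith)]
    have h1 : π * a * (a + 54 / 10 + h) ≤ 3.141593 * a * (a + 54 / 10 + h) := by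
      have := pi_lt_d6
      gcongr
    refine h1.trans ?_
    obtain ⟨c, rfl⟩ : ∃ c, a = 13 / 10 + c := ⟨a - 13 / 10, by ring⟩
    have hc : 0 ≤ c := by linarith
    nlinarith [mul_nonneg hh hc, mul_nonneg hh (sq_nonneg c), pow_nonneg hh 2, pow_nonneg hh 3,
      mul_nonneg (pow_nonneg hh 2) hc, sq_nonneg (c - 1 / 10), sq_nonneg c,
      mul_nonneg hh (sq_nonneg (c - 1 / 10))]
  have := abs_le_of_sq_le_sq' key (by linarith)
  linarith [this.2]

lemma thin_annulus_bound {a b P : ℝ} (ha : 13 / 10 ≤ a) (hab : a + 54 / 10 ≤ b)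
    (hb : 54 * (b - a) ≤ b) (hP2 : P ^ 2 = π * a * b / (2 * (b - a))) :
    P / 3 ≤ 2059 / 10000 * a - 159157 / 1000000 * (b - a) + 21 / 100 := by
  have hb0 : 0 ≤ b := by linarith
  have key : P ^ 2 ≤ (54 / 100 * b) ^ 2 := by
    rw [hP2, div_le_iff₀ (by linarith)]
    have h1 : π * a * b ≤ 3.141593 * b * b := by
      have := pi_lt_d6
      have : a ≤ b := by linarith
      gcongr
    refine h1.trans ?_
    have : (54 / 10) * (b * b) ≤ (b - a) * (b * b) := by
      apply mul_le_mul_of_nonneg_right (by linarith) (by positivity)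
    nlinarith
  have := abs_le_of_sq_le_sq' key (by linarith)
  linarith [this.2]

lemma count_le_of_ge {a b : ℝ} (ha1 : 13 / 10 ≤ a) (hab' : a + 43 / 25 * π ≤ b) (K : ℕ) :
    ((⌊(debye (0 : ℕ) b - debye (0 : ℕ) a) / π + 7 / 25⌋₊ +
      2 * ∑ i ∈ Finset.Icc 1 K, ⌊(debye (i : ℕ) b - debye (i : ℕ) a) / π + 7 / 25⌋₊ : ℕ) : ℝ) ≤
      (b ^ 2 - a ^ 2) / 4 := by
  have hp := pi_pos
  have hp1 := pi_gt_d6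
  have hp2 := pi_lt_d6
  have hd : a + 54 / 10 ≤ b := by linarith
  have ha : 0 < a := by linarith
  have hab : a < b := by linarith
  have hb : 0 < b := by linarith
  have H := isUnimodalDensity_annulus ha hab
  have hintg := fun y (hy : 0 ≤ y) => integral_annulusDensity ha hab hy
  have hL : (b - a) / π = ∫ t in (0:ℝ)..b, annulusDensity a b t := by
    rw [hintg b hb.le, debye_of_le hb le_rfl, debye_of_le ha hab.le]; ring
  have hn0 : ∀ i : ℕ, 0 ≤ (debye i b - debye i a) / π + 7 / 25 := fun i => by
    have := monotoneOn_debye (Nat.cast_nonneg i) ha hb hab.le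
    have := div_nonneg (sub_nonneg.2 this) hp.le
    linarith
  obtain ⟨n, hn⟩ : ∃ n : ℕ → ℕ, n = fun i : ℕ => ⌊(debye i b - debye i a) / π + 7 / 25⌋₊ :=
    ⟨_, rfl⟩
  have hnle : ∀ i : ℕ, (n i : ℝ) ≤ (debye i b - debye i a) / π + 7 / 25 := fun i => by
    rw [hn]; exact Nat.floor_le (hn0 i)
  have h2 : (43 / 25 : ℝ) ≤ (b - a) / π := by
    rw [le_div_iff₀ hp]; linarith
  obtain ⟨M, hM, hMu, I, hN, hI⟩ := H.exists_count_le (n := n) (K := K)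
    (J := ⌊(b - a) / π + 7 / 25⌋₊) hL
    (fun i => by
      refine Nat.le_floor ((hnle i).trans ?_)
      have h3 := debye_sub_debye_le (Nat.cast_nonneg i) ha hab
      gcongr)
    (Nat.floor_le (by linarith)) (Nat.le_floor (by push_cast; linarith)) (fun i hi => by
      constructor
      · by_contra! h
        refine hi ?_
        rw [hn]
        simp only
        rw [debye_of_le hb h.le, debye_of_le ha (hab.le.trans h.le)]; norm_num
      · rw [hintg i (Nat.cast_nonneg i), ← sub_div, sub_sub_cancel]
        exact hnle i)
  have hN' := hN
  rw [hn] at hN'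
  refine hN'.trans ?_
  rw [integral_mul_annulusDensity ha hab]
  have hMb : M + 54 / 10 ≤ b := by
    rw [hintg M hM.1, div_le_iff₀ hp, sub_mul, div_mul_cancel₀ _ hp.ne'] at hMu
    have := debye_le_sub hM.1 hb hM.2
    have := debye_nonneg hM.1 ha
    linarith
  obtain ⟨P, hP⟩ : ∃ P, P = √(π * a * b / (2 * (b - a))) := ⟨_, rfl⟩
  have hP0 : 0 ≤ P := by rw [hP]; exact Real.sqrt_nonneg _
  have hP2 : P ^ 2 = π * a * b / (2 * (b - a)) := by
    rw [hP, Real.sq_sqrt (div_nonneg (by positivity) (by linarith))]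
  have hT := boundary_term_bound ha1 hd hM.1 hMb hP0 hP2
  have hLb : (b - a) / π ≤ 31831 / 100000 * (b - a) := by
    rw [div_le_iff₀ hp]; nlinarith
  have hIP : P / 3 ≤ I - 159157 / 1000000 * (b - a) + 21 / 100 := by
    rcases hI with ⟨x, hx, hxu, hxI⟩ | ⟨h, h1⟩
    · have hx0 : 0 ≤ x := ha.le.trans hx.1
      rw [hintg x hx0, div_eq_iff hp.ne', sub_mul, div_mul_cancel₀ _ hp.ne',
        debye_of_le ha hx.1] at hxu
      have := sub_le_of_debye_eq hx0 hb hx.2 (by linarith)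
      have := thick_annulus_bound ha1 hd hP2
      linarith
    · rw [hintg a ha.le, debye_of_le ha le_rfl, sub_zero] at h
      have h3 : debye a b / π < 11 / 50 := by
        have : (b - a - debye a b) / π = (b - a) / π - debye a b / π := by ring
        linarith
      rw [div_lt_iff₀ hp] at h3
      have h4 := debye_nonneg ha.le hb
      have h5 := eight_mul_sub_pow_le_debye ha.le hb hab.le
      have h6 : debye a b ^ 2 ≤ (69116 / 100000) ^ 2 := by
        have : debye a b ≤ 69116 / 100000 := by linarith
        gcongr
      have h7 : 8 * (b - a) ^ 3 ≤ 9 * b * (69116 / 100000) ^ 2 := h5.trans (by gcongr)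
      have h8 : 54 * (b - a) ≤ b := by
        have : (54 / 10) ^ 2 * (b - a) ≤ (b - a) ^ 2 * (b - a) := by
          have h9 : (54 / 10 : ℝ) ≤ b - a := by linarith
          gcongr
        linarith
      have h9 := thin_annulus_bound ha1 hd h8 hP2
      have h10 : (11 / 50) ^ 2 / (2 * ((b - a) / π)) ≤ 141 / 10000 := by
        rw [div_le_iff₀ (by linarith)]; linarith
      have h11 := mul_le_mul_of_nonneg_left h10 ha.le
      linarith
  linarith

lemma arctan_le_quintic {y : ℝ} (hy : 0 ≤ y) : arctan y ≤ y - y ^ 3 / 3 + y ^ 5 / 5 := by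
  have hd : ∀ t, HasDerivAt (fun t : ℝ => t - t ^ 3 / 3 + t ^ 5 / 5 - arctan t)
      (1 - t ^ 2 + t ^ 4 - 1 / (1 + t ^ 2)) t := fun t => by
    have := (((hasDerivAt_id t).sub (((hasDerivAt_id t).pow 3).div_const 3)).add
      (((hasDerivAt_id t).pow 5).div_const 5)).sub (hasDerivAt_arctan t)
    refine this.congr_deriv ?_
    simp
  have hm : MonotoneOn (fun t : ℝ => t - t ^ 3 / 3 + t ^ 5 / 5 - arctan t) (Set.Ici 0) := by
    refine monotoneOn_of_deriv_nonneg (convex_Ici 0)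
      (fun t _ => (hd t).continuousAt.continuousWithinAt)
      (fun t _ => (hd t).differentiableAt.differentiableWithinAt) fun t _ => ?_
    rw [(hd t).deriv]
    have h : 1 / (1 + t ^ 2) ≤ 1 - t ^ 2 + t ^ 4 := by
      rw [div_le_iff₀ (by positivity)]
      nlinarith [pow_nonneg (sq_nonneg t) 3]
    linarith
  have := hm Set.self_mem_Ici hy hy
  simp at this
  linarith

lemma le_arctan_of_pos {s : ℝ} (hs : 0 < s) :
    π / 2 - ((1 / s) - (1 / s) ^ 3 / 3 + (1 / s) ^ 5 / 5) ≤ arctan s := by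
  have h := arctan_inv_of_pos hs
  have := arctan_le_quintic (y := s⁻¹) (by positivity)
  rw [h] at this
  rw [one_div]
  linarith

lemma debye_sqrt_mul_one_add_sq {m s : ℝ} (hm : 0 < m) (hs : 0 ≤ s) :
    debye m √(m ^ 2 * (1 + s ^ 2)) = m * (s - arctan s) := by
  have h1 : √(m ^ 2 * (1 + s ^ 2)) = m * √(1 + s ^ 2) := by
    rw [Real.sqrt_mul (by positivity), Real.sqrt_sq hm.le]
  have h2 : 0 < √(1 + s ^ 2) := Real.sqrt_pos.2 (by positivity)
  unfold debye
  rw [Real.sq_sqrt (by positivity), h1, show m / (m * √(1 + s ^ 2)) = 1 / √(1 + s ^ 2) by field_simp,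
    ← cos_arctan, arccos_cos (arctan_nonneg.2 hs) (by linarith [arctan_lt_pi_div_two s, pi_pos]),
    show m ^ 2 * (1 + s ^ 2) - m ^ 2 = (m * s) ^ 2 by ring, Real.sqrt_sq (by positivity)]
  ring

lemma hasDerivAt_debye_sqrt {m X : ℝ} (hm : 0 < m) (hX : m ^ 2 < X) :
    HasDerivAt (fun X => debye m √X) (√(X - m ^ 2) / (2 * X)) X := by
  have hX0 : 0 < X := (by positivity : 0 < m ^ 2).trans hX
  have h1 : m < √X := Real.lt_sqrt_of_sq_lt hX
  have h := (hasDerivAt_debye hm.le h1).comp X ((hasDerivAt_id X).sqrt hX0.ne')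
  refine h.congr_deriv ?_
  have := Real.sqrt_pos.2 hX0
  have h2 := Real.sq_sqrt hX0.le
  simp only [id]
  rw [h2]
  field_simp
  rw [h2]
  ring

lemma antitoneOn_debye_sub {m B X₁ : ℝ} (hm : 0 < m) (hB : 0 ≤ B) (h1 : m ^ 2 < X₁)
    (h2 : m ^ 4 ≤ (X₁ - m ^ 2) * (X₁ + B - m ^ 2)) :
    AntitoneOn (fun X => debye m √(X + B) - debye m √X) (Set.Ici X₁) := by
  have hd : ∀ X ∈ Set.Ici X₁, HasDerivAt (fun X => debye m √(X + B) - debye m √X)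
      (√(X + B - m ^ 2) / (2 * (X + B)) - √(X - m ^ 2) / (2 * X)) X := fun X hX => by
    have hX' : X₁ ≤ X := hX
    have := (hasDerivAt_debye_sqrt hm (X := X + B) (by linarith)).comp X
      ((hasDerivAt_id X).add_const B)
    rw [mul_one] at this
    exact this.sub (hasDerivAt_debye_sqrt hm (by linarith))
  refine antitoneOn_of_deriv_nonpos (convex_Ici X₁)
    (fun t ht => (hd t ht).continuousAt.continuousWithinAt)
    (fun t ht => (hd t (interior_subset ht)).differentiableAt.differentiableWithinAt) fun X hX => ?_
  rw [(hd X (interior_subset hX)).deriv]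
  have hX' : X₁ ≤ X := interior_subset hX
  have hX0 : 0 < X := (by positivity : 0 < m ^ 2).trans (by linarith)
  have hp : 0 ≤ X - m ^ 2 := by linarith
  have hq : 0 ≤ X + B - m ^ 2 := by linarith
  have h3 : m ^ 2 ≤ √(X - m ^ 2) * √(X + B - m ^ 2) := by
    rw [← Real.sqrt_mul hp]
    refine Real.le_sqrt_of_sq_le ?_
    calc (m ^ 2) ^ 2 = m ^ 4 := by ring
      _ ≤ _ := h2
      _ ≤ _ := by gcongr; linarith
  have h4 : √(X - m ^ 2) ≤ √(X + B - m ^ 2) := Real.sqrt_le_sqrt (by linarith)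
  rw [sub_nonpos, div_le_div_iff₀ (by linarith) (by linarith)]
  have h5 := Real.sq_sqrt hp
  have h6 := Real.sq_sqrt hq
  have h7 : 0 ≤ √(X - m ^ 2) := Real.sqrt_nonneg _
  generalize √(X - m ^ 2) = p at *
  generalize √(X + B - m ^ 2) = q at *
  have e1 : X = p ^ 2 + m ^ 2 := by linarith
  have e2 : X + B = q ^ 2 + m ^ 2 := by linarith
  rw [e2, e1]
  nlinarith [mul_nonneg (sub_nonneg.2 h3) (sub_nonneg.2 h4)]

/-- If `b² ≤ a² + B` then the Debye phase difference is controlled by two explicit values. -/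
lemma debye_sub_le_of_sq_le {m a b s₀ s₁ t κ : ℝ} (hm : 0 < m) (ha : 0 < a) (hab : a < b)
    {B : ℝ} (hB : b ^ 2 ≤ a ^ 2 + B) (hB0 : 0 ≤ B) (h0 : 0 ≤ s₀) (h01 : s₀ ≤ s₁) (ht : 0 ≤ t)
    (h2 : m ^ 4 ≤ (m ^ 2 * s₁ ^ 2 - B) * (m ^ 2 * s₁ ^ 2)) (h3 : B < m ^ 2 * s₁ ^ 2)
    (h4 : m ^ 2 * t ^ 2 ≤ m ^ 2 * s₀ ^ 2 - B)
    (h5 : m * (s₀ - arctan s₀) ≤ κ) (h6 : m * (s₁ - arctan s₁) - m * (t - arctan t) ≤ κ) :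
    debye m b - debye m a ≤ κ := by
  have hb := ha.trans hab
  have hbX : debye m b ≤ debye m √(a ^ 2 + B) := by
    refine monotoneOn_debye hm.le hb ?_ (Real.le_sqrt_of_sq_le hB)
    exact Real.sqrt_pos.2 (by positivity)
  have hmono : ∀ X s, 0 ≤ s → 0 < X → X ≤ m ^ 2 * (1 + s ^ 2) → debye m √X ≤ m * (s - arctan s) := by
    intro X s hs hX h
    rw [← debye_sqrt_mul_one_add_sq hm hs]
    exact monotoneOn_debye hm.le (Real.sqrt_pos.2 hX) (Real.sqrt_pos.2 (by positivity))
      (Real.sqrt_le_sqrt h)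
  rcases le_or_gt (a ^ 2 + B) (m ^ 2 * (1 + s₀ ^ 2)) with h | h
  · have := hmono _ _ h0 (by positivity) h
    have := debye_nonneg hm.le ha
    linarith
  have hat : m * (t - arctan t) ≤ debye m a := by
    rw [← debye_sqrt_mul_one_add_sq hm ht]
    refine monotoneOn_debye hm.le (Real.sqrt_pos.2 (by positivity)) ha (Real.sqrt_le_iff.2
      ⟨ha.le, by linarith⟩)
  rcases le_or_gt (a ^ 2 + B) (m ^ 2 * (1 + s₁ ^ 2)) with h' | h'
  · have := hmono _ _ (h0.trans h01) (by positivity) h'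
    linarith
  · have hanti := antitoneOn_debye_sub (m := m) (B := B) (X₁ := m ^ 2 * (1 + s₁ ^ 2) - B) hm hB0
      (by linarith) (by
        refine h2.trans (le_of_eq ?_)
        ring)
    have := hanti Set.self_mem_Ici (show a ^ 2 ∈ Set.Ici _ from by
      simp only [Set.mem_Ici]; linarith) (by linarith)
    simp only at this
    rw [Real.sqrt_sq ha.le, sub_add_cancel, debye_sqrt_mul_one_add_sq hm (h0.trans h01)] at this
    have h7 : m * (t - arctan t) ≤ debye m √(m ^ 2 * (1 + s₁ ^ 2) - B) := by
      rw [← debye_sqrt_mul_one_add_sq hm ht]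
      have h8 : s₀ ^ 2 ≤ s₁ ^ 2 := by gcongr
      have h9 : m ^ 2 * s₀ ^ 2 ≤ m ^ 2 * s₁ ^ 2 := by gcongr
      have h10 : m ^ 2 * (1 + t ^ 2) ≤ m ^ 2 * (1 + s₁ ^ 2) - B := by linarith
      have h11 : 0 < m ^ 2 * (1 + t ^ 2) := by positivity
      exact monotoneOn_debye hm.le (Real.sqrt_pos.2 h11) (Real.sqrt_pos.2 (h11.trans_le h10))
        (Real.sqrt_le_sqrt h10)
    linarith

lemma debye_sub_le_sq {m a b : ℝ} (hm : 0 < m) (ha : 0 < a) (hab : a < b) :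
    debye m b - debye m a ≤ (b ^ 2 - a ^ 2) / (4 * m) := by
  have key : ∀ x y, m ≤ x → x ≤ y → debye m y - debye m x ≤ (y ^ 2 - x ^ 2) / (4 * m) := by
    have hanti : AntitoneOn (fun x => debye m x - x ^ 2 / (4 * m)) (Set.Ici m) := by
      have hd : ∀ x ∈ interior (Set.Ici m), HasDerivAt (fun x => debye m x - x ^ 2 / (4 * m))
          (√(x ^ 2 - m ^ 2) / x - x / (2 * m)) x := fun x hx => by
        rw [interior_Ici] at hx
        refine ((hasDerivAt_debye hm.le hx).sub
          (((hasDerivAt_id x).pow 2).div_const (4 * m))).congr_deriv ?_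
        simp
        field_simp
        ring
      refine antitoneOn_of_deriv_nonpos (convex_Ici m) (((continuousOn_debye m).mono
        fun x hx => hm.trans_le hx).sub (by fun_prop))
        (fun t ht => (hd t ht).differentiableAt.differentiableWithinAt) fun x hx => ?_
      rw [(hd x hx).deriv]
      rw [interior_Ici] at hx
      have hx' : m < x := hx
      have hx0 : 0 < x := hm.trans hx'
      rw [sub_nonpos, div_le_div_iff₀ hx0 (by positivity)]
      have := Real.sq_sqrt (show 0 ≤ x ^ 2 - m ^ 2 by nlinarith)
      nlinarith [sq_nonneg (√(x ^ 2 - m ^ 2) - m)]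
    intro x y hx hxy
    have := hanti hx (hx.trans hxy) hxy
    simp only at this
    rw [sub_div]
    linarith
  rcases le_or_gt b m with hb | hb
  · rw [debye_of_le (ha.trans hab) hb, debye_of_le ha (hab.le.trans hb), sub_self]
    exact div_nonneg (by nlinarith) (by positivity)
  rcases le_or_gt a m with h | h
  · have := key m b le_rfl hb.le
    rw [debye_of_le ha h]
    rw [debye_of_le hm le_rfl] at this
    refine this.trans ?_
    gcongr
  · exact key a b h.le hab.le

/-- A mode that is counted at all forces the annulus to be large. -/
lemma le_sq_sub_sq_of_debye_ge (M : ℕ) {a b : ℝ} (ha : 0 < a) (hab : a < b)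
    (h : 18 / 25 * π ≤ debye M b - debye M a) : 8 * (M : ℝ) + 4 ≤ b ^ 2 - a ^ 2 := by
  have hp1 := pi_gt_d6
  have hp2 := pi_lt_d6
  by_contra! hlt
  have hlt' : b ^ 2 ≤ a ^ 2 + (8 * M + 4) := by linarith
  obtain hM | hM | hM | hM | hM : M = 0 ∨ M = 1 ∨ M = 2 ∨ M = 3 ∨ 4 ≤ M := by omega
  · subst hM
    rw [Nat.cast_zero, debye_zero ha.le, debye_zero (ha.trans hab).le] at h
    norm_num at hlt
    nlinarith
  · subst hM
    have := debye_sub_le_of_sq_le (κ := 2262 / 1000 - 1 / 1000) (s₀ := 7 / 2) (s₁ := 7 / 2) (t := 0)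
      (by norm_num : (0:ℝ) < (1:ℕ)) ha hab hlt' (by norm_num) (by norm_num) (by norm_num)
      (by norm_num) (by norm_num) (by norm_num) (by norm_num)
      (by have := le_arctan_of_pos (s := 7 / 2) (by norm_num)
          norm_num at this ⊢; linarith)
      (by have := le_arctan_of_pos (s := 7 / 2) (by norm_num)
          norm_num at this ⊢; linarith)
    linarith
  · subst hM
    have := debye_sub_le_of_sq_le (κ := 2262 / 1000 - 1 / 1000) (s₀ := 228 / 100) (s₁ := 228 / 100)
      (t := 0)
      (by norm_num : (0:ℝ) < (2:ℕ)) ha hab hlt' (by norm_num) (by norm_num) (by norm_num)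
      (by norm_num) (by norm_num) (by norm_num) (by norm_num)
      (by have := le_arctan_of_pos (s := 228 / 100) (by norm_num)
          norm_num at this ⊢; linarith)
      (by have := le_arctan_of_pos (s := 228 / 100) (by norm_num)
          norm_num at this ⊢; linarith)
    linarith
  · subst hM
    have := debye_sub_le_of_sq_le (κ := 2262 / 1000 - 1 / 1000) (s₀ := 182 / 100) (s₁ := 1847 / 1000)
      (t := 448 / 1000)
      (by norm_num : (0:ℝ) < (3:ℕ)) ha hab hlt' (by norm_num) (by norm_num) (by norm_num)
      (by norm_num) (by norm_num) (by norm_num) (by norm_num)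
      (by have := le_arctan_of_pos (s := 182 / 100) (by norm_num)
          norm_num at this ⊢; linarith)
      (by have := le_arctan_of_pos (s := 1847 / 1000) (by norm_num)
          have := arctan_le_quintic (y := 448 / 1000) (by norm_num)
          norm_num at *; linarith)
    linarith
  · have hM4 : (4 : ℝ) ≤ M := by exact_mod_cast hM
    have hM0 : (0 : ℝ) < M := by linarith
    have h1 := debye_sub_le_sq hM0 ha hab
    have h2 : (b ^ 2 - a ^ 2) / (4 * M) ≤ 9 / 4 := by
      rw [div_le_iff₀ (by positivity)]; linarith
    linarith

/-- The lattice inequality: mode counts for the annulus are dominated by its Weyl volume. -/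
theorem exists_mode_counts {a b : ℝ} (ha : 0 < a) (hab : a < b) : ∃ n : ℕ → ℕ,
    (∀ m : ℕ, (debye m b - debye m a) / π + 7 / 25 < n m + 1) ∧
      ∀ K, ((n 0 + 2 * ∑ i ∈ Finset.Icc 1 K, n i : ℕ) : ℝ) ≤ (b ^ 2 - a ^ 2) / 4 := by
  have hp := pi_pos
  have hb := ha.trans hab
  rcases le_or_gt (a + 43 / 25 * π) b with h | h
  · rcases le_or_gt a (13 / 10) with h1 | h1
    · refine ⟨fun i => ⌊debye i b / π + 7 / 25⌋₊, fun m => ?_, fun K => count_le_of_le ha h1 h K⟩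
      refine lt_of_le_of_lt ?_ (Nat.lt_floor_add_one (debye m b / π + 7 / 25))
      have := debye_nonneg (Nat.cast_nonneg m) ha
      gcongr
      linarith
    · exact ⟨fun i => ⌊(debye i b - debye i a) / π + 7 / 25⌋₊, fun m => Nat.lt_floor_add_one _,
        fun K => count_le_of_ge h1.le h K⟩
  · obtain ⟨n, hn⟩ : ∃ n : ℕ → ℕ, n = fun i : ℕ => ⌊(debye i b - debye i a) / π + 7 / 25⌋₊ :=
      ⟨_, rfl⟩
    refine ⟨n, fun m => by rw [hn]; exact Nat.lt_floor_add_one _, fun K => ?_⟩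
    have hn1 : ∀ i, n i ≤ 1 := by
      intro i
      rw [hn]
      refine Nat.lt_succ_iff.1 (Nat.floor_lt' (by norm_num) |>.2 ?_)
      have := debye_sub_debye_le (Nat.cast_nonneg i) ha hab
      have : (debye i b - debye i a) / π < 43 / 25 := by
        rw [div_lt_iff₀ hp]; linarith
      norm_num
      linarith
    have hnpos : ∀ i, n i ≠ 0 → 18 / 25 * π ≤ debye i b - debye i a := by
      intro i hi
      rw [hn] at hi
      have := (Nat.floor_pos.1 (Nat.pos_of_ne_zero hi))
      rw [← le_div_iff₀ hp]
      linarith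
    rcases Finset.eq_empty_or_nonempty ((Finset.range (K + 1)).filter fun i => n i ≠ 0) with h0 | h0
    · have hz : ∀ i ≤ K, n i = 0 := by
        intro i hi
        by_contra hne
        have : i ∈ (Finset.range (K + 1)).filter fun i => n i ≠ 0 := by
          simp only [Finset.mem_filter, Finset.mem_range]
          exact ⟨by omega, hne⟩
        rw [h0] at this
        simp at this
      rw [hz 0 (Nat.zero_le K), Finset.sum_eq_zero fun i hi => hz i (Finset.mem_Icc.1 hi).2]
      simp
      nlinarith
    · obtain ⟨M, hM, hMmax⟩ := Finset.exists_max_image _ id h0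
      rw [Finset.mem_filter] at hM
      have key := le_sq_sub_sq_of_debye_ge M ha hab (hnpos M hM.2)
      have hsum : ∑ i ∈ Finset.Icc 1 K, n i ≤ M := by
        calc ∑ i ∈ Finset.Icc 1 K, n i ≤ ∑ i ∈ Finset.Icc 1 K, if i ≤ M then 1 else 0 := by
              refine Finset.sum_le_sum fun i hi => ?_
              split_ifs with hiM
              · exact hn1 i
              · by_contra hne
                refine hiM (hMmax i ?_)
                simp only [Finset.mem_filter, Finset.mem_range]
                exact ⟨by have := (Finset.mem_Icc.1 hi).2; omega, by omega⟩
          _ = ((Finset.Icc 1 K).filter fun i => i ≤ M).card := by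
              rw [← Finset.sum_filter, Finset.sum_const, smul_eq_mul, mul_one]
          _ ≤ (Finset.Icc 1 M).card := Finset.card_le_card fun i hi => by
              simp only [Finset.mem_filter, Finset.mem_Icc] at hi ⊢
              exact ⟨hi.1.1, hi.2⟩
          _ = M := by rw [Nat.card_Icc, Nat.add_sub_cancel]
      have : ((n 0 + 2 * ∑ i ∈ Finset.Icc 1 K, n i : ℕ) : ℝ) ≤ ((1 + 2 * M : ℕ) : ℝ) := by
        exact_mod_cast Nat.add_le_add (hn1 0) (Nat.mul_le_mul_left 2 hsum)
      push_cast at this ⊢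
      linarith

/-- The cosine moment of order `n` of a function on `[-π, π]`. -/
noncomputable def cosMoment (n : ℤ) (f : ℝ → ℝ) : ℝ := ∫ θ in -π..π, f θ * cos (n * θ)

/-- The sine moment of order `n` of a function on `[-π, π]`. -/
noncomputable def sinMoment (n : ℤ) (f : ℝ → ℝ) : ℝ := ∫ θ in -π..π, f θ * sin (n * θ)

lemma norm_fourierCoeffOn_sq (hab : -π < π) {f : ℝ → ℝ} (hf : Continuous f) (n : ℤ) :
    ‖fourierCoeffOn hab (fun x => (f x : ℂ)) n‖ ^ 2
      = (1 / (2 * π)) ^ 2 * (cosMoment n f ^ 2 + sinMoment n f ^ 2) := by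
  have hpi := pi_pos
  have key : (∫ x in -π..π, fourier (-n) (x : AddCircle (π - -π)) • (f x : ℂ))
      = (cosMoment n f : ℂ) - (sinMoment n f : ℂ) * Complex.I := by
    rw [cosMoment, sinMoment, ← intervalIntegral.integral_ofReal,
      ← intervalIntegral.integral_ofReal, ← intervalIntegral.integral_mul_const,
      ← intervalIntegral.integral_sub]
    · refine intervalIntegral.integral_congr fun x _ => ?_
      simp only [fourier_coe_apply, smul_eq_mul]
      have : 2 * (π : ℂ) * Complex.I * ((-n : ℤ) : ℂ) * x / ((π - -π : ℝ) : ℂ)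
          = ((-(n * x) : ℝ) : ℂ) * Complex.I := by
        have : (π : ℂ) ≠ 0 := by exact_mod_cast hpi.ne'
        push_cast
        field_simp
        ring
      rw [this, Complex.exp_mul_I, ← Complex.ofReal_cos, ← Complex.ofReal_sin, cos_neg, sin_neg]
      push_cast
      ring
    · apply Continuous.intervalIntegrable
      fun_prop
    · apply Continuous.intervalIntegrable
      fun_prop
  rw [fourierCoeffOn_eq_integral, key, norm_smul, mul_pow]
  congr 1
  · rw [Real.norm_eq_abs, sq_abs]
    ring
  · rw [← Complex.normSq_eq_norm_sq, Complex.normSq_apply]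
    simp
    ring

/-- Parseval's identity for real functions, in terms of cosine and sine moments. -/
lemma hasSum_moments {f : ℝ → ℝ} (hf : Continuous f) :
    HasSum (fun n : ℤ => 1 / (2 * π) * (cosMoment n f ^ 2 + sinMoment n f ^ 2))
      (∫ θ in -π..π, f θ ^ 2) := by
  have hpi := pi_pos
  have hab : -π < π := by linarith
  have hc : Continuous (fun x => (f x : ℂ)) := by fun_prop
  have hL : MemLp (fun x => (f x : ℂ)) 2 (volume.restrict (Set.Ioc (-π) π)) := by
    obtain ⟨C, hC⟩ := (isCompact_Icc (a := -π) (b := π)).exists_bound_of_continuousOn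
      hc.continuousOn
    refine MemLp.of_bound hc.aestronglyMeasurable C ?_
    filter_upwards [ae_restrict_mem measurableSet_Ioc] with x hx
    exact hC x (Set.Ioc_subset_Icc_self hx)
  have h := (hasSum_sq_fourierCoeffOn hab hL).mul_left (2 * π)
  simp only [norm_fourierCoeffOn_sq hab hf, Complex.norm_real, Real.norm_eq_abs, sq_abs,
    smul_eq_mul] at h
  rw [show π - -π = 2 * π by ring, mul_inv_cancel_left₀ (by positivity)] at h
  refine h.congr_fun fun n => ?_
  field_simp

/-- Integration by parts for the cosine moments of a periodic function. -/
lemma cosMoment_deriv {f f' : ℝ → ℝ} (hf : ∀ θ, HasDerivAt f (f' θ) θ) (hf' : Continuous f')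
    (hper : f π = f (-π)) (n : ℤ) : cosMoment n f' = n * sinMoment n f := by
  have h := intervalIntegral.integral_deriv_mul_eq_sub (a := -π) (b := π) (u := f)
    (v := fun θ => cos (n * θ)) (u' := f') (v' := fun θ => -sin (n * θ) * n)
    (fun θ _ => hf θ) (fun θ _ => by simpa using ((hasDerivAt_id θ).const_mul (n : ℝ)).cos)
    (hf'.intervalIntegrable _ _) (Continuous.intervalIntegrable (by fun_prop) _ _)
  have hc : Continuous f := continuous_iff_continuousAt.2 fun θ => (hf θ).continuousAt
  rw [intervalIntegral.integral_add (Continuous.intervalIntegrable (by fun_prop) _ _)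
    (Continuous.intervalIntegrable (by fun_prop) _ _), hper, mul_neg, cos_neg, sub_self] at h
  have h2 : (∫ θ in -π..π, f θ * (-sin (n * θ) * n)) = -(n * sinMoment n f) := by
    rw [sinMoment, ← intervalIntegral.integral_const_mul, ← intervalIntegral.integral_neg]
    exact intervalIntegral.integral_congr fun x _ => by ring
  rw [h2] at h
  rw [cosMoment]
  linarith

/-- Integration by parts for the sine moments of a periodic function. -/
lemma sinMoment_deriv {f f' : ℝ → ℝ} (hf : ∀ θ, HasDerivAt f (f' θ) θ) (hf' : Continuous f')
    (n : ℤ) : sinMoment n f' = -(n * cosMoment n f) := by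
  have h := intervalIntegral.integral_deriv_mul_eq_sub (a := -π) (b := π) (u := f)
    (v := fun θ => sin (n * θ)) (u' := f') (v' := fun θ => cos (n * θ) * n)
    (fun θ _ => hf θ) (fun θ _ => by simpa using ((hasDerivAt_id θ).const_mul (n : ℝ)).sin)
    (hf'.intervalIntegrable _ _) (Continuous.intervalIntegrable (by fun_prop) _ _)
  have hc : Continuous f := continuous_iff_continuousAt.2 fun θ => (hf θ).continuousAt
  rw [intervalIntegral.integral_add (Continuous.intervalIntegrable (by fun_prop) _ _)
    (Continuous.intervalIntegrable (by fun_prop) _ _), mul_neg, sin_neg, sin_int_mul_pi] at h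
  have h2 : (∫ θ in -π..π, f θ * (cos (n * θ) * n)) = n * cosMoment n f := by
    rw [cosMoment, ← intervalIntegral.integral_const_mul]
    exact intervalIntegral.integral_congr fun x _ => by ring
  rw [h2] at h
  rw [sinMoment]
  linarith

/-- On a circle of radius `ρ`, the energy is bounded below by that of the angular modes of
order at most `K`, provided all higher modes contribute nonnegatively. -/
lemma sum_moments_le {f f' g : ℝ → ℝ} (hf : ∀ θ, HasDerivAt f (f' θ) θ) (hf' : Continuous f')
    (hper : f π = f (-π)) (hg : Continuous g) {ρ Λ : ℝ} (hρ : 0 < ρ) {K : ℕ}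
    (hK : Λ * ρ ^ 2 ≤ (K + 1) ^ 2) :
    ∑ n ∈ Finset.Icc (-(K : ℤ)) K, 1 / (2 * π) *
        (cosMoment n g ^ 2 + sinMoment n g ^ 2
          + (n ^ 2 / ρ ^ 2 - Λ) * (cosMoment n f ^ 2 + sinMoment n f ^ 2))
      ≤ ∫ θ in -π..π, (g θ ^ 2 + f' θ ^ 2 / ρ ^ 2 - Λ * f θ ^ 2) := by
  have hc : Continuous f := continuous_iff_continuousAt.2 fun θ => (hf θ).continuousAt
  have hs := ((hasSum_moments hg).add ((hasSum_moments hf').div_const (ρ ^ 2))).sub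
    ((hasSum_moments hc).mul_left Λ)
  have hI : (∫ θ in -π..π, (g θ ^ 2 + f' θ ^ 2 / ρ ^ 2 - Λ * f θ ^ 2))
      = (∫ θ in -π..π, g θ ^ 2) + (∫ θ in -π..π, f' θ ^ 2) / ρ ^ 2
        - Λ * ∫ θ in -π..π, f θ ^ 2 := by
    rw [intervalIntegral.integral_sub (Continuous.intervalIntegrable (by fun_prop) _ _)
      (Continuous.intervalIntegrable (by fun_prop) _ _),
      intervalIntegral.integral_add (Continuous.intervalIntegrable (by fun_prop) _ _)
      (Continuous.intervalIntegrable (by fun_prop) _ _), intervalIntegral.integral_div,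
      intervalIntegral.integral_const_mul]
  rw [hI]
  have e : ∀ n : ℤ, 1 / (2 * π) * (cosMoment n g ^ 2 + sinMoment n g ^ 2)
      + 1 / (2 * π) * (cosMoment n f' ^ 2 + sinMoment n f' ^ 2) / ρ ^ 2
      - Λ * (1 / (2 * π) * (cosMoment n f ^ 2 + sinMoment n f ^ 2))
      = 1 / (2 * π) * (cosMoment n g ^ 2 + sinMoment n g ^ 2
          + (n ^ 2 / ρ ^ 2 - Λ) * (cosMoment n f ^ 2 + sinMoment n f ^ 2)) := by
    intro n
    rw [cosMoment_deriv hf hf' hper, sinMoment_deriv hf hf']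
    ring
  simp only [e] at hs
  refine sum_le_hasSum _ (fun n hn => ?_) hs
  have hn' : ((K : ℝ) + 1) ^ 2 ≤ (n : ℝ) ^ 2 := by
    have h1 : (K : ℤ) + 1 ≤ |n| := by
      rw [Finset.mem_Icc, ← abs_le, not_le] at hn
      exact hn
    have h2 : (K : ℝ) + 1 ≤ |(n : ℝ)| := by exact_mod_cast h1
    rw [← sq_abs (n : ℝ)]
    gcongr
  have : 0 ≤ (n : ℝ) ^ 2 / ρ ^ 2 - Λ := by
    rw [sub_nonneg, le_div_iff₀ (by positivity)]
    linarith
  positivity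

/-- The point of the plane with polar coordinates `(ρ, θ)`. -/
noncomputable def polarPt (ρ θ : ℝ) : EuclideanSpace ℝ (Fin 2) := !₂[ρ * cos θ, ρ * sin θ]

lemma continuous_polarPt : Continuous fun p : ℝ × ℝ => polarPt p.1 p.2 := by
  refine (PiLp.continuous_toLp 2 _).comp (continuous_pi fun i => ?_)
  fin_cases i <;> simp <;> fun_prop

lemma norm_polarPt {ρ : ℝ} (hρ : 0 ≤ ρ) (θ : ℝ) : ‖polarPt ρ θ‖ = ρ := by
  rw [EuclideanSpace.norm_eq, polarPt]
  simp only [Fin.sum_univ_two, norm_eq_abs, sq_abs, Matrix.cons_val_zero,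
    Matrix.cons_val_one]
  rw [mul_pow, mul_pow, ← mul_add, cos_sq_add_sin_sq, mul_one, sqrt_sq hρ]

lemma polarPt_pi (ρ : ℝ) : polarPt ρ π = polarPt ρ (-π) := by
  simp [polarPt]

lemma vec_eq_smul_add_smul (s t : ℝ) : (!₂[s, t] : EuclideanSpace ℝ (Fin 2))
    = s • EuclideanSpace.single 0 1 + t • EuclideanSpace.single 1 1 := by
  ext i
  fin_cases i <;> simp

lemma hasDerivAt_polarPt_radius (ρ θ : ℝ) :
    HasDerivAt (fun t => polarPt t θ) !₂[cos θ, sin θ] ρ := by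
  simp only [polarPt, vec_eq_smul_add_smul]
  exact ((by simpa using (hasDerivAt_id ρ).mul_const (cos θ) :
    HasDerivAt (fun t => t * cos θ) (cos θ) ρ).smul_const _).add
    ((by simpa using (hasDerivAt_id ρ).mul_const (sin θ) :
    HasDerivAt (fun t => t * sin θ) (sin θ) ρ).smul_const _)

lemma hasDerivAt_polarPt_angle (ρ θ : ℝ) :
    HasDerivAt (fun t => polarPt ρ t) !₂[-(ρ * sin θ), ρ * cos θ] θ := by
  simp only [polarPt, vec_eq_smul_add_smul]
  exact ((by simpa using (hasDerivAt_cos θ).const_mul ρ :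
    HasDerivAt (fun t => ρ * cos t) (-(ρ * sin θ)) θ).smul_const _).add
    (((hasDerivAt_sin θ).const_mul ρ).smul_const _)

/-- Integration in polar coordinates for continuous functions supported in an annulus. -/
lemma integral_eq_polar {F : EuclideanSpace ℝ (Fin 2) → ℝ} (hF : Continuous F) {a b : ℝ}
    (ha : 0 < a) (hab : a ≤ b) (h0 : ∀ x, ¬(a < ‖x‖ ∧ ‖x‖ < b) → F x = 0) :
    ∫ x, F x = ∫ ρ in a..b, ρ * ∫ θ in -π..π, F (polarPt ρ θ) := by
  have hpi := pi_pos
  have h1 : ∫ x, F x = ∫ p : ℝ × ℝ, F !₂[p.1, p.2] := by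
    rw [← (PiLp.volume_preserving_toLp (Fin 2)).integral_comp
        (MeasurableEquiv.toLp 2 (Fin 2 → ℝ)).measurableEmbedding,
      ← (volume_preserving_finTwoArrow ℝ).symm.integral_comp
        (MeasurableEquiv.finTwoArrow (α := ℝ)).symm.measurableEmbedding]
    rfl
  have h2 : ∫ p : ℝ × ℝ, F !₂[p.1, p.2]
      = ∫ p in Set.Ioi (0 : ℝ) ×ˢ Set.Ioo (-π) π, p.1 * F (polarPt p.1 p.2) :=
    (integral_comp_polarCoord_symm fun p : ℝ × ℝ => F !₂[p.1, p.2]).symm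
  have h3 : ∫ p in Set.Ioi (0 : ℝ) ×ˢ Set.Ioo (-π) π, p.1 * F (polarPt p.1 p.2)
      = ∫ p in Set.Ioc a b ×ˢ Set.Ioo (-π) π, p.1 * F (polarPt p.1 p.2) := by
    refine setIntegral_eq_of_subset_of_forall_sdiff_eq_zero
      (measurableSet_Ioi.prod measurableSet_Ioo)
      (Set.prod_mono (fun x hx => ha.trans hx.1) le_rfl) ?_
    rintro ⟨ρ, θ⟩ ⟨⟨hρ, hθ⟩, hn⟩
    have hρ0 : 0 < ρ := hρ
    simp only
    rw [h0, mul_zero]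
    rw [norm_polarPt hρ0.le]
    exact fun h => hn ⟨⟨h.1, h.2.le⟩, hθ⟩
  have hc : Continuous fun p : ℝ × ℝ => p.1 * F (polarPt p.1 p.2) :=
    continuous_fst.mul (hF.comp continuous_polarPt)
  have hintg : IntegrableOn (fun p : ℝ × ℝ => p.1 * F (polarPt p.1 p.2))
      (Set.Ioc a b ×ˢ Set.Ioo (-π) π) (volume.prod volume) :=
    (hc.continuousOn.integrableOn_compact (isCompact_Icc.prod isCompact_Icc)).mono_set
      (Set.prod_mono Set.Ioc_subset_Icc_self Set.Ioo_subset_Icc_self)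
  rw [h1, h2, h3, Measure.volume_eq_prod, setIntegral_prod _ hintg,
    intervalIntegral.integral_of_le hab]
  refine setIntegral_congr_fun measurableSet_Ioc fun ρ _ => ?_
  simp only
  rw [integral_const_mul, intervalIntegral.integral_of_le (by linarith),
    integral_Ioc_eq_integral_Ioo]

lemma norm_gradient_sq (u : EuclideanSpace ℝ (Fin 2) → ℝ) (x : EuclideanSpace ℝ (Fin 2)) :
    ‖gradient u x‖ ^ 2
      = fderiv ℝ u x (EuclideanSpace.single 0 1) ^ 2
        + fderiv ℝ u x (EuclideanSpace.single 1 1) ^ 2 := by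
  have h : ∀ i, fderiv ℝ u x (EuclideanSpace.single i 1) = gradient u x i := by
    intro i
    rw [← toDual_gradient, InnerProductSpace.toDual_apply_apply,
      EuclideanSpace.inner_single_right]
    simp
  rw [h, h, EuclideanSpace.norm_sq_eq]
  simp [Fin.sum_univ_two]

/-- The squared gradient in polar coordinates. -/
lemma norm_gradient_sq_polar (u : EuclideanSpace ℝ (Fin 2) → ℝ) {ρ : ℝ} (hρ : ρ ≠ 0) (θ : ℝ)
    (x : EuclideanSpace ℝ (Fin 2)) :
    ‖gradient u x‖ ^ 2 = fderiv ℝ u x !₂[cos θ, sin θ] ^ 2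
      + fderiv ℝ u x !₂[-(ρ * sin θ), ρ * cos θ] ^ 2 / ρ ^ 2 := by
  have h : ∀ s t : ℝ, fderiv ℝ u x !₂[s, t]
      = s * fderiv ℝ u x (EuclideanSpace.single 0 1)
        + t * fderiv ℝ u x (EuclideanSpace.single 1 1) := by
    intro s t
    rw [vec_eq_smul_add_smul]
    simp
  rw [norm_gradient_sq, h, h]
  field_simp
  linear_combination (fderiv ℝ u x (EuclideanSpace.single 0 1) ^ 2
    + fderiv ℝ u x (EuclideanSpace.single 1 1) ^ 2) * (-cos_sq_add_sin_sq θ)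

/-- Differentiation under the integral sign for a `C¹` family of functions on an interval. -/
lemma hasDerivAt_integral_of_continuous {G G' : ℝ → ℝ → ℝ} {a b : ℝ}
    (hG : ∀ ρ θ, HasDerivAt (fun t => G t θ) (G' ρ θ) ρ) (hc : ∀ ρ, Continuous (G ρ))
    (hcG : Continuous fun p : ℝ × ℝ => G' p.1 p.2) (ρ : ℝ) :
    HasDerivAt (fun t => ∫ θ in a..b, G t θ) (∫ θ in a..b, G' ρ θ) ρ := by
  obtain ⟨C, hC⟩ := ((isCompact_Icc (a := ρ - 1) (b := ρ + 1)).prod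
    (isCompact_uIcc (a := a) (b := b))).exists_bound_of_continuousOn hcG.continuousOn
  refine (intervalIntegral.hasDerivAt_integral_of_dominated_loc_of_deriv_le (bound := fun _ => C)
    (F' := G') (s := Set.Icc (ρ - 1) (ρ + 1)) (Icc_mem_nhds (by linarith) (by linarith))
    (Filter.Eventually.of_forall fun x => (hc x).aestronglyMeasurable)
    ((hc ρ).intervalIntegrable _ _) ?_ ?_ (by simp) ?_).2
  · exact (hcG.comp (by fun_prop : Continuous fun θ : ℝ => (ρ, θ))).aestronglyMeasurable
  · exact Filter.Eventually.of_forall fun θ hθ x hx => hC (x, θ) ⟨hx, Set.uIoc_subset_uIcc hθ⟩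
  · exact Filter.Eventually.of_forall fun θ _ x _ => hG x θ

lemma contDiff_integral_of_continuous {G G' : ℝ → ℝ → ℝ} {a b : ℝ}
    (hG : ∀ ρ θ, HasDerivAt (fun t => G t θ) (G' ρ θ) ρ) (hc : ∀ ρ, Continuous (G ρ))
    (hcG : Continuous fun p : ℝ × ℝ => G' p.1 p.2) :
    ContDiff ℝ 1 (fun t => ∫ θ in a..b, G t θ) := by
  have h := hasDerivAt_integral_of_continuous (a := a) (b := b) hG hc hcG
  rw [contDiff_one_iff_deriv]
  refine ⟨fun ρ => (h ρ).differentiableAt, ?_⟩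
  rw [funext fun ρ => (h ρ).deriv]
  exact intervalIntegral.continuous_parametric_intervalIntegral_of_continuous' hcG _ _

/-- The mode form after rescaling the radial variable. -/
lemma modeForm_comp_div (m a b : ℝ) {s : ℝ} (hs : 0 < s) (v : ℝ → ℝ) :
    modeForm m (s * a) (s * b) (fun x => v (x / s))
      = ∫ ρ in a..b, (ρ * deriv v ρ ^ 2 + (m ^ 2 / ρ - s ^ 2 * ρ) * v ρ ^ 2) := by
  rw [modeForm, ← intervalIntegral.smul_integral_comp_mul_left, smul_eq_mul,
    ← intervalIntegral.integral_const_mul]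
  refine intervalIntegral.integral_congr fun ρ _ => ?_
  have hd : deriv (fun x => v (x / s)) (s * ρ) = deriv v ρ / s := by
    have := deriv_comp_mul_left s⁻¹ v (s * ρ)
    simp only [inv_mul_cancel_left₀ hs.ne', smul_eq_mul] at this
    rw [div_eq_inv_mul, ← this]
    simp only [div_eq_inv_mul]
  simp only [hd, mul_div_cancel_left₀ _ hs.ne']
  by_cases hρ : ρ = 0
  · simp [hρ]
  · field_simp

section Energy

variable {u : EuclideanSpace ℝ (Fin 2) → ℝ}

/-- The radial profile of the `n`-th cosine mode of a function on the plane. -/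
noncomputable def cosProfile (n : ℤ) (u : EuclideanSpace ℝ (Fin 2) → ℝ) (ρ : ℝ) : ℝ :=
  cosMoment n fun θ => u (polarPt ρ θ)

/-- The radial profile of the `n`-th sine mode of a function on the plane. -/
noncomputable def sinProfile (n : ℤ) (u : EuclideanSpace ℝ (Fin 2) → ℝ) (ρ : ℝ) : ℝ :=
  sinMoment n fun θ => u (polarPt ρ θ)

lemma continuous_comp_polarPt (hu : Continuous u) (ρ : ℝ) :
    Continuous fun θ => u (polarPt ρ θ) :=
  hu.comp (continuous_polarPt.comp (by fun_prop : Continuous fun θ : ℝ => (ρ, θ)))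

lemma hasDerivAt_comp_polarPt_radius (hu : ContDiff ℝ 1 u) (ρ θ : ℝ) :
    HasDerivAt (fun t => u (polarPt t θ)) (fderiv ℝ u (polarPt ρ θ) !₂[cos θ, sin θ]) ρ :=
  ((hu.differentiable one_ne_zero _).hasFDerivAt).comp_hasDerivAt ρ
    (hasDerivAt_polarPt_radius ρ θ)

lemma hasDerivAt_comp_polarPt_angle (hu : ContDiff ℝ 1 u) (ρ θ : ℝ) :
    HasDerivAt (fun t => u (polarPt ρ t))
      (fderiv ℝ u (polarPt ρ θ) !₂[-(ρ * sin θ), ρ * cos θ]) θ :=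
  ((hu.differentiable one_ne_zero _).hasFDerivAt).comp_hasDerivAt θ
    (hasDerivAt_polarPt_angle ρ θ)

lemma continuous_fderiv_radius (hu : ContDiff ℝ 1 u) :
    Continuous fun p : ℝ × ℝ => fderiv ℝ u (polarPt p.1 p.2) !₂[cos p.2, sin p.2] := by
  refine ((hu.continuous_fderiv one_ne_zero).comp continuous_polarPt).clm_apply ?_
  simp only [vec_eq_smul_add_smul]
  fun_prop

lemma continuous_fderiv_angle (hu : ContDiff ℝ 1 u) :
    Continuous fun p : ℝ × ℝ =>
      fderiv ℝ u (polarPt p.1 p.2) !₂[-(p.1 * sin p.2), p.1 * cos p.2] := by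
  refine ((hu.continuous_fderiv one_ne_zero).comp continuous_polarPt).clm_apply ?_
  simp only [vec_eq_smul_add_smul]
  fun_prop

lemma hasDerivAt_cosProfile (hu : ContDiff ℝ 1 u) (n : ℤ) (ρ : ℝ) :
    HasDerivAt (cosProfile n u)
      (cosMoment n fun θ => fderiv ℝ u (polarPt ρ θ) !₂[cos θ, sin θ]) ρ :=
  hasDerivAt_integral_of_continuous
    (fun ρ θ => (hasDerivAt_comp_polarPt_radius hu ρ θ).mul_const (cos (n * θ)))
    (fun ρ => (continuous_comp_polarPt hu.continuous ρ).mul (by fun_prop))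
    ((continuous_fderiv_radius hu).mul (by fun_prop)) ρ

lemma hasDerivAt_sinProfile (hu : ContDiff ℝ 1 u) (n : ℤ) (ρ : ℝ) :
    HasDerivAt (sinProfile n u)
      (sinMoment n fun θ => fderiv ℝ u (polarPt ρ θ) !₂[cos θ, sin θ]) ρ :=
  hasDerivAt_integral_of_continuous
    (fun ρ θ => (hasDerivAt_comp_polarPt_radius hu ρ θ).mul_const (sin (n * θ)))
    (fun ρ => (continuous_comp_polarPt hu.continuous ρ).mul (by fun_prop))
    ((continuous_fderiv_radius hu).mul (by fun_prop)) ρ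

lemma contDiff_cosProfile (hu : ContDiff ℝ 1 u) (n : ℤ) : ContDiff ℝ 1 (cosProfile n u) :=
  contDiff_integral_of_continuous
    (fun ρ θ => (hasDerivAt_comp_polarPt_radius hu ρ θ).mul_const (cos (n * θ)))
    (fun ρ => (continuous_comp_polarPt hu.continuous ρ).mul (by fun_prop))
    ((continuous_fderiv_radius hu).mul (by fun_prop))

lemma contDiff_sinProfile (hu : ContDiff ℝ 1 u) (n : ℤ) : ContDiff ℝ 1 (sinProfile n u) :=
  contDiff_integral_of_continuous
    (fun ρ θ => (hasDerivAt_comp_polarPt_radius hu ρ θ).mul_const (sin (n * θ)))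
    (fun ρ => (continuous_comp_polarPt hu.continuous ρ).mul (by fun_prop))
    ((continuous_fderiv_radius hu).mul (by fun_prop))

/-- If all low angular modes of `u` have nonnegative form, then the Dirichlet energy of `u`
dominates `s ^ 2` times its `L²` norm squared. -/
lemma sq_mul_integral_sq_le (hu : ContDiff ℝ 1 u) {a b s : ℝ} (ha : 0 < a) (hab : a ≤ b)
    (hs : 0 < s) (hsupp : tsupport u ⊆ {x | a < ‖x‖ ∧ ‖x‖ < b}) {K : ℕ}
    (hK : (s * b) ^ 2 ≤ (K + 1) ^ 2)
    (hcos : ∀ n ∈ Finset.Icc (-(K : ℤ)) K,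
      0 ≤ modeForm n (s * a) (s * b) (fun x => cosProfile n u (x / s)))
    (hsin : ∀ n ∈ Finset.Icc (-(K : ℤ)) K,
      0 ≤ modeForm n (s * a) (s * b) (fun x => sinProfile n u (x / s))) :
    s ^ 2 * ∫ x, u x ^ 2 ≤ ∫ x, ‖gradient u x‖ ^ 2 := by
  have hu0 : ∀ x, ¬(a < ‖x‖ ∧ ‖x‖ < b) → u x = 0 := fun x hx =>
    image_eq_zero_of_notMem_tsupport fun h => hx (hsupp h)
  have hg0 : ∀ x, ¬(a < ‖x‖ ∧ ‖x‖ < b) → gradient u x = 0 := fun x hx => by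
    rw [gradient, fderiv_of_notMem_tsupport ℝ fun h => hx (hsupp h), map_zero]
  have hgc : Continuous fun x => ‖gradient u x‖ ^ 2 := by
    have := hu.continuous_fderiv one_ne_zero
    simp only [norm_gradient_sq]
    fun_prop
  have huc := hu.continuous
  have hpc := continuous_polarPt
  have hfc := continuous_fderiv_radius hu
  have hfa := continuous_fderiv_angle hu
  have hpi := pi_pos
  rw [integral_eq_polar (F := fun x => u x ^ 2) (by fun_prop) ha hab (fun x hx => by simp [hu0 x hx]),
    integral_eq_polar hgc ha hab (fun x hx => by simp [hg0 x hx]),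
    ← intervalIntegral.integral_const_mul]
  have hP : Continuous fun ρ => ∫ θ in -π..π, ‖gradient u (polarPt ρ θ)‖ ^ 2 :=
    intervalIntegral.continuous_parametric_intervalIntegral_of_continuous'
      (f := fun ρ θ => ‖gradient u (polarPt ρ θ)‖ ^ 2) (hgc.comp hpc) _ _
  have hQ : Continuous fun ρ => ∫ θ in -π..π, u (polarPt ρ θ) ^ 2 :=
    intervalIntegral.continuous_parametric_intervalIntegral_of_continuous'
      (f := fun ρ θ => u (polarPt ρ θ) ^ 2) ((continuous_pow 2).comp (huc.comp hpc)) _ _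
  rw [← sub_nonneg, ← intervalIntegral.integral_sub
    (Continuous.intervalIntegrable (by fun_prop) _ _)
    (Continuous.intervalIntegrable (by fun_prop) _ _)]
  let q : (ℝ → ℝ) → ℤ → ℝ → ℝ := fun v n ρ =>
    ρ * deriv v ρ ^ 2 + (n ^ 2 / ρ - s ^ 2 * ρ) * v ρ ^ 2
  have hq : ∀ v : ℝ → ℝ, ContDiff ℝ 1 v → ∀ n, IntervalIntegrable (q v n) volume a b := by
    intro v hv n
    have h1 : Continuous (deriv v) := hv.continuous_deriv le_rfl
    have h2 : Continuous v := hv.continuous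
    have h3 : ContinuousOn (fun x : ℝ => (n : ℝ) ^ 2 / x) (Set.uIcc a b) :=
      continuousOn_const.div continuousOn_id fun x hx => by
        rw [Set.uIcc_of_le hab] at hx
        exact (ha.trans_le hx.1).ne'
    refine ContinuousOn.intervalIntegrable ?_
    fun_prop
  have hcp := fun n => hq _ (contDiff_cosProfile hu n) n
  have hsp := fun n => hq _ (contDiff_sinProfile hu n) n
  have hsum : 0 ≤ ∫ ρ in a..b, ∑ n ∈ Finset.Icc (-(K : ℤ)) K,
      1 / (2 * π) * (q (cosProfile n u) n ρ + q (sinProfile n u) n ρ) := by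
    rw [intervalIntegral.integral_finsetSum
      fun n _ => ((hcp n).add (hsp n)).const_mul (1 / (2 * π))]
    refine Finset.sum_nonneg fun n hn => ?_
    rw [intervalIntegral.integral_const_mul, intervalIntegral.integral_add (hcp n) (hsp n),
      ← modeForm_comp_div _ _ _ hs, ← modeForm_comp_div _ _ _ hs]
    have := hcos n hn
    have := hsin n hn
    positivity
  refine hsum.trans (intervalIntegral.integral_mono_on hab ?_
    (Continuous.intervalIntegrable (by fun_prop) _ _) fun ρ hρ => ?_)
  · simpa only [Finset.sum_fn] using IntervalIntegrable.sum _ fun n _ =>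
      ((hcp n).add (hsp n)).const_mul (1 / (2 * π))
  have hρ0 : 0 < ρ := ha.trans_le hρ.1
  have hgr := (continuous_fderiv_radius hu).comp (by fun_prop : Continuous fun θ : ℝ => (ρ, θ))
  have hga := (continuous_fderiv_angle hu).comp (by fun_prop : Continuous fun θ : ℝ => (ρ, θ))
  have key := sum_moments_le (hasDerivAt_comp_polarPt_angle hu ρ) hga
    (by rw [polarPt_pi]) hgr hρ0 (Λ := s ^ 2) (K := K) (by
      refine le_trans ?_ hK
      rw [← mul_pow]
      have := hρ.2
      gcongr)
  have hI : (∫ θ in -π..π, (fderiv ℝ u (polarPt ρ θ) !₂[cos θ, sin θ] ^ 2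
        + fderiv ℝ u (polarPt ρ θ) !₂[-(ρ * sin θ), ρ * cos θ] ^ 2 / ρ ^ 2
        - s ^ 2 * u (polarPt ρ θ) ^ 2))
      = (∫ θ in -π..π, ‖gradient u (polarPt ρ θ)‖ ^ 2)
        - s ^ 2 * ∫ θ in -π..π, u (polarPt ρ θ) ^ 2 := by
    rw [← intervalIntegral.integral_const_mul, ← intervalIntegral.integral_sub]
    · refine intervalIntegral.integral_congr fun θ _ => ?_
      simp only [norm_gradient_sq_polar u hρ0.ne' θ]
    · exact (hgc.comp
        (hpc.comp (by fun_prop : Continuous fun θ : ℝ => (ρ, θ)))).intervalIntegrable _ _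
    · exact (((continuous_comp_polarPt huc ρ).pow 2).const_mul _).intervalIntegrable _ _
  have key' := mul_le_mul_of_nonneg_left (key.trans_eq hI) hρ0.le
  rw [Finset.mul_sum] at key'
  refine (Finset.sum_congr rfl fun n _ => ?_).trans_le (key'.trans_eq (by ring))
  simp only [q, (hasDerivAt_cosProfile hu n ρ).deriv, (hasDerivAt_sinProfile hu n ρ).deriv]
  simp only [cosProfile, sinProfile, Function.comp_def]
  field_simp
  ring

end Energy

/-- Fewer linear functionals than the dimension have a common nonzero zero. -/
lemma exists_ne_zero_forall_eq_zero {E : Type*} [AddCommGroup E] [Module ℝ E]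
    [FiniteDimensional ℝ E] (T : Finset (E →ₗ[ℝ] ℝ)) (hT : T.card < Module.finrank ℝ E) :
    ∃ u : E, u ≠ 0 ∧ ∀ L ∈ T, L u = 0 := by
  have h : LinearMap.ker (LinearMap.pi fun L : T => (L : E →ₗ[ℝ] ℝ)) ≠ ⊥ :=
    LinearMap.ker_ne_bot_of_finrank_lt (by simpa using hT)
  obtain ⟨u, hu, hu0⟩ := Submodule.exists_mem_ne_zero_of_ne_bot h
  exact ⟨u, hu0, fun L hL => congrFun (LinearMap.mem_ker.1 hu) ⟨L, hL⟩⟩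

/-- Pairing the trace on a circle with a fixed weight is linear. -/
lemma exists_linearMap_polar {E : Submodule ℝ (EuclideanSpace ℝ (Fin 2) → ℝ)}
    (hE : ∀ u ∈ E, Continuous u) {w : ℝ → ℝ} (hw : Continuous w) (ρ : ℝ) :
    ∃ L : E →ₗ[ℝ] ℝ, ∀ u : E, L u = ∫ θ in -π..π, (u : _ → ℝ) (polarPt ρ θ) * w θ := by
  refine ⟨⟨⟨fun u => ∫ θ in -π..π, (u : _ → ℝ) (polarPt ρ θ) * w θ, ?_⟩, ?_⟩, fun u => rfl⟩
  · intro u v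
    have hu : Continuous fun θ => (u : _ → ℝ) (polarPt ρ θ) * w θ :=
      (continuous_comp_polarPt (hE u u.2) ρ).mul hw
    have hv : Continuous fun θ => (v : _ → ℝ) (polarPt ρ θ) * w θ :=
      (continuous_comp_polarPt (hE v v.2) ρ).mul hw
    rw [← intervalIntegral.integral_add (hu.intervalIntegrable _ _) (hv.intervalIntegrable _ _)]
    exact intervalIntegral.integral_congr fun θ _ => by simp [add_mul]
  · intro c u
    simp only [RingHom.id_apply, smul_eq_mul]
    rw [← intervalIntegral.integral_const_mul]
    exact intervalIntegral.integral_congr fun θ _ => by simp [mul_assoc]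

lemma modeForm_intCast (n : ℤ) (α β : ℝ) (v : ℝ → ℝ) :
    modeForm n α β v = modeForm (n.natAbs : ℕ) α β v := by
  simp only [modeForm, Nat.cast_natAbs, Int.cast_abs, sq_abs]

lemma cosProfile_natAbs (n : ℤ) (u : EuclideanSpace ℝ (Fin 2) → ℝ) (ρ : ℝ) :
    cosProfile n u ρ = cosProfile (n.natAbs : ℕ) u ρ := by
  rcases Int.natAbs_eq n with h | h
  · rw [← h]
  · generalize n.natAbs = m at h
    subst h
    simp [cosProfile, cosMoment]

lemma sinProfile_eq_zero_of_natAbs {n : ℤ} {u : EuclideanSpace ℝ (Fin 2) → ℝ} {ρ : ℝ}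
    (h : n ≠ 0 → sinProfile (n.natAbs : ℕ) u ρ = 0) : sinProfile n u ρ = 0 := by
  by_cases hn : n = 0
  · simp [sinProfile, sinMoment, hn]
  replace h := h hn
  rcases Int.natAbs_eq n with h' | h'
  · rwa [← h'] at h
  · generalize n.natAbs = m at h h'
    subst h'
    simpa [sinProfile, sinMoment] using h

/-- A bound for the mode form on a larger interval restricts to functions that vanish on the
added part. -/
lemma modeForm_nonneg_of_extend {m a' a b : ℝ} (ha' : 0 < a') (haa : a' ≤ a) (hab : a ≤ b)
    {v : ℝ → ℝ} (hv : ContDiff ℝ 1 v) (hv0 : ∀ x ∈ Set.Ioc 0 a, v x = 0)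
    (h : 0 ≤ modeForm m a' b v) : 0 ≤ modeForm m a b v := by
  rw [modeForm_add ha' haa hab hv] at h
  have h0 : modeForm m a' a v = 0 := by
    rw [modeForm, intervalIntegral.integral_of_le haa, integral_Ioc_eq_integral_Ioo]
    refine setIntegral_eq_zero_of_forall_eq_zero fun x hx => ?_
    have hx0 : 0 < x := ha'.trans hx.1
    have : v =ᶠ[nhds x] fun _ => 0 := by
      filter_upwards [Ioo_mem_nhds hx0 hx.2] with y hy
      exact hv0 y ⟨hy.1, hy.2.le⟩
    rw [this.deriv_eq, hv0 x ⟨hx0, hx.2.le⟩]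
    simp
  linarith

/-- Any `k`-dimensional space of test functions on the annulus contains a nonzero function with
Rayleigh quotient at least `s ^ 2`, once `k` exceeds the Weyl counting term of `s ^ 2`. -/
lemma exists_mem_sq_mul_integral_sq_le {r R s : ℝ} {k : ℕ} (hr : 0 < r) (hrR : r < R) (hs : 0 < s)
    (hk : s ^ 2 * (R ^ 2 - r ^ 2) / 4 < k) {E : Submodule ℝ (EuclideanSpace ℝ (Fin 2) → ℝ)}
    [FiniteDimensional ℝ E] (hEk : Module.finrank ℝ E = k)
    (hE : ∀ u ∈ E, ContDiff ℝ 1 u ∧ tsupport u ⊆ {x | r < ‖x‖ ∧ ‖x‖ < R}) :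
    ∃ u ∈ E, u ≠ 0 ∧ s ^ 2 * ∫ x, u x ^ 2 ≤ ∫ x, ‖gradient u x‖ ^ 2 := by
  classical
  have ha : 0 < s * r := by positivity
  have hab : s * r < s * R := by gcongr
  obtain ⟨n, hn, hsum⟩ := exists_mode_counts ha hab
  choose a' ha' haa S hcard hS using fun m => exists_nonnegModulo m ha hab (hn m)
  obtain ⟨K, hK⟩ : ∃ K : ℕ, s * R ≤ K := exists_nat_ge _
  have hEc : ∀ u ∈ E, Continuous u := fun u hu => (hE u hu).1.continuous
  choose Lc hLc using fun (m : ℕ) (x : ℝ) => exists_linearMap_polar hEc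
    (w := fun θ => cos (((m : ℤ) : ℝ) * θ)) (by fun_prop) (x / s)
  choose Ls hLs using fun (m : ℕ) (x : ℝ) => exists_linearMap_polar hEc
    (w := fun θ => sin (((m : ℤ) : ℝ) * θ)) (by fun_prop) (x / s)
  let T : Finset (E →ₗ[ℝ] ℝ) := (S 0).image (Lc 0) ∪
    (Finset.Icc 1 K).biUnion fun m => (S m).image (Lc m) ∪ (S m).image (Ls m)
  have hT : T.card ≤ n 0 + 2 * ∑ i ∈ Finset.Icc 1 K, n i := by
    refine (Finset.card_union_le _ _).trans
      (add_le_add (Finset.card_image_le.trans (hcard 0)) ?_)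
    rw [Finset.mul_sum]
    refine Finset.card_biUnion_le.trans (Finset.sum_le_sum fun m _ => ?_)
    refine (Finset.card_union_le _ _).trans ?_
    have h1 := (Finset.card_image_le (f := Lc m)).trans (hcard m)
    have h2 := (Finset.card_image_le (f := Ls m)).trans (hcard m)
    omega
  have hTk : T.card < Module.finrank ℝ E := by
    rw [hEk]
    have h1 : (T.card : ℝ) ≤ ((n 0 + 2 * ∑ i ∈ Finset.Icc 1 K, n i : ℕ) : ℝ) := by
      exact_mod_cast hT
    have h2 := hsum K
    have : (T.card : ℝ) < k := by
      rw [mul_pow, mul_pow, ← mul_sub] at h2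
      linarith
    exact_mod_cast this
  obtain ⟨⟨u, huE⟩, hu0, huT⟩ := exists_ne_zero_forall_eq_zero T hTk
  have hu := (hE u huE).1
  have hout : ∀ ρ, 0 ≤ ρ → (ρ ≤ r ∨ R ≤ ρ) → ∀ θ, u (polarPt ρ θ) = 0 := by
    intro ρ hρ h θ
    refine image_eq_zero_of_notMem_tsupport fun h' => ?_
    have := (hE u huE).2 h'
    rw [Set.mem_ofPred_eq, norm_polarPt hρ] at this
    rcases h with h | h <;> linarith [this.1, this.2]
  have hcos0 : ∀ (n : ℤ) (ρ : ℝ), 0 ≤ ρ → (ρ ≤ r ∨ R ≤ ρ) → cosProfile n u ρ = 0 := by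
    intro n ρ hρ h
    simp [cosProfile, cosMoment, hout ρ hρ h]
  have hsin0 : ∀ (n : ℤ) (ρ : ℝ), 0 ≤ ρ → (ρ ≤ r ∨ R ≤ ρ) → sinProfile n u ρ = 0 := by
    intro n ρ hρ h
    simp [sinProfile, sinMoment, hout ρ hρ h]
  have hcosT : ∀ m ≤ K, ∀ x ∈ S m, cosProfile (m : ℕ) u (x / s) = 0 := by
    intro m hm x hx
    refine (hLc m x ⟨u, huE⟩).symm.trans (huT _ ?_)
    rcases Nat.eq_zero_or_pos m with rfl | hm0
    · exact Finset.mem_union_left _ (Finset.mem_image_of_mem _ hx)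
    · exact Finset.mem_union_right _ (Finset.mem_biUnion.2 ⟨m, Finset.mem_Icc.2 ⟨hm0, hm⟩,
        Finset.mem_union_left _ (Finset.mem_image_of_mem _ hx)⟩)
  have hsinT : ∀ m ≤ K, 1 ≤ m → ∀ x ∈ S m, sinProfile (m : ℕ) u (x / s) = 0 := by
    intro m hm hm0 x hx
    refine (hLs m x ⟨u, huE⟩).symm.trans (huT _ ?_)
    exact Finset.mem_union_right _ (Finset.mem_biUnion.2 ⟨m, Finset.mem_Icc.2 ⟨hm0, hm⟩,
      Finset.mem_union_right _ (Finset.mem_image_of_mem _ hx)⟩)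
  have hmain : ∀ (m : ℕ) (v : ℝ → ℝ), ContDiff ℝ 1 v →
      (∀ ρ, 0 ≤ ρ → (ρ ≤ r ∨ R ≤ ρ) → v ρ = 0) → (∀ x ∈ S m, v (x / s) = 0) →
      0 ≤ modeForm m (s * r) (s * R) fun x => v (x / s) := by
    intro m v hv hv0 hvS
    have hv' : ContDiff ℝ 1 fun x => v (x / s) := hv.comp (contDiff_id.div_const s)
    have hin : ∀ x ∈ Set.Ioc 0 (s * r), v (x / s) = 0 := fun x hx =>
      hv0 _ (div_nonneg hx.1.le hs.le) (Or.inl ((div_le_iff₀' hs).2 hx.2))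
    refine modeForm_nonneg_of_extend (ha' m) (haa m) hab.le hv' hin ?_
    refine hS m _ hv' (hin _ ⟨ha' m, haa m⟩) ?_ hvS
    have hR : 0 ≤ R := by linarith
    rw [mul_div_cancel_left₀ _ hs.ne']
    exact hv0 R hR (Or.inr le_rfl)
  refine ⟨u, huE, fun h => hu0 (Subtype.ext h), sq_mul_integral_sq_le hu hr hrR.le hs
    (hE u huE).2 (K := K) ?_ ?_ ?_⟩
  · have : 0 ≤ s * R := by linarith
    gcongr
    linarith
  · intro n hn
    have hnK : n.natAbs ≤ K := by
      rw [Finset.mem_Icc] at hn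
      omega
    rw [modeForm_intCast]
    refine hmain _ _ (contDiff_cosProfile hu n) (hcos0 n) fun x hx => ?_
    rw [cosProfile_natAbs]
    exact hcosT _ hnK x hx
  · intro n hn
    have hnK : n.natAbs ≤ K := by
      rw [Finset.mem_Icc] at hn
      omega
    rw [modeForm_intCast]
    refine hmain _ _ (contDiff_sinProfile hu n) (hsin0 n) fun x hx => ?_
    exact sinProfile_eq_zero_of_natAbs fun h0 => hsinT _ hnK (by omega) x hx

/-- A linear map on a finite-dimensional space is bounded relative to any injective one. -/
lemma exists_norm_le_mul_norm {E F G : Type*} [AddCommGroup E] [Module ℝ E]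
    [FiniteDimensional ℝ E] [NormedAddCommGroup F] [NormedSpace ℝ F] [NormedAddCommGroup G]
    [NormedSpace ℝ G] (S : E →ₗ[ℝ] G) (T : E →ₗ[ℝ] F) (hT : Function.Injective T) :
    ∃ C, ∀ u, ‖S u‖ ≤ C * ‖T u‖ := by
  let e := LinearEquiv.ofInjective T hT
  let L := LinearMap.toContinuousLinearMap (S ∘ₗ e.symm.toLinearMap)
  refine ⟨‖L‖, fun u => ?_⟩
  have h := L.le_opNorm (e u)
  simpa [L, e] using h

lemma norm_toLp_sq {F : Type*} [NormedAddCommGroup F] [InnerProductSpace ℝ F] {α : Type*}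
    [MeasurableSpace α] {μ : Measure α} {f : α → F} (hf : MemLp f 2 μ) :
    ‖hf.toLp f‖ ^ 2 = ∫ x, ‖f x‖ ^ 2 ∂μ := by
  rw [← real_inner_self_eq_norm_sq, L2.inner_def]
  refine integral_congr_ae ?_
  filter_upwards [hf.coeFn_toLp] with x hx
  rw [hx, real_inner_self_eq_norm_sq]

section Gradient

variable {V : Type*} [NormedAddCommGroup V] [InnerProductSpace ℝ V] [CompleteSpace V]

lemma gradient_add_of_contDiff {u v : V → ℝ} (hu : ContDiff ℝ 1 u) (hv : ContDiff ℝ 1 v) :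
    gradient (u + v) = gradient u + gradient v := by
  ext1 x
  simp only [gradient, Pi.add_apply, ← map_add]
  rw [fderiv_add (hu.differentiable one_ne_zero x) (hv.differentiable one_ne_zero x)]

lemma gradient_smul_of_contDiff (c : ℝ) {u : V → ℝ} (hu : ContDiff ℝ 1 u) :
    gradient (c • u) = c • gradient u := by
  ext1 x
  rw [Pi.smul_apply, gradient, gradient,
    fderiv_const_smul (hu.differentiable one_ne_zero x) c]
  simp

lemma memLp_gradient [MeasurableSpace V] [BorelSpace V] [FiniteDimensional ℝ V]
    {μ : Measure V} [IsFiniteMeasureOnCompacts μ] {u : V → ℝ} (hu : ContDiff ℝ 1 u)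
    (hc : HasCompactSupport u) : MemLp (gradient u) 2 μ := by
  have h1 : Continuous (gradient u) :=
    (InnerProductSpace.toDual ℝ V).symm.continuous.comp (hu.continuous_fderiv one_ne_zero)
  exact h1.memLp_of_hasCompactSupport ((hc.fderiv ℝ).comp_left (map_zero _))

end Gradient

/-- On a finite-dimensional space of test functions the Dirichlet energy is bounded by a multiple
of the `L²` norm. -/
lemma exists_integral_gradient_le {E : Submodule ℝ (EuclideanSpace ℝ (Fin 2) → ℝ)}
    [FiniteDimensional ℝ E] (hE : ∀ u ∈ E, ContDiff ℝ 1 u ∧ HasCompactSupport u) :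
    ∃ C : ℝ, ∀ u ∈ E, ∫ x, ‖gradient u x‖ ^ 2 ≤ C * ∫ x, u x ^ 2 := by
  have hu : ∀ u : E, MemLp (u : EuclideanSpace ℝ (Fin 2) → ℝ) 2 volume := fun u =>
    (hE u u.2).1.continuous.memLp_of_hasCompactSupport (hE u u.2).2
  have hg : ∀ u : E, MemLp (gradient (u : EuclideanSpace ℝ (Fin 2) → ℝ)) 2 volume := fun u =>
    memLp_gradient (hE u u.2).1 (hE u u.2).2
  let T : E →ₗ[ℝ] Lp ℝ 2 (volume : Measure (EuclideanSpace ℝ (Fin 2))) :=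
    { toFun := fun u => (hu u).toLp _
      map_add' := fun u v => (hu u).toLp_add (hu v)
      map_smul' := fun c u => (hu u).toLp_const_smul c }
  let S : E →ₗ[ℝ] Lp (EuclideanSpace ℝ (Fin 2)) 2
      (volume : Measure (EuclideanSpace ℝ (Fin 2))) :=
    { toFun := fun u => (hg u).toLp _
      map_add' := fun u v => by
        rw [← (hg u).toLp_add (hg v)]
        congr 1
        exact gradient_add_of_contDiff (hE u u.2).1 (hE v v.2).1
      map_smul' := fun c u => by
        rw [RingHom.id_apply, ← (hg u).toLp_const_smul c]
        congr 1
        exact gradient_smul_of_contDiff c (hE u u.2).1 }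
  have hT : Function.Injective T := by
    intro u v h
    have h' : (u : EuclideanSpace ℝ (Fin 2) → ℝ) =ᵐ[volume] v :=
      ((hu u).toLp_eq_toLp_iff (hu v)).1 h
    exact Subtype.ext (Continuous.ae_eq_iff_eq volume (hE u u.2).1.continuous
      (hE v v.2).1.continuous |>.1 h')
  obtain ⟨C, hC⟩ := exists_norm_le_mul_norm S T hT
  refine ⟨C ^ 2, fun u huE => ?_⟩
  have h := pow_le_pow_left₀ (norm_nonneg _) (hC ⟨u, huE⟩) 2
  have h1 : ‖S ⟨u, huE⟩‖ ^ 2 = ∫ x, ‖gradient u x‖ ^ 2 := norm_toLp_sq (hg ⟨u, huE⟩)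
  have h2 : ‖T ⟨u, huE⟩‖ ^ 2 = ∫ x, ‖u x‖ ^ 2 := norm_toLp_sq (hu ⟨u, huE⟩)
  rw [mul_pow, h1, h2] at h
  simpa using h

/-- The test functions on an annulus contain subspaces of every finite dimension. -/
lemma exists_testSpace_finrank_eq {r R : ℝ} (hr : 0 < r) (hrR : r < R) {k : ℕ} (hk : 1 ≤ k) :
    ∃ E : Submodule ℝ (EuclideanSpace ℝ (Fin 2) → ℝ), Module.finrank ℝ E = k ∧
      ∀ u ∈ E, ContDiff ℝ (⊤ : ℕ∞) u ∧ HasCompactSupport u ∧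
        tsupport u ⊆ {x | r < ‖x‖ ∧ ‖x‖ < R} := by
  have hk0 : (0 : ℝ) < k := by exact_mod_cast hk
  set δ := (R - r) / (4 * k) with hδ
  have hδ0 : 0 < δ := div_pos (by linarith) (by positivity)
  have hR : R = r + 4 * k * δ := by
    rw [hδ]
    field_simp
    ring
  let p : Fin k → ℝ := fun i => r + (4 * i + 2) * δ
  have hp0 : ∀ i, 0 ≤ p i := fun i => by positivity
  let φ : ∀ i : Fin k, ContDiffBump (polarPt (p i) 0) := fun i =>
    ⟨δ / 2, δ, by positivity, by linarith⟩
  have hφ1 : ∀ i, φ i (polarPt (p i) 0) = 1 := fun i =>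
    (φ i).one_of_mem_closedBall (Metric.mem_closedBall_self (by positivity))
  have hφ0 : ∀ i j, i ≠ j → φ i (polarPt (p j) 0) = 0 := by
    intro i j hij
    refine (φ i).zero_of_le_dist ?_
    rw [dist_eq_norm]
    refine le_trans ?_ (abs_norm_sub_norm_le _ _)
    rw [norm_polarPt (hp0 _), norm_polarPt (hp0 _)]
    have h1 : p j - p i = 4 * δ * ((j : ℝ) - i) := by simp only [p]; ring
    have h2 : (1 : ℝ) ≤ |(j : ℝ) - i| := by
      have : (1 : ℤ) ≤ |((j : ℕ) : ℤ) - ((i : ℕ) : ℤ)| :=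
        Int.one_le_abs (sub_ne_zero.2 fun h => hij (Fin.ext (by exact_mod_cast h.symm)))
      exact_mod_cast this
    rw [h1, abs_mul, abs_of_pos (by positivity)]
    change δ ≤ _
    nlinarith
  have hind : LinearIndependent ℝ fun i => (φ i : EuclideanSpace ℝ (Fin 2) → ℝ) := by
    rw [Fintype.linearIndependent_iff]
    intro g hg j
    have h := congrFun hg (polarPt (p j) 0)
    rw [Finset.sum_apply, Finset.sum_eq_single j] at h
    · simpa [hφ1] using h
    · intro i _ hij
      simp [hφ0 i j hij]
    · simp
  refine ⟨Submodule.span ℝ (Set.range fun i => (φ i : EuclideanSpace ℝ (Fin 2) → ℝ)), ?_, ?_⟩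
  · rw [finrank_span_eq_card hind, Fintype.card_fin]
  intro u hu
  induction hu using Submodule.span_induction with
  | mem u hu =>
    obtain ⟨i, rfl⟩ := hu
    refine ⟨(φ i).contDiff, (φ i).hasCompactSupport, ?_⟩
    simp only [(φ i).tsupport_eq]
    intro x hx
    rw [Metric.mem_closedBall, dist_eq_norm] at hx
    change _ ≤ δ at hx
    have h1 := abs_le.1 ((abs_norm_sub_norm_le _ _).trans hx)
    rw [norm_polarPt (hp0 _)] at h1
    have h2 : (i : ℝ) + 1 ≤ k := by exact_mod_cast i.2
    have h3 : (0 : ℝ) ≤ i := by positivity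
    simp only [p] at h1
    constructor
    · nlinarith [h1.1]
    · rw [hR]
      nlinarith [h1.2]
  | zero =>
    refine ⟨contDiff_const, HasCompactSupport.zero, ?_⟩
    simp [tsupport]
  | add u v _ _ hu hv =>
    refine ⟨hu.1.add hv.1, hu.2.1.add hv.2.1, ?_⟩
    refine (closure_mono (Function.support_add u v)).trans ?_
    rw [closure_union]
    exact Set.union_subset hu.2.2 hv.2.2
  | smul c u _ hu =>
    refine ⟨hu.1.const_smul c, hu.2.1.smul_left (f := fun _ => c), ?_⟩
    exact (tsupport_smul_subset_right (fun _ => c) u).trans hu.2.2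

lemma volume_annulus {r R : ℝ} (hr : 0 < r) (hrR : r < R) :
    (volume {x : EuclideanSpace ℝ (Fin 2) | r < ‖x‖ ∧ ‖x‖ < R}).toReal
      = π * (R ^ 2 - r ^ 2) := by
  have h : {x : EuclideanSpace ℝ (Fin 2) | r < ‖x‖ ∧ ‖x‖ < R}
      = Metric.ball 0 R \ Metric.closedBall 0 r := by
    ext x
    simp [and_comm]
  have hsub : Metric.closedBall (0 : EuclideanSpace ℝ (Fin 2)) r ⊆ Metric.ball 0 R :=
    Metric.closedBall_subset_ball hrR
  have h' := measureReal_sdiff (μ := volume) hsub measurableSet_closedBall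
  rw [h, ← Measure.real, h', Measure.real, Measure.real, EuclideanSpace.volume_ball_fin_two,
    EuclideanSpace.volume_closedBall_fin_two]
  simp only [ENNReal.toReal_mul, ENNReal.toReal_pow, ENNReal.toReal_ofReal hr.le,
    ENNReal.toReal_ofReal (hr.trans hrR).le, ENNReal.toReal_ofReal pi_pos.le]
  ring

lemma integral_sq_pos {u : EuclideanSpace ℝ (Fin 2) → ℝ} (hu : Continuous u)
    (hc : HasCompactSupport u) (h0 : u ≠ 0) : 0 < ∫ x, u x ^ 2 := by
  obtain ⟨x, hx⟩ := Function.ne_iff.1 h0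
  have h2 : HasCompactSupport fun x => u x ^ 2 := hc.comp_left (g := fun t => t ^ 2) (by simp)
  refine Continuous.integral_pos_of_hasCompactSupport_nonneg_nonzero (x := x) (by fun_prop) h2
    (fun x => sq_nonneg _) ?_
  exact pow_ne_zero 2 hx

/-- The supremum of the Rayleigh quotients over a `k`-dimensional space of test functions on the
annulus is at least the Weyl term. -/
lemma le_sSup_rayleigh {r R : ℝ} (hr : 0 < r) (hrR : r < R) {k : ℕ} (hk : 1 ≤ k)
    {E : Submodule ℝ (EuclideanSpace ℝ (Fin 2) → ℝ)} (hEk : Module.finrank ℝ E = k)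
    (hE : ∀ u ∈ E, ContDiff ℝ (⊤ : ℕ∞) u ∧ HasCompactSupport u ∧
      tsupport u ⊆ {x : EuclideanSpace ℝ (Fin 2) | r < ‖x‖ ∧ ‖x‖ < R}) :
    4 * k / (R ^ 2 - r ^ 2) ≤ sSup {q : ℝ | ∃ u ∈ E, u ≠ (0 : EuclideanSpace ℝ (Fin 2) → ℝ) ∧
      q = (∫ x in {x : EuclideanSpace ℝ (Fin 2) | r < ‖x‖ ∧ ‖x‖ < R}, ‖gradient u x‖ ^ 2) /
        (∫ x in {x : EuclideanSpace ℝ (Fin 2) | r < ‖x‖ ∧ ‖x‖ < R}, (u x) ^ 2)} := by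
  have : FiniteDimensional ℝ E := Module.finite_of_finrank_pos (by omega)
  have hk0 : (0 : ℝ) < k := by exact_mod_cast hk
  have hD : 0 < R ^ 2 - r ^ 2 := by nlinarith
  have hE1 : ∀ u ∈ E, ContDiff ℝ 1 u := fun u hu => (hE u hu).1.of_le (by exact_mod_cast le_top)
  have hI1 : ∀ u ∈ E, ∫ x in {x : EuclideanSpace ℝ (Fin 2) | r < ‖x‖ ∧ ‖x‖ < R},
      ‖gradient u x‖ ^ 2 = ∫ x, ‖gradient u x‖ ^ 2 := by
    refine fun u hu => setIntegral_eq_integral_of_forall_compl_eq_zero fun x hx => ?_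
    rw [gradient, fderiv_of_notMem_tsupport ℝ fun h => hx ((hE u hu).2.2 h), map_zero]
    simp
  have hI2 : ∀ u ∈ E, ∫ x in {x : EuclideanSpace ℝ (Fin 2) | r < ‖x‖ ∧ ‖x‖ < R},
      u x ^ 2 = ∫ x, u x ^ 2 := by
    refine fun u hu => setIntegral_eq_integral_of_forall_compl_eq_zero fun x hx => ?_
    rw [image_eq_zero_of_notMem_tsupport fun h => hx ((hE u hu).2.2 h)]
    simp
  obtain ⟨C, hC⟩ := exists_integral_gradient_le fun u hu => ⟨hE1 u hu, (hE u hu).2.1⟩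
  have hpos : ∀ u ∈ E, u ≠ 0 → 0 < ∫ x, u x ^ 2 := fun u hu h0 =>
    integral_sq_pos (hE1 u hu).continuous (hE u hu).2.1 h0
  refine le_of_forall_lt_imp_le_of_dense fun c hc => ?_
  obtain ⟨t, hct, ht⟩ := exists_between (max_lt hc (by positivity : 0 < 4 * k / (R ^ 2 - r ^ 2)))
  have ht0 : 0 < t := (le_max_right _ _).trans_lt hct
  refine ((le_max_left _ _).trans hct.le).trans ?_
  obtain ⟨u, hu, hu0, hle⟩ := exists_mem_sq_mul_integral_sq_le hr hrR (sqrt_pos.2 ht0)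
    (by
      rw [sq_sqrt ht0.le, div_lt_iff₀ (by norm_num)]
      rw [lt_div_iff₀ hD] at ht
      linarith) hEk fun u hu => ⟨hE1 u hu, (hE u hu).2.2⟩
  rw [sq_sqrt ht0.le] at hle
  refine le_csSup_of_le ⟨C, ?_⟩ ⟨u, hu, hu0, rfl⟩ ?_
  · rintro _ ⟨v, hv, hv0, rfl⟩
    rw [hI1 v hv, hI2 v hv, div_le_iff₀ (hpos v hv hv0)]
    exact hC v hv
  · rwa [hI1 u hu, hI2 u hu, le_div_iff₀ (hpos u hu hu0)]

/-- Pólya's conjecture for Dirichlet eigenvalues on annuli: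
for `0 < r < R` and the annulus `Ω = {r < |x| < R} ⊆ ℝ²`, for every `k ≥ 1` one has
`λ_k(Ω) ≥ 4πk/|Ω| = 4k/(R² − r²)`. -/
theorem polya_dirichlet_annulus
    (r R : ℝ) (hr : 0 < r) (hrR : r < R) (k : ℕ) (hk : 1 ≤ k) :
    dirichletEig {x : EuclideanSpace ℝ (Fin 2) | r < ‖x‖ ∧ ‖x‖ < R} k ≥
        4 * π * k / (volume {x : EuclideanSpace ℝ (Fin 2) | r < ‖x‖ ∧ ‖x‖ < R}).toReal ∧
      4 * π * k / (volume {x : EuclideanSpace ℝ (Fin 2) | r < ‖x‖ ∧ ‖x‖ < R}).toReal =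
        4 * k / (R ^ 2 - r ^ 2) := by
  have hD : 0 < R ^ 2 - r ^ 2 := by nlinarith
  have hpi := pi_pos
  have hvol : 4 * π * k /
      (volume {x : EuclideanSpace ℝ (Fin 2) | r < ‖x‖ ∧ ‖x‖ < R}).toReal
        = 4 * k / (R ^ 2 - r ^ 2) := by
    rw [volume_annulus hr hrR]
    field_simp
  refine ⟨?_, hvol⟩
  rw [hvol, ge_iff_le, dirichletEig]
  refine le_csInf ?_ ?_
  · obtain ⟨E, hEk, hE⟩ := exists_testSpace_finrank_eq hr hrR hk
    exact ⟨_, E, hEk, hE, rfl⟩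
  · rintro _ ⟨E, hEk, hE, rfl⟩
    exact le_sSup_rayleigh hr hrR hk hEk hE
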